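/- For q ∈ O_K, q ≠ 0, define D(w, q; χ) = ∑_{m primary} χ(m) g(q, m) / N(m)^w and D₁(w, q) = ∑_{m primary} g(q, m²) / N(m)^{2w}. Then D(w, q; χ_1), D(w, q; χ_i) and D₁(w, q) have meromorphic continuations to the half-plane {w : Re(w) > 1}, holomorphic there except that D(w, q; χ_1) has a simple pole at w = 3/2 if q = i·(square) and D(w, q; χ_i) has a simple pole at w = 3/2 if q = square. Moreover, for Re(w) > 1+ε and away from the possible pole, |D(w, q; χ)| ≪ ((1+|w|²) N(q))^{max{(3/2−Re(w))/2, 0} + ε}. -/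

import Mathlib

open Complex Real Filter Topology
open scoped BigOperators Classical

noncomputable section

/-- The norm `N(n)` of a Gaussian integer, as a real number. -/
def Nm (n : GaussianInt) : ℝ := ((Zsqrtd.norm n : ℤ) : ℝ)

/-- The element `1 + i` of `ℤ[i]`. -/
def ωg : GaussianInt := ⟨1, 1⟩

/-- The element `i` of `ℤ[i]`. -/
def ig : GaussianInt := ⟨0, 1⟩

/-- `n` is primary: `n ≡ 1 mod (1+i)³`. -/
def IsPrimary (n : GaussianInt) : Prop := ωg ^ 3 ∣ (n - 1)

/-- `ẽ(z) = exp(2πi(z/(2i) − z̄/(2i)))`. -/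
def eT (z : ℂ) : ℂ :=
  Complex.exp (2 * (Real.pi : ℂ) * Complex.I *
    (z / (2 * Complex.I) - (starRingEnd ℂ) z / (2 * Complex.I)))

/-- `χ a n = (a/n)` is the quadratic residue symbol of `ℤ[i]`: on odd primes `ϖ` it is
the `±1` (or `0`) value determined by `(a/ϖ) ≡ a^((N(ϖ)-1)/2) mod ϖ`, it is extended
multiplicatively in the denominator over odd elements, and equals `1` on units. -/
structure IsQuadSym (χ : GaussianInt → GaussianInt → ℤ) : Prop where
  val_prime : ∀ ϖ a : GaussianInt, Prime ϖ → ¬ ωg ∣ ϖ → ¬ ϖ ∣ a →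
    (χ a ϖ = 1 ∨ χ a ϖ = -1) ∧
      ϖ ∣ (a ^ (((Zsqrtd.norm ϖ).toNat - 1) / 2) - (χ a ϖ : GaussianInt))
  zero_of_dvd : ∀ ϖ a : GaussianInt, Prime ϖ → ϖ ∣ a → χ a ϖ = 0
  mul_den : ∀ a m n : GaussianInt, ¬ ωg ∣ m → ¬ ωg ∣ n → χ a (m * n) = χ a m * χ a n
  unit_den : ∀ a u : GaussianInt, IsUnit u → χ a u = 1

/-- `L s m = L(s, χ_m)`: the Hecke `L`-function attached to the quadratic symbol `(m/·)`,
given by its Dirichlet series over primary elements (= odd ideals) for `Re s > 1`,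
and analytic away from `s = 1`. -/
def IsHeckeL (χ : GaussianInt → GaussianInt → ℤ) (L : ℂ → GaussianInt → ℂ) : Prop :=
  (∀ (m : GaussianInt) (s : ℂ), 1 < s.re →
      L s m = ∑' n : {n : GaussianInt // IsPrimary n}, (χ m n.1 : ℂ) / (Nm n.1 : ℂ) ^ s) ∧
    ∀ m : GaussianInt, DifferentiableOn ℂ (fun s => L s m) {s : ℂ | s ≠ 1}

/-- The generalized Riemann hypothesis for the family of quadratic Hecke `L`-functions. -/
def GRHfor (L : ℂ → GaussianInt → ℂ) : Prop :=
  ∀ m : GaussianInt, m ≠ 0 → ∀ s : ℂ, 0 < s.re → s.re < 1 → L s m = 0 → s.re = 1 / 2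

/-- The absolute norm of an ideal of `ℤ[i]`, as a complex number. -/
def idN (I : Ideal GaussianInt) : ℂ := (Nat.card (GaussianInt ⧸ I) : ℂ)

/-- The Dedekind zeta function of `ℚ(i)`. -/
def IsDedekindZetaK (Z : ℂ → ℂ) : Prop :=
  (∀ s : ℂ, 1 < s.re → Z s = ∑' I : {I : Ideal GaussianInt // I ≠ ⊥}, idN I.1 ^ (-s)) ∧
    DifferentiableOn ℂ Z {s : ℂ | s ≠ 1}

/-- `ζ_K^{(2)}`: the Euler product of `ζ_K` with the factor at the prime `(1+i)` omitted. -/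
def zeta2 (Z : ℂ → ℂ) (s : ℂ) : ℂ := Z s * (1 - (2 : ℂ) ^ (-s))

/-- `P(z) = ∏_ϖ (1 + ((N(ϖ)^{z-1/2} − 1)(N(ϖ) + 1))⁻¹)`, over all primes of `ℤ[i]`. -/
def Pfun (z : ℂ) : ℂ :=
  ∏' I : {I : Ideal GaussianInt // I ≠ ⊥ ∧ I.IsPrime},
    (1 + 1 / ((idN I.1 ^ (z - 1 / 2) - 1) * (idN I.1 + 1)))

/-- The Euler product over odd primes appearing in the ratios-conjecture main term. -/
def ratioEuler (α β : ℂ) : ℂ :=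
  ∏' I : {I : Ideal GaussianInt // I ≠ ⊥ ∧ I.IsPrime ∧ (2 : GaussianInt) ∉ I},
    (1 + (idN I.1 ^ (α - β) - 1) / (idN I.1 ^ (1 + α - β) * (idN I.1 ^ (1 + α + β) - 1)))

/-- `g r n` is the quadratic Gauss sum `g(r,n) = ∑_{x mod n} (x/n) ẽ(rx/n)`:
for any complete residue system `S` modulo `n` it is given by the indicated finite sum. -/
def IsGaussSum (χ : GaussianInt → GaussianInt → ℤ) (g : GaussianInt → GaussianInt → ℂ) : Prop :=
  ∀ r n : GaussianInt, n ≠ 0 → ∀ S : Finset GaussianInt,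
    (∀ z : GaussianInt, ∃! x, x ∈ S ∧ n ∣ (z - x)) →
    g r n = ∑ x ∈ S, (χ x n : ℂ) * eT (GaussianInt.toComplex (r * x) / GaussianInt.toComplex n)

/-- A Dirichlet character modulo `q` on `ℤ[i]` (extended by zero). -/
def IsDirichletChar (q : GaussianInt) (χ : GaussianInt → ℂ) : Prop :=
  χ 1 = 1 ∧ (∀ a b : GaussianInt, χ (a * b) = χ a * χ b) ∧
    (∀ a b : GaussianInt, q ∣ (a - b) → χ a = χ b) ∧
    (∀ a : GaussianInt, IsCoprime a q → ‖χ a‖ = 1) ∧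
    (∀ a : GaussianInt, ¬ IsCoprime a q → χ a = 0)

/-- The Gauss sum `g(r,χ) = ∑_{x mod q} χ(x) ẽ(rx/q)` of a Dirichlet character modulo `q`. -/
def IsGaussSumChar (q : GaussianInt) (χ : GaussianInt → ℂ) (g : GaussianInt → ℂ) : Prop :=
  ∀ r : GaussianInt, ∀ S : Finset GaussianInt,
    (∀ z : GaussianInt, ∃! x, x ∈ S ∧ q ∣ (z - x)) →
    g r = ∑ x ∈ S, χ x * eT (GaussianInt.toComplex (r * x) / GaussianInt.toComplex q)

/-- A primary `n = a + bi` is of type 1 if `a ≡ 1, b ≡ 0 (mod 4)` (else it is of type 2). -/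
def IsTypeOne (n : GaussianInt) : Prop := n.re % 4 = 1 ∧ n.im % 4 = 0

/-- `ψ₁`, the principal character modulo `2` on `ℤ[i]`. -/
def psi1 (m : GaussianInt) : ℂ := if IsCoprime m 2 then 1 else 0

/-- `ψ₂`, the primitive quadratic character modulo `2` on `ℤ[i]`:
`ψ₂(m) = 1` for `m ≡ 1 (mod 2)`, `ψ₂(m) = −1` for `m ≡ i (mod 2)`, and `0` otherwise. -/
def psi2 (m : GaussianInt) : ℂ :=
  if (2 : GaussianInt) ∣ (m - 1) then 1 else if (2 : GaussianInt) ∣ (m - ig) then -1 else 0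

/-- `χ̃_n = ψ_j · (·/n)`, where `j` is the type of the primary element `n`. -/
def tchi (χ : GaussianInt → GaussianInt → ℤ) (n m : GaussianInt) : ℂ :=
  (if IsTypeOne n then psi1 m else psi2 m) * (χ m n : ℂ)

/-! ### Basic facts on Gaussian integers -/

lemma omega_dvd_iff (n : GaussianInt) : ωg ∣ n ↔ (n.re + n.im) % 2 = 0 := by
  constructor
  · rintro ⟨k, rfl⟩
    simp [ωg, Zsqrtd.re_mul, Zsqrtd.im_mul]
    omega
  · intro h
    refine ⟨⟨(n.re + n.im) / 2, (n.im - n.re) / 2⟩, ?_⟩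
    ext <;> simp [ωg, Zsqrtd.re_mul, Zsqrtd.im_mul] <;> omega

lemma omega_cube : ωg ^ 3 = ⟨-2, 2⟩ := by
  ext <;> simp [ωg, pow_succ, Zsqrtd.re_mul, Zsqrtd.im_mul]

lemma isPrimary_iff (n : GaussianInt) :
    IsPrimary n ↔ n.im % 2 = 0 ∧ (n.re + n.im) % 4 = 1 := by
  unfold IsPrimary
  rw [omega_cube]
  constructor
  · rintro ⟨k, hk⟩
    have h1 := congrArg Zsqrtd.re hk
    have h2 := congrArg Zsqrtd.im hk
    simp [Zsqrtd.re_mul, Zsqrtd.im_mul] at h1 h2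
    omega
  · rintro ⟨h1, h2⟩
    refine ⟨⟨(n.im - (n.re - 1)) / 4, (-n.im - (n.re - 1)) / 4⟩, ?_⟩
    ext <;> simp [Zsqrtd.re_mul, Zsqrtd.im_mul] <;> omega

lemma isPrimary_one : IsPrimary 1 := by simp [isPrimary_iff]

lemma IsPrimary.mul {m n : GaussianInt} (hm : IsPrimary m) (hn : IsPrimary n) :
    IsPrimary (m * n) := by
  unfold IsPrimary at *
  have : m * n - 1 = m * (n - 1) + (m - 1) := by ring
  rw [this]
  exact dvd_add (Dvd.dvd.mul_left hn _) hm

lemma IsPrimary.pow {m : GaussianInt} (hm : IsPrimary m) (k : ℕ) : IsPrimary (m ^ k) := by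
  induction k with
  | zero => simpa using isPrimary_one
  | succ k ih => rw [pow_succ]; exact ih.mul hm

lemma IsPrimary.not_omega_dvd {m : GaussianInt} (hm : IsPrimary m) : ¬ ωg ∣ m := by
  rw [isPrimary_iff] at hm
  rw [omega_dvd_iff]; omega

lemma prime_omega : Prime ωg := by
  have hn : (Zsqrtd.norm ωg).natAbs = 2 := by simp [ωg, Zsqrtd.norm]
  rw [← irreducible_iff_prime]
  constructor
  · intro h
    rw [Zsqrtd.isUnit_iff_norm_isUnit, Int.isUnit_iff_natAbs_eq, hn] at h
    omega
  · intro a b hab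
    rw [hab, Zsqrtd.norm_mul, Int.natAbs_mul] at hn
    have := (Nat.prime_mul_iff.1 (hn ▸ Nat.prime_two))
    rw [Zsqrtd.isUnit_iff_norm_isUnit, Zsqrtd.isUnit_iff_norm_isUnit, Int.isUnit_iff_natAbs_eq,
      Int.isUnit_iff_natAbs_eq]
    tauto

lemma IsPrimary.of_mul {m n : GaussianInt} (hm : IsPrimary m) (hmn : IsPrimary (m * n)) :
    IsPrimary n := by
  unfold IsPrimary at *
  have : n - 1 = (m * n - 1) - (m - 1) * n := by ring
  rw [this]
  exact dvd_sub hmn (Dvd.dvd.mul_right hm _)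

lemma IsPrimary.ne_zero {m : GaussianInt} (hm : IsPrimary m) : m ≠ 0 := by
  rintro rfl; exact hm.not_omega_dvd (dvd_zero _)

lemma norm_def' (n : GaussianInt) : Zsqrtd.norm n = n.re ^ 2 + n.im ^ 2 := by
  simp [Zsqrtd.norm]; ring

lemma isUnit_cases {u : GaussianInt} (hu : IsUnit u) : u = 1 ∨ u = -1 ∨ u = ig ∨ u = -ig := by
  rw [Zsqrtd.isUnit_iff_norm_isUnit, Int.isUnit_iff] at hu
  rcases u with ⟨a, b⟩
  rw [norm_def'] at hu
  simp only at hu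
  have hu' : a ^ 2 + b ^ 2 ≤ 1 := by omega
  have ha : a ≤ 1 := by nlinarith [sq_nonneg b]
  have ha' : -1 ≤ a := by nlinarith [sq_nonneg b]
  have hb : b ≤ 1 := by nlinarith [sq_nonneg a]
  have hb' : -1 ≤ b := by nlinarith [sq_nonneg a]
  interval_cases a <;> interval_cases b <;> simp [ig, Zsqrtd.ext_iff] at *

lemma isUnit_ig : IsUnit ig := by
  rw [Zsqrtd.isUnit_iff_norm_isUnit]; simp [ig, Zsqrtd.norm]

lemma ig_sq : ig ^ 2 = -1 := by
  ext <;> simp [ig, pow_succ, Zsqrtd.re_mul, Zsqrtd.im_mul]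

lemma IsPrimary.eq_one_of_isUnit {m : GaussianInt} (hm : IsPrimary m) (hu : IsUnit m) :
    m = 1 := by
  rw [isPrimary_iff] at hm
  rcases isUnit_cases hu with rfl | rfl | rfl | rfl <;> simp [ig] at hm ⊢

lemma IsPrimary.eq_of_associated {m n : GaussianInt} (hm : IsPrimary m) (hn : IsPrimary n)
    (h : Associated m n) : m = n := by
  obtain ⟨u, hu⟩ := h
  have h1 : IsPrimary (u : GaussianInt) := hm.of_mul (hu ▸ hn)
  rw [h1.eq_one_of_isUnit u.isUnit] at hu
  simpa using hu

lemma exists_primary_unit {n : GaussianInt} (hn : ¬ ωg ∣ n) : ∃ u, IsUnit u ∧ IsPrimary (u * n) := by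
  rw [omega_dvd_iff] at hn
  have : (IsPrimary (1 * n) ∨ IsPrimary (-1 * n)) ∨ IsPrimary (ig * n) ∨ IsPrimary (-ig * n) := by
    simp only [isPrimary_iff]
    simp [ig, Zsqrtd.re_mul, Zsqrtd.im_mul]
    omega
  rcases this with (h | h) | h | h
  · exact ⟨_, isUnit_one, h⟩
  · exact ⟨_, isUnit_one.neg, h⟩
  · exact ⟨_, isUnit_ig, h⟩
  · exact ⟨_, isUnit_ig.neg, h⟩

lemma IsPrimary.norm_mod_four {m : GaussianInt} (hm : IsPrimary m) : Zsqrtd.norm m % 4 = 1 := by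
  rw [isPrimary_iff] at hm
  obtain ⟨h1, h2⟩ := hm
  obtain ⟨b, hb⟩ : ∃ b, m.im = 2 * b := ⟨m.im / 2, by omega⟩
  obtain ⟨a, ha⟩ : ∃ a, m.re = 2 * a + 1 := ⟨m.re / 2, by omega⟩
  have : Zsqrtd.norm m = 4 * (a ^ 2 + a + b ^ 2) + 1 := by rw [norm_def', ha, hb]; ring
  omega

lemma norm_pos' {m : GaussianInt} (hm : m ≠ 0) : 1 ≤ Zsqrtd.norm m :=
  GaussianInt.norm_pos.2 hm

lemma norm_eq_one_iff_isUnit {m : GaussianInt} : Zsqrtd.norm m = 1 ↔ IsUnit m := by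
  rw [Zsqrtd.isUnit_iff_norm_isUnit, Int.isUnit_iff]
  have := GaussianInt.norm_nonneg m
  omega

lemma IsPrimary.five_le_norm {m : GaussianInt} (hm : IsPrimary m) (h1 : m ≠ 1) :
    5 ≤ Zsqrtd.norm m := by
  have h2 := norm_pos' hm.ne_zero
  have h3 := hm.norm_mod_four
  by_contra h
  have : Zsqrtd.norm m = 1 := by omega
  exact h1 (hm.eq_one_of_isUnit (norm_eq_one_iff_isUnit.1 this))

lemma Nm_mul (m n : GaussianInt) : Nm (m * n) = Nm m * Nm n := by
  simp [Nm, Zsqrtd.norm_mul]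

lemma Nm_one : Nm 1 = 1 := by simp [Nm]

lemma Nm_pow (m : GaussianInt) (k : ℕ) : Nm (m ^ k) = Nm m ^ k := by
  induction k with
  | zero => simp [Nm_one]
  | succ k ih => rw [pow_succ, Nm_mul, ih, pow_succ]

lemma one_le_Nm {m : GaussianInt} (hm : m ≠ 0) : 1 ≤ Nm m := by
  unfold Nm; exact_mod_cast norm_pos' hm

lemma Nm_nonneg (m : GaussianInt) : 0 ≤ Nm m := by
  unfold Nm; exact_mod_cast GaussianInt.norm_nonneg m

lemma Nm_pos {m : GaussianInt} (hm : m ≠ 0) : 0 < Nm m := lt_of_lt_of_le one_pos (one_le_Nm hm)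

lemma Nm_eq_normSq (m : GaussianInt) : Nm m = Complex.normSq (GaussianInt.toComplex m) := by
  unfold Nm; rw [GaussianInt.intCast_real_norm]

lemma Nm_eq_norm_sq (m : GaussianInt) : Nm m = ‖GaussianInt.toComplex m‖ ^ 2 := by
  rw [Nm_eq_normSq, Complex.normSq_eq_norm_sq]

lemma IsPrimary.five_le_Nm {m : GaussianInt} (hm : IsPrimary m) (h1 : m ≠ 1) : 5 ≤ Nm m := by
  unfold Nm; exact_mod_cast hm.five_le_norm h1

lemma Nm_le_of_dvd {m n : GaussianInt} (h : m ∣ n) (hn : n ≠ 0) : Nm m ≤ Nm n := by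
  obtain ⟨k, rfl⟩ := h
  rw [Nm_mul]
  have := one_le_Nm (right_ne_zero_of_mul hn)
  nlinarith [Nm_nonneg m]

/-- Every odd element `≠` unit is a product of primary primes: induction principle. -/
lemma primary_induction {P : GaussianInt → Prop} (h1 : P 1)
    (hmul : ∀ ϖ m, Prime ϖ → IsPrimary ϖ → IsPrimary m → P m → P (ϖ * m)) :
    ∀ m, IsPrimary m → P m := by
  have key : ∀ n : ℕ, ∀ m, IsPrimary m → (Zsqrtd.norm m).natAbs ≤ n → P m := by
    intro n
    induction n with
    | zero =>
      intro m hm h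
      have := norm_pos' hm.ne_zero
      omega
    | succ n ih =>
      intro m hm h
      by_cases hu : IsUnit m
      · rw [hm.eq_one_of_isUnit hu]; exact h1
      · obtain ⟨p, hp, k, hk⟩ := WfDvdMonoid.exists_irreducible_factor hu hm.ne_zero
        have hp' : Prime p := irreducible_iff_prime.1 hp
        have hodd : ¬ ωg ∣ p := fun h => hm.not_omega_dvd (h.trans ⟨k, hk⟩)
        obtain ⟨u, hu, hup⟩ := exists_primary_unit hodd
        obtain ⟨v, hv⟩ := hu.exists_left_inv
        have e : m = (u * p) * (v * k) := by
          rw [hk]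
          calc p * k = (v * u) * (p * k) := by rw [hv, one_mul]
            _ = _ := by ring
        have hpr : Prime (u * p) := (associated_unit_mul_left p u hu).prime_iff.2 hp'
        have hprim : IsPrimary (v * k) := hup.of_mul (e ▸ hm)
        rw [e]
        refine hmul _ _ hpr hup hprim (ih _ hprim ?_)
        have h5 := hup.five_le_norm (fun h => hpr.not_isUnit (h ▸ isUnit_one))
        have h6 := norm_pos' hprim.ne_zero
        have h7 : Zsqrtd.norm m = Zsqrtd.norm (u * p) * Zsqrtd.norm (v * k) := by
          conv_lhs => rw [e]
          rw [Zsqrtd.norm_mul]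
        have h8 : Zsqrtd.norm (v * k) < Zsqrtd.norm m := by nlinarith
        omega
  intro m hm
  exact key _ m hm le_rfl

lemma exists_primary_prime_dvd {m : GaussianInt} (hm : IsPrimary m) (h1 : m ≠ 1) :
    ∃ ϖ, Prime ϖ ∧ IsPrimary ϖ ∧ ϖ ∣ m := by
  revert h1
  refine primary_induction (P := fun m => m ≠ 1 → ∃ ϖ, Prime ϖ ∧ IsPrimary ϖ ∧ ϖ ∣ m) ?_ ?_ m hm
  · simp
  · intro ϖ m h1 h2 _ _ _
    exact ⟨ϖ, h1, h2, dvd_mul_right _ _⟩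

/-! ### Complete residue systems -/

/-- `S` is a complete residue system modulo `n`. -/
def IsRes (n : GaussianInt) (S : Finset GaussianInt) : Prop :=
  ∀ z : GaussianInt, ∃! x, x ∈ S ∧ n ∣ (z - x)

lemma IsRes.eq_of {n : GaussianInt} {S : Finset GaussianInt} (hS : IsRes n S) {x y : GaussianInt}
    (hx : x ∈ S) (hy : y ∈ S) (h : n ∣ x - y) : x = y :=
  (hS x).unique ⟨hx, by simp⟩ ⟨hy, h⟩

lemma IsRes.sum_eq {n : GaussianInt} {S T : Finset GaussianInt} (hS : IsRes n S) (hT : IsRes n T)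
    {M : Type*} [AddCommMonoid M]
    (F : GaussianInt → M) (hF : ∀ x y, n ∣ x - y → F x = F y) : ∑ x ∈ S, F x = ∑ x ∈ T, F x := by
  have hT' := hT
  choose f hf _ using hT
  refine Finset.sum_bij (fun x _ => f x) (fun x _ => (hf x).1) ?_ ?_ (fun x _ => hF _ _ (hf x).2)
  · intro x hx y hy hxy
    refine hS.eq_of hx hy ?_
    have e : x - y = (x - f x) - (y - f y) := by
      have hxy : f x = f y := hxy
      rw [hxy]; ring
    rw [e]; exact dvd_sub (hf x).2 (hf y).2
  · intro t ht
    obtain ⟨x, ⟨hx, hx2⟩, _⟩ := hS t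
    refine ⟨x, hx, ?_⟩
    refine (hT'.eq_of (hf x).1 ht ?_)
    · have e : f x - t = -((x - f x) + (t - x)) := by ring
      rw [e]; exact (dvd_add (hf x).2 hx2).neg_right

lemma IsRes.image {n : GaussianInt} {S : Finset GaussianInt} (hS : IsRes n S)
    (φ : GaussianInt → GaussianInt) (h1 : ∀ x y, n ∣ φ x - φ y → n ∣ x - y)
    (h1' : ∀ x y, n ∣ x - y → n ∣ φ x - φ y)
    (h2 : ∀ z, ∃ x, n ∣ z - φ x) : IsRes n (S.image φ) := by
  intro z
  obtain ⟨x, hx⟩ := h2 z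
  obtain ⟨y, ⟨hy, hy2⟩, _⟩ := hS x
  refine ⟨φ y, ⟨Finset.mem_image_of_mem _ hy, ?_⟩, ?_⟩
  · have : z - φ y = (z - φ x) + (φ x - φ y) := by ring
    rw [this]; exact dvd_add hx (h1' _ _ hy2)
  · rintro w ⟨hw, hw2⟩
    obtain ⟨t, ht, rfl⟩ := Finset.mem_image.1 hw
    congr 1
    refine hS.eq_of ht hy (h1 _ _ ?_)
    have : φ t - φ y = (z - φ x) + (φ x - φ y) - (z - φ t) := by ring
    rw [this]; exact dvd_sub (dvd_add hx (h1' _ _ hy2)) hw2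

/-- reindexing sums over residue systems -/
lemma IsRes.sum_comp {n : GaussianInt} {S : Finset GaussianInt} (hS : IsRes n S)
    {M : Type*} [AddCommMonoid M] (F : GaussianInt → M) (hF : ∀ x y, n ∣ x - y → F x = F y)
    (φ : GaussianInt → GaussianInt) (h1 : ∀ x y, n ∣ φ x - φ y → n ∣ x - y)
    (h1' : ∀ x y, n ∣ x - y → n ∣ φ x - φ y)
    (h2 : ∀ z, ∃ x, n ∣ z - φ x) : ∑ x ∈ S, F (φ x) = ∑ x ∈ S, F x := by
  rw [← (hS.image φ h1 h1' h2).sum_eq hS F hF, Finset.sum_image]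
  intro x hx y hy hxy
  exact hS.eq_of hx hy (h1 _ _ (by rw [hxy]; simp))

lemma IsRes.sum_add {n : GaussianInt} {S : Finset GaussianInt} (hS : IsRes n S)
    {M : Type*} [AddCommMonoid M] (F : GaussianInt → M) (hF : ∀ x y, n ∣ x - y → F x = F y)
    (a : GaussianInt) : ∑ x ∈ S, F (x + a) = ∑ x ∈ S, F x := by
  refine hS.sum_comp F hF (· + a) ?_ ?_ ?_
  · intro x y h; simpa using h
  · intro x y h; simpa using h
  · intro z; exact ⟨z - a, by simp⟩

lemma IsRes.sum_mul {n : GaussianInt} {S : Finset GaussianInt} (hS : IsRes n S)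
    {M : Type*} [AddCommMonoid M] (F : GaussianInt → M) (hF : ∀ x y, n ∣ x - y → F x = F y)
    {a : GaussianInt} (ha : IsCoprime a n) : ∑ x ∈ S, F (a * x) = ∑ x ∈ S, F x := by
  refine hS.sum_comp F hF (a * ·) ?_ ?_ ?_
  · intro x y h
    rw [← mul_sub] at h
    exact ha.symm.dvd_of_dvd_mul_left h
  · intro x y h; rw [← mul_sub]; exact Dvd.dvd.mul_left h _
  · intro z
    obtain ⟨u, v, huv⟩ := ha
    refine ⟨u * z, v * z, ?_⟩
    linear_combination (-z) * huv

lemma IsRes.mul {m n : GaussianInt} (hm0 : m ≠ 0) {S T : Finset GaussianInt} (hS : IsRes m S)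
    (hT : IsRes n T) :
    IsRes (m * n) ((S ×ˢ T).image (fun p => p.1 + m * p.2)) := by
  intro z
  obtain ⟨x, ⟨hx, k, hk⟩, _⟩ := hS z
  obtain ⟨y, ⟨hy, l, hl⟩, _⟩ := hT k
  refine ⟨x + m * y, ⟨Finset.mem_image.2 ⟨(x, y), by simp [hx, hy], rfl⟩, l, ?_⟩, ?_⟩
  · linear_combination hk + m * hl
  · rintro w ⟨hw, e, he⟩
    obtain ⟨⟨x', y'⟩, hxy, rfl⟩ := Finset.mem_image.1 hw
    simp only [Finset.mem_product] at hxy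
    simp only at he
    have h1 : x' = x := by
      refine hS.eq_of hxy.1 hx ⟨k - y' - n * e, ?_⟩
      linear_combination hk - he
    subst h1
    have h2 : y' = y := by
      refine hT.eq_of hxy.2 hy ⟨l - e, ?_⟩
      apply mul_left_cancel₀ hm0
      linear_combination hk + m * hl - he
    rw [h2]

lemma IsRes.mul_inj {m n : GaussianInt} (hm0 : m ≠ 0) {S T : Finset GaussianInt} (hS : IsRes m S)
    (hT : IsRes n T) : Set.InjOn (fun p : GaussianInt × GaussianInt => p.1 + m * p.2)
      (S ×ˢ T : Finset _) := by
  rintro ⟨x, y⟩ hxy ⟨x', y'⟩ hxy' h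
  simp only [Finset.coe_product, Set.mem_prod, Finset.mem_coe] at hxy hxy'
  simp only at h
  have h1 : x = x' := hS.eq_of hxy.1 hxy'.1 ⟨y' - y, by linear_combination h⟩
  subst h1
  have h2 : y = y' := by
    apply mul_left_cancel₀ hm0; linear_combination h
  rw [h2]

lemma IsRes.sum_mul_eq {m n : GaussianInt} (hm0 : m ≠ 0) {S T U : Finset GaussianInt}
    (hS : IsRes m S) (hT : IsRes n T) (hU : IsRes (m * n) U)
    {M : Type*} [AddCommMonoid M] (F : GaussianInt → M) (hF : ∀ x y, m * n ∣ x - y → F x = F y) :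
    ∑ x ∈ U, F x = ∑ x ∈ S, ∑ y ∈ T, F (x + m * y) := by
  rw [hU.sum_eq (hS.mul hm0 hT) F hF, Finset.sum_image (hS.mul_inj hm0 hT), Finset.sum_product]

/-- CRT reindexing -/
lemma IsRes.sum_crt {m n : GaussianInt} (hmn : IsCoprime m n) {S T U : Finset GaussianInt}
    (hS : IsRes m S) (hT : IsRes n T) (hU : IsRes (m * n) U)
    {M : Type*} [AddCommMonoid M] (F : GaussianInt → M) (hF : ∀ x y, m * n ∣ x - y → F x = F y) :
    ∑ x ∈ U, F x = ∑ x ∈ S, ∑ y ∈ T, F (n * x + m * y) := by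
  have hinj : Set.InjOn (fun p : GaussianInt × GaussianInt => n * p.1 + m * p.2)
      (S ×ˢ T : Finset _) := by
    rintro ⟨x, y⟩ hxy ⟨x', y'⟩ hxy' h
    simp only [Finset.coe_product, Set.mem_prod, Finset.mem_coe] at hxy hxy'
    simp only at h
    have h1 : x = x' := hS.eq_of hxy.1 hxy'.1
      (hmn.dvd_of_dvd_mul_left ⟨y' - y, by linear_combination h⟩)
    have h2 : y = y' := hT.eq_of hxy.2 hxy'.2
      (hmn.symm.dvd_of_dvd_mul_left ⟨x' - x, by linear_combination h⟩)
    rw [h1, h2]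
  have hres : IsRes (m * n) ((S ×ˢ T).image (fun p => n * p.1 + m * p.2)) := by
    intro z
    obtain ⟨u, v, huv⟩ := id hmn
    obtain ⟨x, ⟨hx, k, hk⟩, _⟩ := hS (v * z)
    obtain ⟨y, ⟨hy, l, hl⟩, _⟩ := hT (u * z)
    refine ⟨n * x + m * y, ⟨Finset.mem_image.2 ⟨(x, y), by simp [hx, hy], rfl⟩, k + l, ?_⟩, ?_⟩
    · linear_combination n * hk + m * hl - z * huv
    · rintro w ⟨hw, e, he⟩
      obtain ⟨⟨x', y'⟩, hxy, rfl⟩ := Finset.mem_image.1 hw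
      simp only [Finset.mem_product] at hxy
      simp only at he
      have h0 : n * x + m * y - (n * x' + m * y') = m * n * (e - k - l) := by
        linear_combination he - n * hk - m * hl + z * huv
      have h1 : x' = x := hS.eq_of hxy.1 hx
        (hmn.dvd_of_dvd_mul_left ⟨y - y' - n * (e - k - l), by linear_combination -h0⟩)
      have h2 : y' = y := hT.eq_of hxy.2 hy
        (hmn.symm.dvd_of_dvd_mul_left ⟨x - x' - m * (e - k - l), by linear_combination -h0⟩)
      rw [h1, h2]
  rw [hU.sum_eq hres F hF, Finset.sum_image hinj, Finset.sum_product]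

/-- the box residue system for a natural number -/
def boxRes (N : ℕ) : Finset GaussianInt :=
  (Finset.range N ×ˢ Finset.range N).image (fun p => (⟨p.1, p.2⟩ : GaussianInt))

lemma natCast_dvd_iff (N : ℕ) (z : GaussianInt) :
    ((N : ℕ) : GaussianInt) ∣ z ↔ (N : ℤ) ∣ z.re ∧ (N : ℤ) ∣ z.im := by
  have := Zsqrtd.intCast_dvd (d := -1) (N : ℤ) z
  simpa using this

lemma isRes_boxRes {N : ℕ} (hN : 0 < N) : IsRes (N : GaussianInt) (boxRes N) := by
  have hN' : (0 : ℤ) < N := by exact_mod_cast hN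
  intro z
  refine ⟨⟨z.re % N, z.im % N⟩, ⟨Finset.mem_image.2 ⟨((z.re % N).toNat, (z.im % N).toNat), ?_, ?_⟩,
    ?_⟩, ?_⟩
  · have h1 := Int.emod_lt_of_pos z.re hN'
    have h2 := Int.emod_lt_of_pos z.im hN'
    simp only [Finset.mem_product, Finset.mem_range]
    omega
  · have h1 := Int.emod_nonneg z.re hN'.ne'
    have h2 := Int.emod_nonneg z.im hN'.ne'
    ext <;> simp [h1, h2]
  · rw [natCast_dvd_iff]; simp [Int.dvd_self_sub_emod]
  · rintro w ⟨hw, hw2⟩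
    obtain ⟨⟨a, b⟩, hab, rfl⟩ := Finset.mem_image.1 hw
    simp only [Finset.mem_product, Finset.mem_range] at hab
    rw [natCast_dvd_iff] at hw2
    simp only [Zsqrtd.re_sub, Zsqrtd.im_sub] at hw2
    have h1 := (Int.emod_emod_of_dvd z.re (dvd_refl (N:ℤ)))
    ext
    · have := (Int.emod_eq_emod_iff_emod_sub_eq_zero.2 (Int.emod_eq_zero_of_dvd hw2.1))
      simp only; rw [this, Int.emod_eq_of_lt] <;> omega
    · have := (Int.emod_eq_emod_iff_emod_sub_eq_zero.2 (Int.emod_eq_zero_of_dvd hw2.2))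
      simp only; rw [this, Int.emod_eq_of_lt] <;> omega

lemma card_boxRes (N : ℕ) : (boxRes N).card = N ^ 2 := by
  unfold boxRes
  rw [Finset.card_image_of_injective, Finset.card_product, Finset.card_range, sq]
  rintro ⟨a, b⟩ ⟨c, d⟩ h
  simpa [Zsqrtd.ext_iff] using h

lemma exists_isRes {n : GaussianInt} (hn : n ≠ 0) : ∃ S, IsRes n S := by
  -- use the box for the norm, choose representatives
  have hpos : 0 < (Zsqrtd.norm n).natAbs := by
    have := norm_pos' hn; omega
  have hdvd : n ∣ (((Zsqrtd.norm n).natAbs : ℕ) : GaussianInt) := by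
    have h2 : (((Zsqrtd.norm n).natAbs : ℕ) : GaussianInt) = ((Zsqrtd.norm n : ℤ) : GaussianInt) := by
      rw [← GaussianInt.abs_natCast_norm n]; simp
    rw [h2, Zsqrtd.norm_eq_mul_conj]; exact dvd_mul_right _ _
  let c : Setoid GaussianInt :=
    { r := fun x y => n ∣ x - y
      iseqv := ⟨fun x => by simp, fun {x y} h => by rw [← neg_sub]; exact h.neg_right,
        fun {x y z} h1 h2 => by have := dvd_add h1 h2; simpa using this⟩ }
  let rep : GaussianInt → GaussianInt := fun x => (Quotient.mk c x).out
  have hrep : ∀ x, n ∣ rep x - x := fun x => Quotient.exact (s := c) (Quotient.out_eq _)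
  have hrep2 : ∀ x y, n ∣ x - y → rep x = rep y := fun x y h => by
    simp only [rep]; rw [Quotient.sound (s := c) h]
  refine ⟨(boxRes (Zsqrtd.norm n).natAbs).image rep, fun z => ?_⟩
  obtain ⟨x, ⟨hx, hx2⟩, _⟩ := isRes_boxRes hpos z
  refine ⟨rep x, ⟨Finset.mem_image_of_mem _ hx, ?_⟩, ?_⟩
  · have : z - rep x = (z - x) - (rep x - x) := by ring
    rw [this]; exact dvd_sub (hdvd.trans hx2) (hrep x)
  · rintro w ⟨hw, hw2⟩
    obtain ⟨y, hy, rfl⟩ := Finset.mem_image.1 hw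
    apply hrep2
    have : y - x = (z - x) - (z - rep y) - (rep y - y) := by ring
    rw [this]
    exact dvd_sub (dvd_sub (hdvd.trans hx2) hw2) (hrep y)

lemma IsRes.card_mul {m n : GaussianInt} (hm0 : m ≠ 0) {S T U : Finset GaussianInt}
    (hS : IsRes m S) (hT : IsRes n T) (hU : IsRes (m * n) U) : U.card = S.card * T.card := by
  have := hS.sum_mul_eq hm0 hT hU (fun _ => (1 : ℕ)) (fun _ _ _ => rfl)
  simpa using this

lemma IsRes.card_eq {n : GaussianInt} (hn : n ≠ 0) {S : Finset GaussianInt} (hS : IsRes n S) :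
    (S.card : ℤ) = Zsqrtd.norm n := by
  have hpos : 0 < (Zsqrtd.norm n).natAbs := by
    have := norm_pos' hn; omega
  have h2 : n * star n = (((Zsqrtd.norm n).natAbs : ℕ) : GaussianInt) := by
    have h2 : (((Zsqrtd.norm n).natAbs : ℕ) : GaussianInt) = ((Zsqrtd.norm n : ℤ) : GaussianInt) := by
      rw [← GaussianInt.abs_natCast_norm n]; simp
    rw [h2, Zsqrtd.norm_eq_mul_conj]
  have hst : IsRes (star n) (S.image star) := by
    intro z
    obtain ⟨x, ⟨hx, k, hk⟩, hu⟩ := hS (star z)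
    refine ⟨star x, ⟨Finset.mem_image_of_mem _ hx, star k, ?_⟩, ?_⟩
    · have := congrArg star hk
      rw [star_sub, star_star, star_mul'] at this
      exact this
    · rintro w ⟨hw, l, hl⟩
      obtain ⟨y, hy, rfl⟩ := Finset.mem_image.1 hw
      rw [hu y ⟨hy, star l, ?_⟩]
      have := congrArg star hl
      rw [star_sub, star_star, star_mul', star_star] at this
      exact this
  have hU : IsRes (n * star n) (boxRes (Zsqrtd.norm n).natAbs) := h2 ▸ isRes_boxRes hpos
  have h3 := hS.card_mul hn hst hU
  rw [card_boxRes, Finset.card_image_of_injective _ star_injective] at h3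
  have h4 : (Zsqrtd.norm n).natAbs = S.card := by nlinarith
  have := norm_pos' hn; omega

lemma IsRes.card_eq_Nm {n : GaussianInt} (hn : n ≠ 0) {S : Finset GaussianInt} (hS : IsRes n S) :
    (S.card : ℝ) = Nm n := by
  unfold Nm; rw [← hS.card_eq hn]; simp

/-! ### The quadratic symbol -/

lemma not_dvd_two_of_odd {ϖ : GaussianInt} (hp : Prime ϖ) (ho : ¬ ωg ∣ ϖ) : ¬ ϖ ∣ 2 := by
  intro h
  have e : (2 : GaussianInt) = (-ig) * ωg ^ 2 := by
    ext <;> simp [ig, ωg, pow_succ, Zsqrtd.re_mul, Zsqrtd.im_mul]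
  rw [e] at h
  rcases hp.dvd_or_dvd h with h | h
  · exact hp.not_isUnit (isUnit_of_dvd_unit h isUnit_ig.neg)
  · have h1 := hp.dvd_of_dvd_pow h
    exact ho (((hp.dvd_prime_iff_associated prime_omega).1 h1).symm.dvd)

lemma sign_unique {ϖ : GaussianInt} (hp : Prime ϖ) (ho : ¬ ωg ∣ ϖ) {e e' : ℤ}
    (he : e = 0 ∨ e = 1 ∨ e = -1) (he' : e' = 0 ∨ e' = 1 ∨ e' = -1)
    (h : ϖ ∣ ((e : GaussianInt) - (e' : GaussianInt))) : e = e' := by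
  have h1 : ¬ ϖ ∣ 1 := hp.not_dvd_one
  have h2 := not_dvd_two_of_odd hp ho
  have h3 : ¬ ϖ ∣ -1 := by rwa [dvd_neg]
  have h4 : ¬ ϖ ∣ -2 := by rwa [dvd_neg]
  rcases he with rfl | rfl | rfl <;> rcases he' with rfl | rfl | rfl <;> norm_num at h ⊢ <;>
    first
    | exact h1 h
    | exact h2 h

section QS
variable {χ : GaussianInt → GaussianInt → ℤ}

lemma chi_prime_vals (hχ : IsQuadSym χ) {ϖ : GaussianInt} (hp : Prime ϖ) (ho : ¬ ωg ∣ ϖ)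
    (a : GaussianInt) : χ a ϖ = 0 ∨ χ a ϖ = 1 ∨ χ a ϖ = -1 := by
  by_cases h : ϖ ∣ a
  · exact Or.inl (hχ.zero_of_dvd _ _ hp h)
  · exact Or.inr (hχ.val_prime _ _ hp ho h).1

lemma chi_prime_congr (hχ : IsQuadSym χ) {ϖ : GaussianInt} (hp : Prime ϖ) (hpr : IsPrimary ϖ)
    (a : GaussianInt) :
    ϖ ∣ (a ^ (((Zsqrtd.norm ϖ).toNat - 1) / 2) - (χ a ϖ : GaussianInt)) := by
  by_cases h : ϖ ∣ a
  · rw [hχ.zero_of_dvd _ _ hp h]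
    have h5 := hpr.five_le_norm (fun h => hp.not_isUnit (h ▸ isUnit_one))
    simp only [Int.cast_zero, sub_zero]
    exact dvd_pow h (by omega)
  · exact (hχ.val_prime _ _ hp hpr.not_omega_dvd h).2

lemma chi_prime_eq (hχ : IsQuadSym χ) {ϖ : GaussianInt} (hp : Prime ϖ) (hpr : IsPrimary ϖ)
    (a : GaussianInt) {e : ℤ} (he : e = 0 ∨ e = 1 ∨ e = -1)
    (h : ϖ ∣ (a ^ (((Zsqrtd.norm ϖ).toNat - 1) / 2) - (e : GaussianInt))) : χ a ϖ = e := by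
  refine sign_unique hp hpr.not_omega_dvd (chi_prime_vals hχ hp hpr.not_omega_dvd a) he ?_
  have := dvd_sub h (chi_prime_congr hχ hp hpr a)
  simpa using this

lemma chi_one_den (hχ : IsQuadSym χ) (a : GaussianInt) : χ a 1 = 1 := hχ.unit_den a 1 isUnit_one

lemma chi_mul (hχ : IsQuadSym χ) (a b : GaussianInt) {n : GaussianInt} (hn : IsPrimary n) :
    χ (a * b) n = χ a n * χ b n := by
  revert n
  apply primary_induction
  · simp [chi_one_den hχ]
  · intro ϖ m hp hpr hm ih
    rw [hχ.mul_den _ _ _ hpr.not_omega_dvd hm.not_omega_dvd, hχ.mul_den _ _ _ hpr.not_omega_dvd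
      hm.not_omega_dvd, hχ.mul_den _ _ _ hpr.not_omega_dvd hm.not_omega_dvd, ih]
    have : χ (a * b) ϖ = χ a ϖ * χ b ϖ := by
      apply chi_prime_eq hχ hp hpr
      · rcases chi_prime_vals hχ hp hpr.not_omega_dvd a with h | h | h <;>
        rcases chi_prime_vals hχ hp hpr.not_omega_dvd b with h' | h' | h' <;> simp [h, h']
      · obtain ⟨k, hk⟩ := chi_prime_congr hχ hp hpr a
        obtain ⟨l, hl⟩ := chi_prime_congr hχ hp hpr b
        rw [mul_pow]
        push_cast
        exact ⟨k * b ^ (((Zsqrtd.norm ϖ).toNat - 1) / 2) + χ a ϖ * l, by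
          linear_combination (b ^ (((Zsqrtd.norm ϖ).toNat - 1) / 2)) * hk + (χ a ϖ : GaussianInt) * hl⟩
    rw [this]; ring

lemma chi_periodic (hχ : IsQuadSym χ) {n : GaussianInt} (hn : IsPrimary n) :
    ∀ a b : GaussianInt, n ∣ a - b → χ a n = χ b n := by
  revert n
  apply primary_induction
  · simp [chi_one_den hχ]
  · intro ϖ m hp hpr hm ih a b hab
    rw [hχ.mul_den _ _ _ hpr.not_omega_dvd hm.not_omega_dvd, hχ.mul_den _ _ _ hpr.not_omega_dvd
      hm.not_omega_dvd, ih a b ((dvd_mul_left _ _).trans hab)]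
    have : χ a ϖ = χ b ϖ := by
      apply chi_prime_eq hχ hp hpr _ (chi_prime_vals hχ hp hpr.not_omega_dvd b)
      have h1 := chi_prime_congr hχ hp hpr b
      have h2 : ϖ ∣ a ^ (((Zsqrtd.norm ϖ).toNat - 1) / 2) - b ^ (((Zsqrtd.norm ϖ).toNat - 1) / 2) :=
        ((dvd_mul_right _ _).trans hab).trans (sub_dvd_pow_sub_pow _ _ _)
      have := dvd_add h1 h2
      simpa using this
    rw [this]

lemma chi_one_num (hχ : IsQuadSym χ) {n : GaussianInt} (hn : IsPrimary n) : χ 1 n = 1 := by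
  revert n
  apply primary_induction
  · simp [chi_one_den hχ]
  · intro ϖ m hp hpr hm ih
    rw [hχ.mul_den _ _ _ hpr.not_omega_dvd hm.not_omega_dvd, ih,
      chi_prime_eq hχ hp hpr 1 (e := 1) (by simp) (by simp)]; rfl

lemma chi_vals (hχ : IsQuadSym χ) {n : GaussianInt} (hn : IsPrimary n) (a : GaussianInt) :
    χ a n = 0 ∨ χ a n = 1 ∨ χ a n = -1 := by
  revert n
  apply primary_induction
  · simp [chi_one_den hχ]
  · intro ϖ m hp hpr hm ih
    rw [hχ.mul_den _ _ _ hpr.not_omega_dvd hm.not_omega_dvd]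
    rcases chi_prime_vals hχ hp hpr.not_omega_dvd a with h | h | h <;>
    rcases ih with h' | h' | h' <;> simp [h, h']

lemma chi_of_coprime (hχ : IsQuadSym χ) {n : GaussianInt} (hn : IsPrimary n) {a : GaussianInt}
    (ha : IsCoprime a n) : χ a n = 1 ∨ χ a n = -1 := by
  obtain ⟨u, v, huv⟩ := ha
  have h1 : χ (u * a) n = χ 1 n := chi_periodic hχ hn _ _ ⟨-v, by linear_combination huv⟩
  rw [chi_mul hχ _ _ hn, chi_one_num hχ hn] at h1
  exact Int.isUnit_iff.1 (IsUnit.of_mul_eq_one (χ u n) (by rw [mul_comm]; exact h1))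

lemma chi_of_not_coprime (hχ : IsQuadSym χ) {n : GaussianInt} (hn : IsPrimary n) {a : GaussianInt}
    (ha : ¬ IsCoprime a n) : χ a n = 0 := by
  revert ha
  revert n
  apply primary_induction
  · intro h; exact absurd isCoprime_one_right h
  · intro ϖ m hp hpr hm ih h
    rw [hχ.mul_den _ _ _ hpr.not_omega_dvd hm.not_omega_dvd]
    by_cases h1 : ϖ ∣ a
    · rw [hχ.zero_of_dvd _ _ hp h1, zero_mul]
    · rw [ih, mul_zero]
      intro h2
      apply h
      refine IsCoprime.mul_right ?_ h2
      exact ((hp.irreducible.coprime_iff_not_dvd).2 h1).symm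

lemma chi_mul_den (hχ : IsQuadSym χ) (a : GaussianInt) {m n : GaussianInt} (hm : IsPrimary m)
    (hn : IsPrimary n) : χ a (m * n) = χ a m * χ a n :=
  hχ.mul_den _ _ _ hm.not_omega_dvd hn.not_omega_dvd

lemma chi_sq (hχ : IsQuadSym χ) {n : GaussianInt} (hn : IsPrimary n) {a : GaussianInt}
    (ha : IsCoprime a n) : χ (a ^ 2) n = 1 := by
  rw [sq, chi_mul hχ _ _ hn]
  rcases chi_of_coprime hχ hn ha with h | h <;> simp [h]

lemma abs_chi_le (hχ : IsQuadSym χ) {n : GaussianInt} (hn : IsPrimary n) (a : GaussianInt) :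
    ‖(χ a n : ℂ)‖ ≤ 1 := by
  rcases chi_vals hχ hn a with h | h | h <;> simp [h]

end QS

/-! ### classification of primary primes -/

lemma primary_prime_cases {ϖ : GaussianInt} (hp : Prime ϖ) (hpr : IsPrimary ϖ) :
    (∃ p : ℕ, p.Prime ∧ p % 4 = 1 ∧ Zsqrtd.norm ϖ = p) ∨
    (∃ p : ℕ, p.Prime ∧ p % 4 = 3 ∧ ϖ = -(p : GaussianInt)) := by
  have h5 := hpr.five_le_norm (fun h => hp.not_isUnit (h ▸ isUnit_one))
  obtain ⟨p, hpp, hdvd⟩ : ∃ p : ℕ, p.Prime ∧ ϖ ∣ (p : GaussianInt) := by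
    have h1 : ϖ ∣ (((Zsqrtd.norm ϖ).natAbs : ℕ) : GaussianInt) := by
      have h2 : (((Zsqrtd.norm ϖ).natAbs : ℕ) : GaussianInt) = ((Zsqrtd.norm ϖ : ℤ) : GaussianInt) := by
        rw [← GaussianInt.abs_natCast_norm ϖ]; simp
      rw [h2, Zsqrtd.norm_eq_mul_conj]; exact dvd_mul_right _ _
    have key : ∀ n : ℕ, n ≠ 0 → ϖ ∣ (n : GaussianInt) → ∃ p : ℕ, p.Prime ∧ ϖ ∣ (p : GaussianInt) := by
      intro n
      induction n using Nat.recOnMul with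
      | zero => simp
      | one => intro _ h; exact absurd (by simpa using h) hp.not_dvd_one
      | prime p hp' => intro _ h; exact ⟨p, hp', h⟩
      | mul a b iha ihb =>
        intro h0 h
        push_cast at h
        rcases hp.dvd_or_dvd h with h | h
        · exact iha (left_ne_zero_of_mul h0) h
        · exact ihb (right_ne_zero_of_mul h0) h
    exact key _ (by omega) h1
  obtain ⟨k, hk⟩ := hdvd
  have hN : (p : ℤ) ^ 2 = Zsqrtd.norm ϖ * Zsqrtd.norm k := by
    rw [← Zsqrtd.norm_mul, ← hk, Zsqrtd.norm_natCast]; ring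
  have hpN : (Zsqrtd.norm ϖ).toNat ∣ p ^ 2 := by
    have : ((Zsqrtd.norm ϖ).toNat : ℤ) ∣ ((p ^ 2 : ℕ) : ℤ) := by
      rw [Int.toNat_of_nonneg (by omega)]; push_cast; exact ⟨_, hN⟩
    exact_mod_cast this
  rw [Nat.dvd_prime_pow hpp] at hpN
  obtain ⟨j, hj, hj2⟩ := hpN
  interval_cases j
  · simp at hj2; omega
  · left
    have : Zsqrtd.norm ϖ = p := by rw [pow_one] at hj2; omega
    refine ⟨p, hpp, ?_, this⟩
    have := hpr.norm_mod_four; omega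
  · right
    have e : Zsqrtd.norm ϖ = (p : ℤ) ^ 2 := by
      have : ((Zsqrtd.norm ϖ).toNat : ℤ) = ((p ^ 2 : ℕ) : ℤ) := by rw [hj2]
      rw [Int.toNat_of_nonneg (by omega)] at this; push_cast at this; exact this
    have hku : IsUnit k := by
      rw [← norm_eq_one_iff_isUnit]
      rw [e] at hN
      have : (p : ℤ) ^ 2 ≠ 0 := pow_ne_zero _ (by exact_mod_cast hpp.ne_zero)
      apply mul_left_cancel₀ this; rw [← hN]; ring
    have hass : Associated ϖ (p : GaussianInt) := ⟨hku.unit, by simp [hk]⟩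
    have := Fact.mk hpp
    have h3 := GaussianInt.mod_four_eq_three_of_nat_prime_of_prime p (hass.prime hp)
    refine ⟨p, hpp, h3, ?_⟩
    apply hpr.eq_of_associated _ (hass.trans (Associated.neg_right (Associated.refl _)))
    rw [isPrimary_iff]
    simp; omega

/-! ### Reciprocity -/

lemma jacobi_neg_one_mod_four {P : ℕ} (hP : P % 4 = 1) (x : ℤ) :
    jacobiSym (-x) P = jacobiSym x P := by
  rw [jacobiSym.neg _ (Nat.odd_iff.2 (by omega)), ZMod.χ₄_nat_one_mod_four hP, one_mul]

lemma jacobi_natAbs {P : ℕ} (hP : P % 4 = 1) (x : ℤ) :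
    jacobiSym (x.natAbs : ℤ) P = jacobiSym x P := by
  rcases Int.natAbs_eq x with h | h
  · rw [← h]
  · conv_rhs => rw [h]
    rw [jacobi_neg_one_mod_four hP]

lemma jacobi_flip {P : ℕ} (hP : P % 4 = 1) {x : ℤ} (hx : x % 2 = 1) :
    jacobiSym x P = jacobiSym P x.natAbs := by
  rw [← jacobi_natAbs hP, jacobiSym.quadratic_reciprocity_one_mod_four hP]
  rw [Nat.odd_iff]; omega

/-- `(x/P) = 1` when `P = x² + y²`. -/
lemma jacobi_sum_sq {P : ℕ} (hP : P % 4 = 1) {x y : ℤ} (hx : x % 2 = 1) (hxy : IsCoprime x y)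
    (h : (P : ℤ) = x ^ 2 + y ^ 2) : jacobiSym x P = 1 := by
  rw [jacobi_flip hP hx]
  have e : jacobiSym (P : ℤ) x.natAbs = jacobiSym (y ^ 2) x.natAbs := by
    apply jacobiSym.mod_left'
    apply Int.emod_emod_of_dvd _ (dvd_refl _) |>.symm.trans
    rw [h]
    apply Int.ModEq.eq
    have : (x.natAbs : ℤ) ∣ x ^ 2 := by
      rw [Int.natAbs_dvd]; exact dvd_pow_self _ (by norm_num)
    rw [Int.modEq_iff_dvd, Int.emod_def]
    obtain ⟨k, hk⟩ := this
    refine ⟨-k + ((x ^ 2 + y ^ 2) / (x.natAbs : ℤ)) , ?_⟩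
    linear_combination (-1 : ℤ) * hk
  rw [e]
  apply jacobiSym.sq_one'
  rw [Int.gcd_comm]
  simpa [Int.gcd, Int.natAbs_abs] using Int.isCoprime_iff_gcd_eq_one.1 hxy

lemma sum_sq_coprime {x y : ℤ} {P : ℕ} (hsq : ∀ l : ℕ, l.Prime → ¬ l ^ 2 ∣ P)
    (h : (P : ℤ) = x ^ 2 + y ^ 2) : IsCoprime x y := by
  rw [Int.isCoprime_iff_gcd_eq_one]
  by_contra hne
  obtain ⟨l, hl, hd⟩ := Nat.exists_prime_and_dvd hne
  apply hsq l hl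
  have h1 : (l : ℤ) ∣ x := (Int.natCast_dvd_natCast.2 hd).trans (Int.gcd_dvd_left ..)
  have h2 : (l : ℤ) ∣ y := (Int.natCast_dvd_natCast.2 hd).trans (Int.gcd_dvd_right ..)
  have : (l : ℤ) ^ 2 ∣ P := by
    rw [h]; exact dvd_add (pow_dvd_pow_of_dvd h1 2) (pow_dvd_pow_of_dvd h2 2)
  exact_mod_cast this

lemma prime_no_sq {p : ℕ} (hp : p.Prime) : ∀ l : ℕ, l.Prime → ¬ l ^ 2 ∣ p := by
  intro l hl h
  have h1 : l ∣ p := (dvd_pow_self l (by norm_num)).trans h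
  rw [(Nat.prime_dvd_prime_iff_eq hl hp).1 h1] at h
  have := Nat.le_of_dvd hp.pos h
  nlinarith [hp.two_le]

lemma IsPrimary.re_odd {m : GaussianInt} (hm : IsPrimary m) : m.re % 2 = 1 := by
  rw [isPrimary_iff] at hm; omega

section QS
variable {χ : GaussianInt → GaussianInt → ℤ}

lemma legendre_vals (p : ℕ) [Fact p.Prime] (x : ℤ) :
    legendreSym p x = 0 ∨ legendreSym p x = 1 ∨ legendreSym p x = -1 := by
  by_cases h : (x : ZMod p) = 0
  · left; exact (legendreSym.eq_zero_iff p x).2 h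
  · right; exact legendreSym.eq_one_or_neg_one p h

lemma jacobi_prime (p : ℕ) (hp : p.Prime) (x : ℤ) :
    jacobiSym x p = @legendreSym p ⟨hp⟩ x := by
  have := Fact.mk hp
  rw [jacobiSym.legendreSym.to_jacobiSym]

lemma dvd_pow_sub_legendre (p : ℕ) [Fact p.Prime] (x : ℤ) :
    (p : ℤ) ∣ x ^ (p / 2) - legendreSym p x := by
  rw [← ZMod.intCast_zmod_eq_zero_iff_dvd]
  push_cast
  rw [legendreSym.eq_pow, sub_self]

/-- integers at split primes -/
lemma chi_split_int (hχ : IsQuadSym χ) {ϖ : GaussianInt} (hp : Prime ϖ) (hpr : IsPrimary ϖ)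
    {p : ℕ} (hpp : p.Prime) (hN : Zsqrtd.norm ϖ = p) (x : ℤ) :
    χ (x : GaussianInt) ϖ = jacobiSym x p := by
  have := Fact.mk hpp
  rw [jacobi_prime p hpp]
  apply chi_prime_eq hχ hp hpr _ (legendre_vals p x)
  have h1 : ϖ ∣ ((p : ℤ) : GaussianInt) := by
    rw [← hN, Zsqrtd.norm_eq_mul_conj]; exact dvd_mul_right _ _
  refine h1.trans ?_
  obtain ⟨k, hk⟩ := dvd_pow_sub_legendre p x
  have h4 := hpr.norm_mod_four
  have e : ((Zsqrtd.norm ϖ).toNat - 1) / 2 = p / 2 := by omega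
  rw [e]
  exact ⟨(k : GaussianInt), by exact_mod_cast congrArg (fun z : ℤ => (z : GaussianInt)) hk⟩

lemma chi_split (hχ : IsQuadSym χ) {ϖ : GaussianInt} (hp : Prime ϖ) (hpr : IsPrimary ϖ)
    {p : ℕ} (hpp : p.Prime) (hN : Zsqrtd.norm ϖ = p) (m : GaussianInt) :
    χ m ϖ = jacobiSym (m.re * ϖ.re + m.im * ϖ.im) p := by
  have h4 := hpr.norm_mod_four
  have hsum : (p : ℤ) = ϖ.re ^ 2 + ϖ.im ^ 2 := by rw [← hN, norm_def']
  have h1 : χ (ϖ.re : GaussianInt) ϖ = 1 := by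
    rw [chi_split_int hχ hp hpr hpp hN]
    exact jacobi_sum_sq (by omega) hpr.re_odd (sum_sq_coprime (prime_no_sq hpp) hsum) hsum
  rw [← chi_split_int hχ hp hpr hpp hN]
  have h2 : χ ((ϖ.re : GaussianInt) * m) ϖ = χ ((m.re * ϖ.re + m.im * ϖ.im : ℤ) : GaussianInt) ϖ := by
    apply chi_periodic hχ hpr
    refine ⟨⟨0, m.im⟩, ?_⟩
    ext <;> simp [Zsqrtd.re_mul, Zsqrtd.im_mul] <;> ring
  rw [← h2, chi_mul hχ _ _ hpr, h1, one_mul]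

lemma inert_norm {p : ℕ} : Zsqrtd.norm (-(p : GaussianInt)) = (p : ℤ) ^ 2 := by
  rw [Zsqrtd.norm_neg, Zsqrtd.norm_natCast]; ring

/-- Frobenius -/
lemma frob_inert {p : ℕ} (hpp : p.Prime) (h3 : p % 4 = 3) (m : GaussianInt) :
    (p : GaussianInt) ∣ m ^ p - star m := by
  have := Fact.mk hpp
  have em : m = (m.re : GaussianInt) + ig * (m.im : GaussianInt) := by
    ext <;> simp [ig, Zsqrtd.re_mul, Zsqrtd.im_mul]
  have es : star m = (m.re : GaussianInt) - ig * (m.im : GaussianInt) := by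
    ext <;> simp [ig, Zsqrtd.re_mul, Zsqrtd.im_mul]
  obtain ⟨r, hr⟩ := exists_add_pow_prime_eq hpp (m.re : GaussianInt) (ig * (m.im : GaussianInt))
  have fl : ∀ x : ℤ, (p : GaussianInt) ∣ (x : GaussianInt) ^ p - x := by
    intro x
    have : (p : ℤ) ∣ x ^ p - x := by
      rw [← ZMod.intCast_zmod_eq_zero_iff_dvd]
      push_cast; rw [ZMod.pow_card, sub_self]
    obtain ⟨k, hk⟩ := this
    exact ⟨(k : GaussianInt), by exact_mod_cast congrArg (fun z : ℤ => (z : GaussianInt)) hk⟩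
  have hi : ig ^ p = -ig := by
    obtain ⟨j, hj⟩ : ∃ j, p = 4 * j + 3 := ⟨p / 4, by omega⟩
    have : ig ^ 4 = 1 := by
      have : ig ^ 4 = (ig ^ 2) ^ 2 := by ring
      rw [this, ig_sq]; ring
    rw [hj, pow_add, pow_mul, this, one_pow, one_mul, pow_succ, ig_sq]; ring
  obtain ⟨k, hk⟩ := fl m.re
  obtain ⟨l, hl⟩ := fl m.im
  rw [← em] at hr
  rw [hr, es, mul_pow, hi]
  exact ⟨k - ig * l + m.re * (ig * m.im) * r, by linear_combination hk - ig * hl⟩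

lemma chi_inert (hχ : IsQuadSym χ) {p : ℕ} (hpp : p.Prime) (h3 : p % 4 = 3)
    (hp : Prime (-(p : GaussianInt))) (hpr : IsPrimary (-(p : GaussianInt))) (m : GaussianInt) :
    χ m (-(p : GaussianInt)) = jacobiSym (Zsqrtd.norm m) p := by
  have := Fact.mk hpp
  rw [jacobi_prime p hpp]
  apply chi_prime_eq hχ hp hpr _ (legendre_vals p _)
  rw [neg_dvd, inert_norm]
  have e : (((p : ℤ) ^ 2).toNat - 1) / 2 = (p + 1) * (p / 2) := by
    have : ((p : ℤ) ^ 2).toNat = p ^ 2 := by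
      rw [← Nat.cast_pow, Int.toNat_natCast]
    rw [this]
    obtain ⟨j, hj⟩ : ∃ j, p = 2 * j + 1 := ⟨p / 2, by omega⟩
    have h5 : p / 2 = j := by omega
    rw [h5, hj]
    have : (2 * j + 1) ^ 2 - 1 = 2 * ((2 * j + 1 + 1) * j) := by
      have : (2 * j + 1) ^ 2 = 2 * ((2 * j + 1 + 1) * j) + 1 := by ring
      omega
    rw [this]; omega
  rw [e, pow_mul]
  have h1 : (p : GaussianInt) ∣ m ^ (p + 1) - (Zsqrtd.norm m : GaussianInt) := by
    obtain ⟨k, hk⟩ := frob_inert hpp h3 m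
    refine ⟨m * k, ?_⟩
    rw [Zsqrtd.norm_eq_mul_conj, pow_succ]
    linear_combination m * hk
  have h2 := h1.trans (sub_dvd_pow_sub_pow _ _ (p / 2))
  have h4 : (p : GaussianInt) ∣ (Zsqrtd.norm m : GaussianInt) ^ (p / 2) -
      (legendreSym p (Zsqrtd.norm m) : GaussianInt) := by
    obtain ⟨k, hk⟩ := dvd_pow_sub_legendre p (Zsqrtd.norm m)
    exact ⟨(k : GaussianInt), by exact_mod_cast congrArg (fun z : ℤ => (z : GaussianInt)) hk⟩
  have := dvd_add h2 h4
  simpa using this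

lemma recip_split_inert (hχ : IsQuadSym χ) {ϖ : GaussianInt} (hp : Prime ϖ) (hpr : IsPrimary ϖ)
    {p : ℕ} (hpp : p.Prime) (hN : Zsqrtd.norm ϖ = p) {l : ℕ} (hll : l.Prime) (h3 : l % 4 = 3)
    (hl : Prime (-(l : GaussianInt))) (hlr : IsPrimary (-(l : GaussianInt))) :
    χ ϖ (-(l : GaussianInt)) = χ (-(l : GaussianInt)) ϖ := by
  have h4 := hpr.norm_mod_four
  rw [chi_inert hχ hll h3 hl hlr, hN]
  have : -(l : GaussianInt) = ((-l : ℤ) : GaussianInt) := by push_cast; rfl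
  rw [this, chi_split_int hχ hp hpr hpp hN, jacobi_neg_one_mod_four (by omega),
    jacobiSym.quadratic_reciprocity_one_mod_four (by omega) (Nat.odd_iff.2 (by omega))]

lemma recip_prime (hχ : IsQuadSym χ) {m n : GaussianInt} (hm : Prime m) (hmr : IsPrimary m)
    (hn : Prime n) (hnr : IsPrimary n) : χ m n = χ n m := by
  rcases primary_prime_cases hm hmr with ⟨p, hpp, hp1, hpN⟩ | ⟨p, hpp, hp3, rfl⟩
  · rcases primary_prime_cases hn hnr with ⟨l, hll, hl1, hlN⟩ | ⟨l, hll, hl3, rfl⟩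
    · rw [chi_split hχ hm hmr hpp hpN, chi_split hχ hn hnr hll hlN]
      have ecomm : n.re * m.re + n.im * m.im = m.re * n.re + m.im * n.im := by ring
      rw [ecomm]
      by_cases hpl : p = l
      · rw [hpl]
      set X := m.re * n.re + m.im * n.im with hX
      have hsum : ((p * l : ℕ) : ℤ) = X ^ 2 + (m.re * n.im - m.im * n.re) ^ 2 := by
        push_cast; rw [← hpN, ← hlN, norm_def', norm_def']; ring
      have hXodd : X % 2 = 1 := by
        rw [isPrimary_iff] at hmr hnr
        obtain ⟨b, hb⟩ : ∃ b, m.im = 2 * b := ⟨m.im / 2, by omega⟩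
        obtain ⟨a, ha⟩ : ∃ a, m.re = 2 * a + 1 := ⟨m.re / 2, by omega⟩
        obtain ⟨c, hc⟩ : ∃ a, n.re = 2 * a + 1 := ⟨n.re / 2, by omega⟩
        have : X = 2 * (2 * a * c + a + c + b * n.im) + 1 := by rw [hX, hb, ha, hc]; ring
        omega
      have hcop : IsCoprime X (m.re * n.im - m.im * n.re) := by
        refine sum_sq_coprime (P := p * l) ?_ hsum
        intro r hr hd
        have h1 : r ∣ p * l := (dvd_pow_self r (by norm_num)).trans hd
        rcases (Nat.Prime.dvd_mul hr).1 h1 with h2 | h2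
        · rw [(Nat.prime_dvd_prime_iff_eq hr hpp).1 h2, sq] at hd
          exact hpl ((Nat.prime_dvd_prime_iff_eq hpp hll).1 (Nat.dvd_of_mul_dvd_mul_left hpp.pos hd))
        · rw [(Nat.prime_dvd_prime_iff_eq hr hll).1 h2, sq] at hd
          exact hpl ((Nat.prime_dvd_prime_iff_eq hll hpp).1
            (Nat.dvd_of_mul_dvd_mul_right hll.pos hd)).symm
      have h1 := jacobi_sum_sq (P := p * l) (by rw [Nat.mul_mod, hp1, hl1]) hXodd hcop hsum
      have := NeZero.mk hpp.ne_zero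
      have := NeZero.mk hll.ne_zero
      rw [jacobiSym.mul_right] at h1
      rcases Int.mul_eq_one_iff_eq_one_or_neg_one.1 h1 with ⟨h2, h3⟩ | ⟨h2, h3⟩ <;> rw [h2, h3]
    · exact recip_split_inert hχ hm hmr hpp hpN hll hl3 hn hnr
  · rcases primary_prime_cases hn hnr with ⟨l, hll, hl1, hlN⟩ | ⟨l, hll, hl3, rfl⟩
    · exact (recip_split_inert hχ hn hnr hll hlN hpp hp3 hm hmr).symm
    · by_cases hpl : p = l
      · rw [hpl]
      rw [chi_inert hχ hll hl3 hn hnr, chi_inert hχ hpp hp3 hm hmr, inert_norm, inert_norm]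
      rw [jacobiSym.sq_one', jacobiSym.sq_one']
      · rw [Int.gcd_natCast_natCast]; exact (Nat.coprime_primes hll hpp).2 (Ne.symm hpl)
      · rw [Int.gcd_natCast_natCast]; exact (Nat.coprime_primes hpp hll).2 hpl

lemma recip (hχ : IsQuadSym χ) {m n : GaussianInt} (hm : IsPrimary m) (hn : IsPrimary n) :
    χ m n = χ n m := by
  revert hn
  revert n
  refine primary_induction (P := fun m => ∀ {n : GaussianInt}, IsPrimary n → χ m n = χ n m)
    ?_ ?_ m hm
  · intro n hn; rw [chi_one_den hχ, chi_one_num hχ hn]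
  · intro ϖ m hp hpr hm ih n hn
    rw [chi_mul hχ _ _ hn, chi_mul_den hχ _ hpr hm, ih hn]
    congr 1
    refine primary_induction (P := fun n => χ ϖ n = χ n ϖ) ?_ ?_ n hn
    · rw [chi_one_den hχ, chi_one_num hχ hpr]
    · intro ϖ' n' hp' hpr' hn' ih'
      rw [chi_mul hχ _ _ hpr, chi_mul_den hχ _ hpr' hn', ih', recip_prime hχ hp hpr hp' hpr']

/-- first supplementary law -/
lemma chi_ig (hχ : IsQuadSym χ) {n : GaussianInt} (hn : IsPrimary n) :
    χ ig n = if n.im % 4 = 0 then 1 else -1 := by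
  refine primary_induction (P := fun n => χ ig n = if n.im % 4 = 0 then 1 else -1) ?_ ?_ n hn
  · rw [chi_one_den hχ]; simp
  · intro ϖ m hp hpr hm ih
    have hmul : (ϖ * m).im % 4 = (ϖ.im + m.im) % 4 := by
      rw [isPrimary_iff] at hm hpr
      obtain ⟨b, hb⟩ : ∃ b, m.im = 2 * b := ⟨m.im / 2, by omega⟩
      obtain ⟨a, ha⟩ : ∃ a, m.re = 2 * a + 1 := ⟨m.re / 2, by omega⟩
      obtain ⟨c, hc⟩ : ∃ a, ϖ.re = 2 * a + 1 := ⟨ϖ.re / 2, by omega⟩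
      obtain ⟨d, hd⟩ : ∃ b, ϖ.im = 2 * b := ⟨ϖ.im / 2, by omega⟩
      have : (ϖ * m).im = ϖ.im + m.im + 4 * (c * b + d * a) := by
        rw [Zsqrtd.im_mul, hb, ha, hc, hd]; ring
      omega
    have hprime : χ ig ϖ = if ϖ.im % 4 = 0 then 1 else -1 := by
      apply chi_prime_eq hχ hp hpr
      · split_ifs <;> simp
      · have h5 := hpr.five_le_norm (fun h => hp.not_isUnit (h ▸ isUnit_one))
        have hI4 : ig ^ 4 = 1 := by
          have : ig ^ 4 = (ig ^ 2) ^ 2 := by ring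
          rw [this, ig_sq]; ring
        have hnd := norm_def' ϖ
        rw [isPrimary_iff] at hpr
        obtain ⟨c, hc⟩ : ∃ a, ϖ.re = 2 * a + 1 := ⟨ϖ.re / 2, by omega⟩
        obtain ⟨d, hd⟩ : ∃ b, ϖ.im = 2 * b := ⟨ϖ.im / 2, by omega⟩
        have hcc : (c ^ 2 + c) % 2 = 0 := by
          have : c ^ 2 + c = c * (c + 1) := by ring
          rw [this]; exact Int.even_iff.1 (Int.even_mul_succ_self c)
        have hnd' : Zsqrtd.norm ϖ = 4 * (c ^ 2 + c) + 4 * d ^ 2 + 1 := by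
          rw [hnd, hc, hd]; ring
        split_ifs with h
        · obtain ⟨e, he⟩ : ∃ e, d = 2 * e := ⟨d / 2, by omega⟩
          have : Zsqrtd.norm ϖ = 4 * (c ^ 2 + c) + 16 * e ^ 2 + 1 := by rw [hnd', he]; ring
          obtain ⟨j, hj⟩ : ∃ j, ((Zsqrtd.norm ϖ).toNat - 1) / 2 = 4 * j :=
            ⟨(((Zsqrtd.norm ϖ).toNat - 1) / 2) / 4, by omega⟩
          rw [hj, pow_mul, hI4]; simp
        · obtain ⟨e, he⟩ : ∃ e, d = 2 * e + 1 := ⟨d / 2, by omega⟩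
          have : Zsqrtd.norm ϖ = 4 * (c ^ 2 + c) + 16 * (e ^ 2 + e) + 5 := by rw [hnd', he]; ring
          obtain ⟨j, hj⟩ : ∃ j, ((Zsqrtd.norm ϖ).toNat - 1) / 2 = 4 * j + 2 :=
            ⟨(((Zsqrtd.norm ϖ).toNat - 1) / 2) / 4, by omega⟩
          rw [hj, pow_add, pow_mul, hI4, ig_sq]; simp
    rw [chi_mul_den hχ _ hpr hm, ih, hprime, hmul]
    rw [isPrimary_iff] at hm hpr
    split_ifs <;> first | rfl | (exfalso; omega)

/-- second supplementary law -/
lemma chi_omega (hχ : IsQuadSym χ) {n : GaussianInt} (hn : IsPrimary n) :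
    χ ωg n = if (n.re + n.im) % 8 = 1 then 1 else -1 := by
  refine primary_induction (P := fun n => χ ωg n = if (n.re + n.im) % 8 = 1 then 1 else -1) ?_ ?_ n hn
  · rw [chi_one_den hχ]; simp
  · intro ϖ m hp hpr hm ih
    have hmul : ((ϖ * m).re + (ϖ * m).im) % 8 = ((ϖ.re + ϖ.im) * (m.re + m.im)) % 8 := by
      rw [isPrimary_iff] at hm hpr
      obtain ⟨b, hb⟩ : ∃ b, m.im = 2 * b := ⟨m.im / 2, by omega⟩
      obtain ⟨d, hd⟩ : ∃ b, ϖ.im = 2 * b := ⟨ϖ.im / 2, by omega⟩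
      have : (ϖ * m).re + (ϖ * m).im = (ϖ.re + ϖ.im) * (m.re + m.im) + 8 * (- d * b) := by
        rw [Zsqrtd.im_mul, Zsqrtd.re_mul, hb, hd]; ring
      omega
    have hprime : χ ωg ϖ = if (ϖ.re + ϖ.im) % 8 = 1 then 1 else -1 := by
      have hr := (isPrimary_iff _).1 hpr
      rcases primary_prime_cases hp hpr with ⟨p, hpp, hp1, hpN⟩ | ⟨p, hpp, hp3, rfl⟩
      · rw [chi_split hχ hp hpr hpp hpN]
        have e : ωg.re * ϖ.re + ωg.im * ϖ.im = ϖ.re + ϖ.im := by simp [ωg]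
        rw [e]
        set s := ϖ.re + ϖ.im with hs
        rw [jacobi_flip hp1 (by omega)]
        have hsum : (p : ℤ) = ϖ.re ^ 2 + ϖ.im ^ 2 := by rw [← hpN, norm_def']
        have hcop := sum_sq_coprime (prime_no_sq hpp) hsum
        have h2p : jacobiSym (2 * p) s.natAbs = 1 := by
          have e2 : jacobiSym (2 * p) s.natAbs = jacobiSym ((2 * ϖ.re) ^ 2) s.natAbs := by
            apply jacobiSym.mod_left'
            apply Int.ModEq.eq
            rw [Int.modEq_iff_dvd, Int.natAbs_dvd]
            exact ⟨2 * (ϖ.re - ϖ.im), by rw [hsum, hs]; ring⟩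
          rw [e2]
          apply jacobiSym.sq_one'
          have h1 : IsCoprime (2 * ϖ.re) s := by
            refine IsCoprime.mul_left ?_ ?_
            · refine ⟨-(s / 2), 1, ?_⟩; omega
            · rw [hs]; obtain ⟨u, v, huv⟩ := hcop
              exact ⟨u - v, v, by linear_combination huv⟩
          have := Int.isCoprime_iff_gcd_eq_one.1 h1
          simpa [Int.gcd, Int.natAbs_abs] using this
        have hsodd : Odd s.natAbs := by rw [Nat.odd_iff]; omega
        rw [jacobiSym.mul_left, jacobiSym.at_two hsodd, ZMod.χ₈_nat_eq_if_mod_eight] at h2p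
        split_ifs at h2p ⊢ <;> first | omega | (exfalso; omega)
      · have hl := Fact.mk hpp
        rw [chi_inert hχ hpp hp3 hp hpr]
        have e : Zsqrtd.norm ωg = 2 := by simp [ωg, Zsqrtd.norm]
        rw [e, jacobiSym.at_two (Nat.odd_iff.2 (by omega)), ZMod.χ₈_nat_eq_if_mod_eight]
        simp at hr ⊢
        split_ifs <;> first | rfl | (exfalso; omega)
    rw [chi_mul_den hχ _ hpr hm, ih, hprime, hmul, Int.mul_emod]
    rw [isPrimary_iff] at hm hpr
    have h1 : (ϖ.re + ϖ.im) % 8 = 1 ∨ (ϖ.re + ϖ.im) % 8 = 5 := by omega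
    have h2 : (m.re + m.im) % 8 = 1 ∨ (m.re + m.im) % 8 = 5 := by omega
    rcases h1 with h1 | h1 <;> rcases h2 with h2 | h2 <;> rw [h1, h2] <;> rfl

end QS

/-! ### The sign of the quadratic Gauss sum -/

lemma theta_split {τ : ℂ} (hτ : 0 < τ.im) {p : ℕ} (hp : 0 < p) (c : ℤ → ℂ)
    (hc : ∀ n k : ℤ, c (k * p + n) = c n) (hcb : ∀ n, ‖c n‖ ≤ 1) :
    ∑' n : ℤ, c n * cexp (π * I * n ^ 2 * τ) =
      1 / (-I * (p ^ 2 * τ)) ^ (1 / 2 : ℂ) *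
        ∑ r : Fin p, c (r : ℕ) * jacobiTheta₂ ((r : ℕ) / p) (-1 / (p ^ 2 * τ)) := by
  have := NeZero.mk hp.ne'
  have hp0 : (p : ℂ) ≠ 0 := by exact_mod_cast hp.ne'
  have hτ0 : τ ≠ 0 := by rintro rfl; simp at hτ
  have hpτ : 0 < ((p : ℂ) ^ 2 * τ).im := by
    have : ((p : ℂ) ^ 2 * τ) = ((p ^ 2 : ℝ) : ℂ) * τ := by push_cast; rfl
    rw [this, Complex.im_ofReal_mul]; positivity
  have hterm : ∀ (k : ℤ) (r : Fin p), c (k * p + (r : ℕ)) * cexp (π * I * ((k * p + (r : ℕ) : ℤ) : ℂ) ^ 2 * τ)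
      = c (r : ℕ) * cexp (π * I * (r : ℕ) ^ 2 * τ) * jacobiTheta₂_term k ((r : ℕ) * p * τ) (p ^ 2 * τ) := by
    intro k r
    rw [hc, jacobiTheta₂_term, mul_assoc (c _) _ (cexp _), ← Complex.exp_add]
    congr 2; push_cast; ring
  have hsum : Summable (fun n : ℤ => c n * cexp (π * I * n ^ 2 * τ)) := by
    have h1 := ((summable_jacobiTheta₂_term_iff 0 τ).2 hτ).norm
    refine Summable.of_norm_bounded h1 (fun n => ?_)
    rw [norm_mul, jacobiTheta₂_term]
    simp only [mul_zero, zero_add]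
    exact mul_le_of_le_one_left (norm_nonneg _) (hcb n)
  have hsum' := (Int.divModEquiv p).symm.summable_iff.2 hsum
  rw [← (Int.divModEquiv p).symm.tsum_eq]
  rw [← (Equiv.prodComm _ _).tsum_eq]
  rw [Summable.tsum_prod (f := fun x : Fin p × ℤ => c ((Int.divModEquiv p).symm
      ((Equiv.prodComm (Fin p) ℤ) x)) *
        cexp (π * I * ((Int.divModEquiv p).symm ((Equiv.prodComm (Fin p) ℤ) x) : ℤ) ^ 2 * τ))
      ((Equiv.prodComm _ _).summable_iff.2 hsum'), tsum_fintype, Finset.mul_sum]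
  refine Finset.sum_congr rfl (fun r _ => ?_)
  simp only [Equiv.prodComm_apply, Prod.swap_prod_mk, Int.divModEquiv_symm_apply]
  simp only [hterm]
  rw [tsum_mul_left, ← jacobiTheta₂, jacobiTheta₂_functional_equation]
  have e1 : -(π : ℂ) * I * ((r : ℕ) * p * τ) ^ 2 / (p ^ 2 * τ) = - (π * I * (r : ℕ) ^ 2 * τ) := by
    field_simp
  have e2 : ((r : ℕ) * p * τ) / (p ^ 2 * τ) = ((r : ℕ) / p : ℂ) := by
    field_simp
  rw [e1, e2, Complex.exp_neg]
  field_simp [Complex.exp_ne_zero]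

lemma theta_sub_one_le {x : ℝ} {τ : ℂ} (hτ : 0 < τ.im) :
    ‖jacobiTheta₂ x τ - 1‖ ≤ 2 / (1 - rexp (-π * τ.im)) * rexp (-π * τ.im) := by
  have h0 : 0 < ((τ.im : ℂ) * I).im := by simpa using hτ
  have hb := norm_jacobiTheta_sub_one_le h0
  have him : ((τ.im : ℂ) * I).im = τ.im := by simp
  rw [him] at hb
  refine le_trans ?_ hb
  have hs1 := hasSum_jacobiTheta₂_term (x : ℂ) hτ
  have hs2 := hasSum_jacobiTheta₂_term (0 : ℂ) h0
  rw [← jacobiTheta_eq_jacobiTheta₂] at hs2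
  have hz : ∀ (z σ : ℂ), jacobiTheta₂_term 0 z σ = 1 := by intro z σ; simp [jacobiTheta₂_term]
  have d1 := hs1.sub (hasSum_ite_eq (0 : ℤ) (1 : ℂ))
  have d2 := hs2.sub (hasSum_ite_eq (0 : ℤ) (1 : ℂ))
  have d2' : HasSum (fun n : ℤ => ‖jacobiTheta₂_term n x τ - (if n = 0 then 1 else 0)‖)
      ((jacobiTheta ((τ.im : ℂ) * I) - 1).re) := by
    convert Complex.hasSum_re d2 using 1
    ext n
    by_cases hn : n = 0
    · subst hn; simp [hz]
    · simp only [hn, if_false, sub_zero]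
      rw [norm_jacobiTheta₂_term, jacobiTheta₂_term]
      have : 2 * (π : ℂ) * I * n * 0 + π * I * n ^ 2 * (τ.im * I) = ((-π * n ^ 2 * τ.im : ℝ) : ℂ) := by
        push_cast
        linear_combination (π * n ^ 2 * τ.im : ℂ) * I_mul_I
      rw [this, ← Complex.ofReal_exp, Complex.ofReal_re]
      congr 1; simp
  rw [← d1.tsum_eq]
  refine (norm_tsum_le_tsum_norm d2'.summable).trans ?_
  rw [d2'.tsum_eq]
  exact Complex.re_le_norm _

lemma tendsto_theta (x : ℝ) (b : ℂ) (hb : b.im = 0) :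
    Tendsto (fun T : ℝ => jacobiTheta₂ x (b + T * I)) atTop (𝓝 1) := by
  rw [tendsto_iff_norm_sub_tendsto_zero]
  have hexp : Tendsto (fun T : ℝ => rexp (-π * T)) atTop (𝓝 0) := by
    have : Tendsto (fun T : ℝ => -π * T) atTop atBot :=
      tendsto_id.const_mul_atTop_of_neg (by linarith [Real.pi_pos])
    exact Real.tendsto_exp_atBot.comp this
  have hlim : Tendsto (fun T : ℝ => 2 / (1 - rexp (-π * T)) * rexp (-π * T)) atTop (𝓝 0) := by
    have := ((tendsto_const_nhds (x := (2:ℝ))).div (tendsto_const_nhds (x := (1:ℝ)) |>.sub hexp)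
      (by norm_num)).mul hexp
    simpa using this
  refine squeeze_zero' (Eventually.of_forall fun _ => norm_nonneg _) ?_ hlim
  filter_upwards [eventually_gt_atTop 0] with T hT
  have him : (b + T * I).im = T := by simp [hb]
  have := theta_sub_one_le (x := x) (τ := b + T * I) (by rw [him]; exact hT)
  rwa [him] at this

lemma real_mul_cpow {T : ℝ} (hT : 0 < T) {z : ℂ} (hz : z ≠ 0) (a : ℂ) :
    ((T : ℂ) * z) ^ a = (T : ℂ) ^ a * z ^ a := by
  have hT' : (T : ℂ) ≠ 0 := by exact_mod_cast hT.ne'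
  rw [Complex.cpow_def_of_ne_zero (mul_ne_zero hT' hz), Complex.cpow_def_of_ne_zero hT',
    Complex.cpow_def_of_ne_zero hz, Complex.log_ofReal_mul hT hz, ← Complex.exp_add,
    Complex.ofReal_log hT.le]
  congr 1; ring

/-- `∑_{r mod p} e(r²/p) = √p` for `p ≡ 1 mod 4`. -/
lemma gauss_sum_sign {p : ℕ} (hp : p % 4 = 1) :
    ∑ r : Fin p, cexp (2 * π * I * ((r : ℕ) : ℂ) ^ 2 / p) = (Real.sqrt p : ℂ) := by
  have hp0 : 0 < p := by omega
  have hpc : (p : ℂ) ≠ 0 := by exact_mod_cast hp0.ne'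
  have hpr : (0 : ℝ) < p := by exact_mod_cast hp0
  -- phases
  set c : ℤ → ℂ := fun n => cexp (2 * π * I * (n : ℂ) ^ 2 / p) with hc
  set d : ℤ → ℂ := fun n => cexp (-(π * I * p * (n : ℂ) ^ 2 / 2)) with hd
  have hnorm : ∀ x : ℝ, ‖cexp (x * I)‖ = 1 := Complex.norm_exp_ofReal_mul_I
  have hc1 : ∀ n k : ℤ, c (k * p + n) = c n := by
    intro n k
    simp only [hc]
    rw [Complex.exp_eq_exp_iff_exists_int]
    refine ⟨k ^ 2 * p + 2 * k * n, ?_⟩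
    push_cast; field_simp; ring
  have hd1 : ∀ n k : ℤ, d (k * (2 : ℕ) + n) = d n := by
    intro n k
    simp only [hd]
    rw [Complex.exp_eq_exp_iff_exists_int]
    refine ⟨- p * (k ^ 2 + k * n), ?_⟩
    push_cast; field_simp; ring
  have hc2 : ∀ n, ‖c n‖ ≤ 1 := by
    intro n; simp only [hc]
    have : 2 * π * I * (n : ℂ) ^ 2 / p = ((2 * π * n ^ 2 / p : ℝ) : ℂ) * I := by push_cast; ring
    rw [this, hnorm]
  have hd2 : ∀ n, ‖d n‖ ≤ 1 := by
    intro n; simp only [hd]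
    have : -(π * I * p * (n : ℂ) ^ 2 / 2) = ((-(π * p * n ^ 2 / 2) : ℝ) : ℂ) * I := by push_cast; ring
    rw [this, hnorm]
  have hd0 : d 0 = 1 := by simp [hd]
  have hd1' : d 1 = -I := by
    simp only [hd]
    obtain ⟨j, hj⟩ : ∃ j : ℕ, p = 4 * j + 1 := ⟨p / 4, by omega⟩
    have : -(π * I * p * ((1:ℤ) : ℂ) ^ 2 / 2) = -(π / 2 * I) + ((-(j : ℤ) : ℤ) : ℂ) * (2 * π * I) := by
      rw [hj]; push_cast; ring
    rw [this, Complex.exp_add, Complex.exp_int_mul_two_pi_mul_I, mul_one,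
      Complex.exp_neg, Complex.exp_pi_div_two_mul_I, Complex.inv_I]
  -- the main identity
  have key : ∀ T : ℝ, 0 < T → ∑ r : Fin p, c (r : ℕ) * jacobiTheta₂ (((r : ℕ) / p : ℝ) : ℂ) (1 / (2 * p) + T * I)
      = (I * T / (1 / (2 * p) + T * I)) ^ (1 / 2 : ℂ) * (I * p / 2 + 1 / (4 * T)) ^ (1 / 2 : ℂ) *
        (jacobiTheta₂ ((0 : ℝ) : ℂ) (0 + T * I) - I * jacobiTheta₂ ((1 / 2 : ℝ) : ℂ) (0 + T * I)) := by
    intro T hT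
    have hTc : (T : ℂ) ≠ 0 := by exact_mod_cast hT.ne'
    set v : ℂ := 1 / (2 * p) + T * I with hv
    set w : ℂ := -p / 2 + (1 / (4 * T) : ℝ) * I with hw
    have hvim : v.im = T := by
      have : v = ((1 / (2 * p) : ℝ) : ℂ) + T * I := by rw [hv]; push_cast; rfl
      rw [this]; simp
    have hwim : w.im = 1 / (4 * T) := by
      have : w = ((-p / 2 : ℝ) : ℂ) + (1 / (4 * T) : ℝ) * I := by rw [hw]; push_cast; rfl
      rw [this]; simp
    have hv0 : v ≠ 0 := by intro h; rw [h] at hvim; simp at hvim; exact hT.ne hvim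
    have hw0 : w ≠ 0 := by
      intro h; rw [h] at hwim; simp at hwim; exact hT.ne' hwim
    set τ' : ℂ := -1 / (p ^ 2 * v) with hτ'
    have hτim : 0 < τ'.im := by
      have e : τ' = ((1 / (p ^ 2) : ℝ) : ℂ) * (-v⁻¹) := by rw [hτ']; push_cast; field_simp
      rw [e, Complex.im_ofReal_mul, Complex.neg_im, Complex.inv_im, hvim]
      have : 0 < normSq v := Complex.normSq_pos.2 hv0
      rw [neg_div, neg_neg]; positivity
    have hrel : -1 / w = 2 / p + τ' := by
      have e2 : v = w * (-(2 * T * I) / p) := by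
        rw [hv, hw]; push_cast; field_simp
        linear_combination (4 : ℂ) * I_sq
      have e3 : (p : ℂ) ^ 2 * v = -(p * w * (2 * T * I)) := by rw [e2]; field_simp
      have hne : (2 * p * T * w : ℂ) ≠ 0 := by
        refine mul_ne_zero (mul_ne_zero (mul_ne_zero two_ne_zero hpc) hTc) hw0
      have e4 : τ' = -I / (2 * p * T * w) := by
        rw [hτ', div_eq_div_iff (mul_ne_zero (pow_ne_zero _ hpc) hv0) hne, e3]
        linear_combination (-2 * p * T * w : ℂ) * I_sq
      have e5 : w * (4 * T) = -2 * T * p + I := by rw [hw]; push_cast; field_simp; ring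
      rw [e4, div_add_div _ _ hpc hne, div_eq_div_iff hw0 (mul_ne_zero hpc hne)]
      linear_combination (-w * p) * e5
    -- theta at w
    have t1 : jacobiTheta₂ 0 w = 1 / (1 / (T : ℂ)) ^ (1 / 2 : ℂ) *
        (jacobiTheta₂ ((0 : ℝ) : ℂ) (0 + T * I) - I * jacobiTheta₂ ((1 / 2 : ℝ) : ℂ) (0 + T * I)) := by
      have hu : 0 < (((1 / (4 * T) : ℝ) : ℂ) * I).im := by simp; positivity
      have := theta_split hu (p := 2) (by norm_num) d hd1 hd2
      have e1 : ∑' n : ℤ, d n * cexp (π * I * n ^ 2 * (((1 / (4 * T) : ℝ) : ℂ) * I)) = jacobiTheta₂ 0 w := by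
        rw [jacobiTheta₂]
        refine tsum_congr (fun n => ?_)
        rw [jacobiTheta₂_term]; simp only [hd]
        rw [← Complex.exp_add]; congr 1; rw [hw]; ring
      rw [← e1, this, Fin.sum_univ_two]
      have e3 : -I * (((2 : ℕ) : ℂ) ^ 2 * (((1 / (4 * T) : ℝ) : ℂ) * I)) = 1 / T := by
        push_cast
        field_simp
        linear_combination (-4 : ℂ) * I_sq
      have e4 : -1 / (((2 : ℕ) : ℂ) ^ 2 * (((1 / (4 * T) : ℝ) : ℂ) * I)) = 0 + T * I := by
        push_cast
        field_simp
        linear_combination (-4 * T : ℂ) * I_sq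
      rw [e3, e4]
      have d0 : d ((((0 : Fin 2) : ℕ)) : ℤ) = 1 := by simpa using hd0
      have d1 : d ((((1 : Fin 2) : ℕ)) : ℤ) = -I := by simpa using hd1'
      have f0 : ((((0 : Fin 2) : ℕ) : ℂ) / ((2 : ℕ) : ℂ)) = ((0 : ℝ) : ℂ) := by simp
      have f1 : ((((1 : Fin 2) : ℕ) : ℂ) / ((2 : ℕ) : ℂ)) = ((1 / 2 : ℝ) : ℂ) := by simp
      rw [d0, d1, f0, f1]
      ring
    have t2 : jacobiTheta₂ 0 (-1 / w) = 1 / (I / v) ^ (1 / 2 : ℂ) *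
        ∑ r : Fin p, c (r : ℕ) * jacobiTheta₂ (((r : ℕ) / p : ℝ) : ℂ) v := by
      have := theta_split hτim hp0 c hc1 hc2
      have e1 : ∑' n : ℤ, c n * cexp (π * I * n ^ 2 * τ') = jacobiTheta₂ 0 (-1 / w) := by
        rw [jacobiTheta₂]
        refine tsum_congr (fun n => ?_)
        rw [jacobiTheta₂_term]; simp only [hc]
        rw [← Complex.exp_add]; congr 1; rw [hrel]; ring
      have e3 : -I * ((p : ℂ) ^ 2 * τ') = I / v := by
        rw [hτ']; field_simp
      have e4 : -1 / ((p : ℂ) ^ 2 * τ') = v := by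
        rw [hτ']; field_simp
      rw [← e1, this, e3, e4]
      push_cast
      rfl
    have t3 := jacobiTheta₂_functional_equation 0 w
    rw [zero_div] at t3
    have e5 : cexp (-π * I * 0 ^ 2 / w) = 1 := by simp
    rw [e5, mul_one] at t3
    have e6 : -I * w = I * p / 2 + 1 / (4 * T) := by
      rw [hw]; push_cast; linear_combination (-1 / (4 * T) : ℂ) * I_sq
    rw [e6] at t3
    have hA : (I * p / 2 + 1 / (4 * T) : ℂ) ^ (1 / 2 : ℂ) ≠ 0 := by
      rw [Complex.cpow_ne_zero_iff]; left; rw [← e6]; exact mul_ne_zero (neg_ne_zero.2 I_ne_zero) hw0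
    have hB : (I / v) ^ (1 / 2 : ℂ) ≠ 0 := by
      rw [Complex.cpow_ne_zero_iff]; left; exact div_ne_zero I_ne_zero hv0
    have hC : (1 / (T : ℂ)) ^ (1 / 2 : ℂ) ≠ 0 := by
      rw [Complex.cpow_ne_zero_iff]; left; exact one_div_ne_zero hTc
    have e7 : (I * T / v) ^ (1 / 2 : ℂ) * (1 / (T : ℂ)) ^ (1 / 2 : ℂ) = (I / v) ^ (1 / 2 : ℂ) := by
      have h8 : I / v = ((1 / T : ℝ) : ℂ) * (I * T / v) := by push_cast; field_simp
      rw [h8, real_mul_cpow (by positivity) (by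
        exact div_ne_zero (mul_ne_zero I_ne_zero hTc) hv0), mul_comm]
      push_cast; rfl
    rw [t1, t2] at t3
    rw [← e7] at t3 hB
    have hD : (I * T / v) ^ (1 / 2 : ℂ) ≠ 0 := left_ne_zero_of_mul hB
    clear_value v w
    generalize (I * p / 2 + 1 / (4 * T) : ℂ) ^ (1 / 2 : ℂ) = A at *
    generalize (I * T / v) ^ (1 / 2 : ℂ) = D at *
    generalize (1 / (T : ℂ)) ^ (1 / 2 : ℂ) = E at *
    generalize (jacobiTheta₂ ((0 : ℝ) : ℂ) (0 + T * I) -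
      I * jacobiTheta₂ ((1 / 2 : ℝ) : ℂ) (0 + T * I)) = X at *
    generalize (∑ r : Fin p, c (r : ℕ) * jacobiTheta₂ (((r : ℕ) / p : ℝ) : ℂ) v) = Y at *
    have t4 := congrArg (fun z => A * D * E * z) t3
    have t5 : A * D * E * (1 / E * X) = D * A * X := by field_simp
    have t6 : A * D * E * (1 / A * (1 / (D * E) * Y)) = Y := by field_simp
    simp only [t5, t6] at t4
    exact t4.symm
  -- limits
  have L1 : Tendsto (fun T : ℝ => ∑ r : Fin p, c (r : ℕ) *
      jacobiTheta₂ (((r : ℕ) / p : ℝ) : ℂ) (1 / (2 * p) + T * I)) atTop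
      (𝓝 (∑ r : Fin p, c (r : ℕ) * 1)) := by
    refine tendsto_finsetSum _ (fun r _ => Tendsto.const_mul _ (tendsto_theta _ _ ?_))
    have : (1 / (2 * p) : ℂ) = ((1 / (2 * p) : ℝ) : ℂ) := by push_cast; rfl
    rw [this, Complex.ofReal_im]
  have hinv : Tendsto (fun T : ℝ => (1 / (T : ℂ))) atTop (𝓝 0) := by
    have : Tendsto (fun T : ℝ => ((1 / T : ℝ) : ℂ)) atTop (𝓝 ((0 : ℝ) : ℂ)) :=
      (Complex.continuous_ofReal.tendsto _).comp (tendsto_const_nhds.div_atTop tendsto_id)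
    simpa using this
  have L2 : Tendsto (fun T : ℝ => (I * T / (1 / (2 * p) + T * I)) ^ (1 / 2 : ℂ)) atTop (𝓝 1) := by
    have h1 : Tendsto (fun T : ℝ => (I * T / (1 / (2 * p) + T * I))) atTop (𝓝 1) := by
      have h2 : Tendsto (fun T : ℝ => I / (1 / (2 * p) * (1 / (T : ℂ)) + I)) atTop
          (𝓝 (I / (1 / (2 * p) * 0 + I))) := by
        refine tendsto_const_nhds.div ((hinv.const_mul _).add tendsto_const_nhds) ?_
        simp
      have h3 : (I / (1 / (2 * p) * 0 + I) : ℂ) = 1 := by simp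
      rw [h3] at h2
      refine h2.congr' ?_
      filter_upwards [eventually_gt_atTop 0] with T hT
      have hTc : (T : ℂ) ≠ 0 := by exact_mod_cast hT.ne'
      have : (1 / (2 * p) * (1 / (T : ℂ)) + I) = (1 / (2 * p) + T * I) / T := by
        field_simp
      rw [this, div_div_eq_mul_div]
    have := h1.cpow (tendsto_const_nhds (x := (1 / 2 : ℂ))) (by simp)
    simpa using this
  have L3 : Tendsto (fun T : ℝ => (I * p / 2 + 1 / (4 * T)) ^ (1 / 2 : ℂ)) atTop
      (𝓝 ((I * p / 2) ^ (1 / 2 : ℂ))) := by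
    refine Tendsto.cpow ?_ tendsto_const_nhds ?_
    · have : Tendsto (fun T : ℝ => (I * p / 2 + (1/4) * (1 / (T : ℂ)))) atTop
        (𝓝 (I * p / 2 + (1/4) * 0)) := tendsto_const_nhds.add (hinv.const_mul _)
      rw [mul_zero, add_zero] at this
      refine this.congr (fun T => ?_)
      ring
    · rw [Complex.mem_slitPlane_iff]; right
      have : (I * p / 2 : ℂ) = ((p / 2 : ℝ) : ℂ) * I := by push_cast; ring
      rw [this]; simp; omega
  have L4 : Tendsto (fun T : ℝ => (jacobiTheta₂ ((0 : ℝ) : ℂ) (0 + T * I) -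
      I * jacobiTheta₂ ((1 / 2 : ℝ) : ℂ) (0 + T * I))) atTop (𝓝 (1 - I * 1)) :=
    (tendsto_theta _ _ (by simp)).sub ((tendsto_theta _ _ (by simp)).const_mul _)
  have hval : (I * p / 2 : ℂ) ^ (1 / 2 : ℂ) = (Real.sqrt p : ℂ) * (1 + I) / 2 := by
    have hs : ((Real.sqrt p : ℂ)) ^ 2 = p := by
      rw [← Complex.ofReal_pow, Real.sq_sqrt hpr.le]; simp
    have e : (I * p / 2 : ℂ) = ((Real.sqrt p : ℂ) * (1 + I) / 2) ^ 2 := by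
      rw [div_pow, mul_pow, hs]; linear_combination (- p / 4 : ℂ) * I_sq
    rw [e, one_div, Complex.sq_cpow_two_inv]
    have : (Real.sqrt p : ℂ) * (1 + I) / 2 = ((Real.sqrt p / 2 : ℝ) : ℂ) * (1 + I) := by
      push_cast; ring
    rw [this]; simp; omega
  have hfin := tendsto_nhds_unique (L1.congr' (by
    filter_upwards [eventually_gt_atTop 0] with T hT using key T hT)) ((L2.mul L3).mul L4)
  simp only [mul_one] at hfin
  rw [hval, one_mul] at hfin
  have : ∑ r : Fin p, cexp (2 * π * I * ((r : ℕ) : ℂ) ^ 2 / p) = ∑ r : Fin p, c (r : ℕ) := by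
    refine Finset.sum_congr rfl (fun r _ => ?_)
    simp only [hc]; push_cast; rfl
  rw [this, hfin]
  linear_combination (-(Real.sqrt p : ℂ) / 2) * I_sq

lemma eT_eq (z : ℂ) : eT z = cexp (2 * π * I * (z.im : ℂ)) := by
  unfold eT
  congr 1
  rw [← sub_div, Complex.sub_conj]
  push_cast; field_simp

lemma eT_add (z w : ℂ) : eT (z + w) = eT z * eT w := by
  rw [eT_eq, eT_eq, eT_eq, ← Complex.exp_add]; congr 1; push_cast [Complex.add_im]; ring

lemma norm_eT (z : ℂ) : ‖eT z‖ = 1 := by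
  rw [eT_eq, show (2 * π * I * (z.im : ℂ)) = ((2 * π * z.im : ℝ) : ℂ) * I by push_cast; ring,
    Complex.norm_exp_ofReal_mul_I]

lemma eT_toComplex (a : GaussianInt) : eT (GaussianInt.toComplex a) = 1 := by
  rw [eT_eq, Complex.exp_eq_one_iff]
  exact ⟨a.im, by rw [← GaussianInt.intCast_im]; push_cast; ring⟩

/-- `ẽ(a/n)` -/
def ee (a n : GaussianInt) : ℂ := eT (GaussianInt.toComplex a / GaussianInt.toComplex n)

lemma toComplex_ne_zero {n : GaussianInt} (hn : n ≠ 0) : GaussianInt.toComplex n ≠ 0 := by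
  simpa using hn

lemma ee_add (a b n : GaussianInt) : ee (a + b) n = ee a n * ee b n := by
  unfold ee; rw [map_add, add_div, eT_add]

lemma norm_ee (a n : GaussianInt) : ‖ee a n‖ = 1 := norm_eT _

lemma ee_mul_self (a : GaussianInt) {n : GaussianInt} (hn : n ≠ 0) : ee (n * a) n = 1 := by
  unfold ee; rw [map_mul, mul_div_cancel_left₀ _ (toComplex_ne_zero hn), eT_toComplex]

lemma ee_zero (n : GaussianInt) : ee 0 n = 1 := by simp [ee, eT_eq]

lemma ee_periodic {n : GaussianInt} (hn : n ≠ 0) {a b : GaussianInt} (h : n ∣ a - b) :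
    ee a n = ee b n := by
  obtain ⟨k, hk⟩ := h
  rw [show a = b + n * k by linear_combination hk, ee_add, ee_mul_self k hn, mul_one]

lemma ee_cancel (a n : GaussianInt) {c : GaussianInt} (hc : c ≠ 0) :
    ee (a * c) (n * c) = ee a n := by
  unfold ee; rw [map_mul, map_mul, mul_div_mul_right _ _ (toComplex_ne_zero hc)]

lemma dvd_of_ee {a n : GaussianInt} (hn : n ≠ 0) (h : ∀ y, ee (a * y) n = 1) : n ∣ a := by
  have hn' := toComplex_ne_zero hn
  have h1 := h 1
  have h2 := h ig
  set z := GaussianInt.toComplex a / GaussianInt.toComplex n with hz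
  have e1 : ee (a * 1) n = eT z := by simp [ee, hz]
  have e2 : ee (a * ig) n = eT (z * I) := by
    unfold ee; rw [hz, map_mul]; congr 1
    have : GaussianInt.toComplex ig = I := by simp [ig, GaussianInt.toComplex_def]
    rw [this]; ring
  rw [e1, eT_eq, Complex.exp_eq_one_iff] at h1
  rw [e2, eT_eq, Complex.exp_eq_one_iff] at h2
  obtain ⟨k, hk⟩ := h1
  obtain ⟨l, hl⟩ := h2
  have hpi := Complex.two_pi_I_ne_zero
  have f1 : z.im = k := by
    have : (z.im : ℂ) = k := mul_left_cancel₀ hpi (by linear_combination hk)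
    exact_mod_cast this
  have f2 : z.re = l := by
    have : (((z * I).im : ℝ) : ℂ) = l := mul_left_cancel₀ hpi (by linear_combination hl)
    have h3 : (z * I).im = z.re := by simp
    rw [h3] at this
    exact_mod_cast this
  refine ⟨⟨l, k⟩, ?_⟩
  apply GaussianInt.toComplex_injective
  rw [map_mul]
  have : GaussianInt.toComplex ⟨l, k⟩ = z := by
    apply Complex.ext <;> simp [GaussianInt.toComplex_def, f1, f2]
  rw [this, hz]; field_simp

section GS
variable {χ : GaussianInt → GaussianInt → ℤ} {g : GaussianInt → GaussianInt → ℂ}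

lemma gs_eq (hg : IsGaussSum χ g) (q : GaussianInt) {n : GaussianInt} (hn : n ≠ 0)
    {S : Finset GaussianInt} (hS : IsRes n S) :
    g q n = ∑ x ∈ S, (χ x n : ℂ) * ee (q * x) n := hg q n hn S hS

lemma gs_per (hχ : IsQuadSym χ) (q : GaussianInt) {n : GaussianInt} (hn : IsPrimary n) :
    ∀ x y, n ∣ x - y → (χ x n : ℂ) * ee (q * x) n = (χ y n : ℂ) * ee (q * y) n := by
  intro x y h
  rw [chi_periodic hχ hn x y h, ee_periodic hn.ne_zero (a := q * x) (b := q * y)]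
  rw [← mul_sub]; exact Dvd.dvd.mul_left h _

lemma gs_one (hχ : IsQuadSym χ) (hg : IsGaussSum χ g) (q : GaussianInt) : g q 1 = 1 := by
  have h1 : IsRes 1 {0} := by
    intro z; exact ⟨0, by simp, by simp⟩
  rw [gs_eq hg q one_ne_zero h1]
  simp [chi_one_den hχ, ee_zero]

lemma norm_gs_le (hχ : IsQuadSym χ) (hg : IsGaussSum χ g) (q : GaussianInt) {n : GaussianInt}
    (hn : IsPrimary n) : ‖g q n‖ ≤ Nm n := by
  obtain ⟨S, hS⟩ := exists_isRes hn.ne_zero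
  rw [gs_eq hg q hn.ne_zero hS, ← hS.card_eq_Nm hn.ne_zero]
  refine (norm_sum_le _ _).trans ?_
  have : ∀ x ∈ S, ‖(χ x n : ℂ) * ee (q * x) n‖ ≤ 1 := fun x _ => by
    rw [norm_mul, norm_ee, mul_one]; exact abs_chi_le hχ hn x
  simpa using Finset.sum_le_card_nsmul S _ 1 this

lemma gs_shift (hχ : IsQuadSym χ) (hg : IsGaussSum χ g) (q : GaussianInt) {n : GaussianInt}
    (hn : IsPrimary n) (d : GaussianInt) (hd : ∀ x y, χ (x + d * y) n = χ x n) (h0 : g q n ≠ 0) :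
    n ∣ q * d := by
  apply dvd_of_ee hn.ne_zero
  intro y
  obtain ⟨S, hS⟩ := exists_isRes hn.ne_zero
  have h := hS.sum_add _ (gs_per hχ q hn) (d * y)
  simp only [hd] at h
  rw [← gs_eq hg q hn.ne_zero hS] at h
  have h2 : ∑ x ∈ S, (χ x n : ℂ) * ee (q * (x + d * y)) n = g q n * ee (q * d * y) n := by
    rw [gs_eq hg q hn.ne_zero hS, Finset.sum_mul]
    refine Finset.sum_congr rfl fun x _ => ?_
    rw [mul_add, ee_add, ← mul_assoc q d y]; ring
  rw [h2] at h
  exact mul_left_cancel₀ h0 (by rw [h, mul_one])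

lemma chi_pow_den (hχ : IsQuadSym χ) (a : GaussianInt) {n : GaussianInt} (hn : IsPrimary n) (k : ℕ) :
    χ a (n ^ k) = χ a n ^ k := by
  induction k with
  | zero => simp [chi_one_den hχ]
  | succ k ih => rw [pow_succ, chi_mul_den hχ a (hn.pow k) hn, ih, pow_succ]

lemma gs_pow_dvd (hχ : IsQuadSym χ) (hg : IsGaussSum χ g) (q : GaussianInt) {n : GaussianInt}
    (hn : IsPrimary n) (k : ℕ) (h0 : g q (n ^ (k + 1)) ≠ 0) : n ^ k ∣ q := by
  have h := gs_shift hχ hg q (hn.pow (k + 1)) n (fun x y => by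
    rw [chi_pow_den hχ _ hn, chi_pow_den hχ _ hn, chi_periodic hχ hn (x + n * y) x (by simp)]) h0
  rw [pow_succ] at h
  exact (mul_dvd_mul_iff_right hn.ne_zero).1 h

lemma ee_crt (q x y : GaussianInt) {m n : GaussianInt} (hm : m ≠ 0) (hn : n ≠ 0) :
    ee (q * (n * x + m * y)) (m * n) = ee (q * x) m * ee (q * y) n := by
  rw [show q * (n * x + m * y) = (q * x) * n + (q * y) * m by ring, ee_add, ee_cancel _ _ hn,
    mul_comm m n, ee_cancel _ _ hm]

lemma chi_add_mul (hχ : IsQuadSym χ) {n : GaussianInt} (hn : IsPrimary n) (x y : GaussianInt) :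
    χ (x + n * y) n = χ x n := chi_periodic hχ hn _ _ (by simp)

lemma gs_mul (hχ : IsQuadSym χ) (hg : IsGaussSum χ g) (q : GaussianInt) {m n : GaussianInt}
    (hm : IsPrimary m) (hn : IsPrimary n) (hmn : IsCoprime m n) :
    g q (m * n) = g q m * g q n := by
  obtain ⟨S, hS⟩ := exists_isRes hm.ne_zero
  obtain ⟨T, hT⟩ := exists_isRes hn.ne_zero
  obtain ⟨U, hU⟩ := exists_isRes (hm.mul hn).ne_zero
  rw [gs_eq hg q hm.ne_zero hS, gs_eq hg q hn.ne_zero hT, gs_eq hg q (hm.mul hn).ne_zero hU,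
    hS.sum_crt hmn hT hU _ (gs_per hχ q (hm.mul hn)), Finset.sum_mul_sum]
  refine Finset.sum_congr rfl fun x _ => Finset.sum_congr rfl fun y _ => ?_
  rw [ee_crt q x y hm.ne_zero hn.ne_zero, chi_mul_den hχ _ hm hn]
  rw [chi_add_mul hχ hm, add_comm (n * x), chi_add_mul hχ hn, chi_mul hχ _ _ hm, chi_mul hχ _ _ hn,
    recip hχ hm hn]
  have h1 : χ n m * χ n m = 1 := by
    rcases chi_of_coprime hχ hm hmn.symm with h | h <;> rw [h] <;> norm_num
  have h2 : (χ n m : ℂ) * (χ n m : ℂ) = 1 := by exact_mod_cast h1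
  push_cast
  linear_combination (χ x m * χ y n * ee (q * x) m * ee (q * y) n : ℂ) * h2

lemma gs_unit_mul (hχ : IsQuadSym χ) (hg : IsGaussSum χ g) (q u : GaussianInt) {n : GaussianInt}
    (hn : IsPrimary n) (hu : IsCoprime u n) : g (q * u) n = (χ u n : ℂ) * g q n := by
  obtain ⟨S, hS⟩ := exists_isRes hn.ne_zero
  rw [gs_eq hg _ hn.ne_zero hS, gs_eq hg q hn.ne_zero hS,
    ← hS.sum_mul _ (gs_per hχ q hn) hu, Finset.mul_sum]
  refine Finset.sum_congr rfl fun x _ => ?_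
  rw [chi_mul hχ _ _ hn, mul_assoc q u x]
  have h1 : χ u n * χ u n = 1 := by
    rcases chi_of_coprime hχ hn hu with h | h <;> rw [h] <;> norm_num
  have h2 : (χ u n : ℂ) * (χ u n : ℂ) = 1 := by exact_mod_cast h1
  push_cast
  linear_combination (-χ x n * ee (q * (u * x)) n : ℂ) * h2
end GS

lemma sum_zmod_range {M : Type*} [AddCommMonoid M] (p : ℕ) [NeZero p] (F : ZMod p → M) :
    ∑ x ∈ Finset.range p, F (x : ZMod p) = ∑ a : ZMod p, F a := by
  refine Finset.sum_nbij (fun x => (x : ZMod p)) (fun _ _ => Finset.mem_univ _) ?_ ?_ (fun _ _ => rfl)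
  · intro x hx y hy hxy
    simp only [Finset.coe_range, Set.mem_Iio] at hx hy
    have := (ZMod.natCast_eq_natCast_iff' x y p).1 hxy
    rwa [Nat.mod_eq_of_lt hx, Nat.mod_eq_of_lt hy] at this
  · intro a _
    exact ⟨a.val, by simpa using ZMod.val_lt a, by simp⟩

lemma stdChar_int {p : ℕ} [NeZero p] (x : ℤ) :
    (ZMod.stdAddChar (x : ZMod p) : ℂ) = cexp (2 * π * I * x / p) := ZMod.stdAddChar_coe x

lemma stdChar_ne_one {p : ℕ} [Fact p.Prime] : (ZMod.stdAddChar : AddChar (ZMod p) ℂ) ≠ 1 := by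
  have := ZMod.isPrimitive_stdAddChar p
  have h := this (a := 1) one_ne_zero
  simpa using h

lemma sum_stdChar {p : ℕ} [Fact p.Prime] : ∑ a : ZMod p, (ZMod.stdAddChar a : ℂ) = 0 :=
  AddChar.sum_eq_zero_of_ne_one stdChar_ne_one

lemma gauss_quad {p : ℕ} [hf : Fact p.Prime] (h1 : p % 4 = 1) :
    ∑ a : ZMod p, (quadraticChar (ZMod p) a : ℂ) * ZMod.stdAddChar a = (Real.sqrt p : ℂ) := by
  have hs : ∑ a : ZMod p, (ZMod.stdAddChar (a ^ 2) : ℂ) = (Real.sqrt p : ℂ) := by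
    rw [← gauss_sum_sign h1, ← sum_zmod_range p, Finset.sum_range]
    refine Finset.sum_congr rfl fun r _ => ?_
    have := stdChar_int (p := p) (((r : ℕ) : ℤ) ^ 2)
    push_cast at this
    rw [this]
  rw [← hs]
  have hp2 : ringChar (ZMod p) ≠ 2 := by
    rw [ZMod.ringChar_zmod_n]; rintro rfl; omega
  have h2 : ∑ a : ZMod p, (ZMod.stdAddChar (a ^ 2) : ℂ) =
      ∑ b : ZMod p, ∑ a ∈ Finset.univ.filter (fun a : ZMod p => a ^ 2 = b),
        (ZMod.stdAddChar (a ^ 2) : ℂ) :=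
    (Finset.sum_fiberwise _ _ _).symm
  rw [h2]
  have h3 : ∀ b : ZMod p, ∑ a ∈ Finset.univ.filter (fun a : ZMod p => a ^ 2 = b),
        (ZMod.stdAddChar (a ^ 2) : ℂ) = (quadraticChar (ZMod p) b : ℂ) * ZMod.stdAddChar b
          + ZMod.stdAddChar b := by
    intro b
    have h4 : ∑ a ∈ Finset.univ.filter (fun a : ZMod p => a ^ 2 = b),
        (ZMod.stdAddChar (a ^ 2) : ℂ) = ∑ a ∈ Finset.univ.filter (fun a : ZMod p => a ^ 2 = b),
        (ZMod.stdAddChar b : ℂ) := by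
      refine Finset.sum_congr rfl fun a ha => ?_
      rw [(Finset.mem_filter.1 ha).2]
    rw [h4, Finset.sum_const]
    have h5 := quadraticChar_card_sqrts hp2 b
    have h6 : ({x : ZMod p | x ^ 2 = b}.toFinset) = Finset.univ.filter (fun a : ZMod p => a ^ 2 = b) := by
      ext; simp
    rw [h6] at h5
    have h7 : ((Finset.univ.filter (fun a : ZMod p => a ^ 2 = b)).card : ℂ) =
      (quadraticChar (ZMod p) b : ℂ) + 1 := by exact_mod_cast h5
    rw [nsmul_eq_mul, h7]; ring
  rw [Finset.sum_congr rfl fun b _ => h3 b, Finset.sum_add_distrib, sum_stdChar, add_zero]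

lemma jac_quad {p : ℕ} [hf : Fact p.Prime] (x : ℤ) : jacobiSym x p = quadraticChar (ZMod p) x := by
  rw [jacobi_prime p hf.out]; rfl

lemma gauss_quad_shift {p : ℕ} [hf : Fact p.Prime] (h1 : p % 4 = 1) {b : ZMod p} (hb : b ≠ 0) :
    ∑ a : ZMod p, (quadraticChar (ZMod p) a : ℂ) * ZMod.stdAddChar (b * a) =
      (quadraticChar (ZMod p) b : ℂ) * (Real.sqrt p : ℂ) := by
  rw [← gauss_quad h1, Finset.mul_sum,
    ← Equiv.sum_comp (Equiv.mulLeft₀ b hb) (fun a => (quadraticChar (ZMod p) b : ℂ) *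
      ((quadraticChar (ZMod p) a : ℂ) * ZMod.stdAddChar a))]
  refine Finset.sum_congr rfl fun a _ => ?_
  change _ = _ * (((quadraticChar (ZMod p) (b * a) : ℤ) : ℂ) * ZMod.stdAddChar (b * a))
  rw [map_mul (quadraticChar (ZMod p))]
  have : (quadraticChar (ZMod p) b : ℂ) ^ 2 = 1 := by exact_mod_cast quadraticChar_sq_one hb
  push_cast
  linear_combination (-(quadraticChar (ZMod p) a : ℂ) * ZMod.stdAddChar (b * a)) * this

lemma isRes_split {ϖ : GaussianInt} {p : ℕ} (hpp : p.Prime) (hN : Zsqrtd.norm ϖ = p)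
     :
    IsRes ϖ ((Finset.range p).image (fun x : ℕ => (x : GaussianInt))) := by
  have hdvd : ∀ z : GaussianInt, ϖ ∣ z → (p : ℤ) ∣ Zsqrtd.norm z := by
    rintro z ⟨k, rfl⟩; rw [Zsqrtd.norm_mul, hN]; exact dvd_mul_right _ _
  have hpd : ϖ ∣ (p : GaussianInt) := by
    have := Zsqrtd.norm_eq_mul_conj ϖ
    rw [hN] at this
    exact ⟨star ϖ, by simpa using this⟩
  have hn := norm_def' ϖ
  rw [hN] at hn
  have hcop : IsCoprime ϖ.im (p : ℤ) := by
    have h := sum_sq_coprime (prime_no_sq hpp) hn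
    rw [hn]
    have := (h.symm.pow_right (n := 2)).add_mul_left_right (ϖ.im)
    rwa [← sq] at this
  obtain ⟨u, v, huv⟩ := hcop
  intro z
  have hex : ∃ x : ℤ, ϖ ∣ z - (x : GaussianInt) := by
    refine ⟨z.re - z.im * u * ϖ.re, ?_⟩
    have : z - ((z.re - z.im * u * ϖ.re : ℤ) : GaussianInt) =
      ϖ * ((z.im * u : ℤ) : GaussianInt) + (p : GaussianInt) * ⟨0, z.im * v⟩ := by
      ext
      · simp [Zsqrtd.re_mul]; ring
      · simp [Zsqrtd.im_mul]; linear_combination -z.im * huv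
    rw [this]
    exact dvd_add (dvd_mul_right _ _) (Dvd.dvd.mul_right hpd _)
  obtain ⟨x, hx⟩ := hex
  have hp0 : (0 : ℤ) < p := by exact_mod_cast hpp.pos
  refine ⟨((x % p).toNat : GaussianInt), ⟨?_, ?_⟩, ?_⟩
  · rw [Finset.mem_image]
    refine ⟨(x % p).toNat, ?_, rfl⟩
    have := Int.emod_lt_of_pos x hp0
    have := Int.emod_nonneg x hp0.ne'
    rw [Finset.mem_range]; omega
  · have h2 := Int.emod_nonneg x hp0.ne'
    have h1 : (((x % p).toNat : ℕ) : GaussianInt) = ((x % p : ℤ) : GaussianInt) := by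
      rw [← Int.cast_natCast, Int.toNat_of_nonneg h2]
    rw [h1]
    have h3 : z - ((x % p : ℤ) : GaussianInt) = (z - (x : GaussianInt)) + (p : GaussianInt) * ((x / p : ℤ) : GaussianInt) := by
      have := Int.emod_add_mul_ediv x p
      have h4 : ((x % p : ℤ) : GaussianInt) + (p : GaussianInt) * ((x / p : ℤ) : GaussianInt) = (x : GaussianInt) := by
        exact_mod_cast congrArg (fun t : ℤ => (t : GaussianInt)) this
      rw [← h4]; ring
    rw [h3]
    exact dvd_add hx (Dvd.dvd.mul_right hpd _)
  · rintro y ⟨hy, hyd⟩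
    rw [Finset.mem_image] at hy
    obtain ⟨t, ht, rfl⟩ := hy
    have h1 : ϖ ∣ ((x - t : ℤ) : GaussianInt) := by
      have := dvd_sub hyd hx
      have e : z - (t : GaussianInt) - (z - (x : GaussianInt)) = ((x - t : ℤ) : GaussianInt) := by
        push_cast; ring
      rwa [e] at this
    have h2 := hdvd _ h1
    rw [Zsqrtd.norm_intCast] at h2
    have h3 : (p : ℤ) ∣ x - t := by
      rcases (Nat.prime_iff_prime_int.1 hpp).dvd_or_dvd h2 with h | h <;> exact h
    have h4 : x % p = t := by
      have h6 : (x - t) % p = 0 := Int.emod_eq_zero_of_dvd h3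
      have h5 : x % p = (t : ℤ) % p := Int.emod_eq_emod_iff_emod_sub_eq_zero.2 h6
      rw [h5]; rw [Finset.mem_range] at ht
      exact Int.emod_eq_of_lt (by omega) (by omega)
    rw [h4]; simp

section GS
variable {χ : GaussianInt → GaussianInt → ℤ} {g : GaussianInt → GaussianInt → ℂ}

lemma ee_im (a n : GaussianInt) : ee a n =
    cexp (2 * π * I * (a.im * n.re - a.re * n.im : ℤ) / (Zsqrtd.norm n : ℤ)) := by
  unfold ee
  rw [eT_eq]
  congr 1
  have : (GaussianInt.toComplex a / GaussianInt.toComplex n).im =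
      (a.im * n.re - a.re * n.im : ℤ) / (Zsqrtd.norm n : ℤ) := by
    rw [Complex.div_im]
    simp only [← GaussianInt.intCast_im, ← GaussianInt.intCast_re, ← GaussianInt.intCast_real_norm]
    push_cast; ring
  rw [this]; push_cast; ring

lemma gs_split (hχ : IsQuadSym χ) (hg : IsGaussSum χ g) {ϖ : GaussianInt} (hp : Prime ϖ)
    (hpr : IsPrimary ϖ) {p : ℕ} (hpp : p.Prime) (h1 : p % 4 = 1) (hN : Zsqrtd.norm ϖ = p) :
    g 1 ϖ = (χ ig ϖ : ℂ) * (Real.sqrt (Nm ϖ) : ℂ) := by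
  have hf := Fact.mk hpp
  rw [gs_eq hg 1 hpr.ne_zero (isRes_split hpp hN), Finset.sum_image (by
    intro x hx y hy hxy; simpa using congrArg Zsqrtd.re hxy)]
  have hb : ((-ϖ.im : ℤ) : ZMod p) ≠ 0 := by
    intro h
    rw [ZMod.intCast_zmod_eq_zero_iff_dvd] at h
    have hn := norm_def' ϖ
    rw [hN] at hn
    have h2 := sum_sq_coprime (prime_no_sq hpp) hn
    have h3 : (p : ℤ) ∣ ϖ.im := by simpa using h
    have h4 : (p : ℤ) ∣ ϖ.re := by
      have : (p : ℤ) ∣ ϖ.re ^ 2 := by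
        have := dvd_sub (dvd_refl (p : ℤ)) (h3.mul_right ϖ.im)
        rwa [show (p : ℤ) - ϖ.im * ϖ.im = ϖ.re ^ 2 by rw [hn]; ring] at this
      exact (Nat.prime_iff_prime_int.1 hpp).dvd_of_dvd_pow this
    have := h2.isUnit_of_dvd' h4 h3
    rw [Int.isUnit_iff] at this
    have := hpp.two_le
    omega
  have h2 := gauss_quad_shift h1 hb
  have h3 : χ ig ϖ = jacobiSym ϖ.im p := by
    rw [chi_split hχ hp hpr hpp hN]; simp [ig]
  rw [← jac_quad, jacobi_neg_one_mod_four h1, ← h3] at h2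
  have h4 : Nm ϖ = p := by unfold Nm; rw [hN]; simp
  rw [h4, ← h2, ← sum_zmod_range p]
  refine Finset.sum_congr rfl fun x _ => ?_
  have h5 := chi_split_int hχ hp hpr hpp hN x
  rw [Int.cast_natCast] at h5
  rw [h5, jac_quad, one_mul, ee_im, hN]
  have h6 := stdChar_int (p := p) (-ϖ.im * x)
  push_cast at h6 ⊢
  rw [h6]
  congr 2
  simp
  ring

lemma inert_sum (hχ : IsQuadSym χ) {p : ℕ} (hpp : p.Prime) (h3 : p % 4 = 3)
    (hp : Prime (-(p : GaussianInt))) (hpr : IsPrimary (-(p : GaussianInt)))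
    {S : Finset GaussianInt} (hS : IsRes (-(p : GaussianInt)) S) :
    ∑ x ∈ S, (χ x (-(p : GaussianInt)) : ℂ) = 0 := by
  have hf := Fact.mk hpp
  have hp2 : ringChar (ZMod p) ≠ 2 := by
    rw [ZMod.ringChar_zmod_n]; rintro rfl; omega
  obtain ⟨n, hn⟩ := quadraticChar_exists_neg_one hp2
  obtain ⟨a, b, hab⟩ := ZMod.sq_add_sq p n
  set u : GaussianInt := ⟨a.val, b.val⟩ with hu
  have h1 : χ u (-(p : GaussianInt)) = -1 := by
    rw [chi_inert hχ hpp h3 hp hpr, jac_quad, norm_def']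
    refine Eq.trans ?_ hn
    rw [← hab]
    simp [hu]
  have hcop : IsCoprime u (-(p : GaussianInt)) := by
    by_contra h
    rw [chi_of_not_coprime hχ hpr h] at h1
    norm_num at h1
  have h2 := hS.sum_mul (fun x => (χ x (-(p : GaussianInt)) : ℂ)) (fun x y h => by
    rw [chi_periodic hχ hpr x y h]) hcop
  simp only [chi_mul hχ _ _ hpr, h1] at h2
  push_cast at h2
  rw [← Finset.mul_sum] at h2
  linear_combination (-1 / 2 : ℂ) * h2

lemma gs_inert (hχ : IsQuadSym χ) (hg : IsGaussSum χ g) {p : ℕ} (hpp : p.Prime) (h3 : p % 4 = 3)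
    (hp : Prime (-(p : GaussianInt))) (hpr : IsPrimary (-(p : GaussianInt))) :
    g 1 (-(p : GaussianInt)) = p := by
  have hf := Fact.mk hpp
  have hS : IsRes (-(p : GaussianInt)) (boxRes p) := by
    have := isRes_boxRes hpp.pos
    intro z
    simpa using this z
  have hinj : Set.InjOn (fun p : ℕ × ℕ => (⟨p.1, p.2⟩ : GaussianInt))
      (Finset.range p ×ˢ Finset.range p : Finset (ℕ × ℕ)) := by
    rintro ⟨x, y⟩ _ ⟨x', y'⟩ _ h
    have h1 := congrArg Zsqrtd.re h
    have h2 := congrArg Zsqrtd.im h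
    simp at h1 h2
    rw [h1, h2]
  have hval : ∀ x y : ℕ, χ ⟨x, y⟩ (-(p : GaussianInt)) =
      quadraticChar (ZMod p) ((x : ZMod p) ^ 2 + (y : ZMod p) ^ 2) := by
    intro x y
    rw [chi_inert hχ hpp h3 hp hpr, jac_quad, norm_def']
    push_cast; rfl
  have t0 := inert_sum hχ hpp h3 hp hpr hS
  have t1 := gs_eq hg 1 hpr.ne_zero hS
  unfold boxRes at t0 t1
  rw [Finset.sum_image hinj, Finset.sum_product_right] at t0 t1
  have e1 : ∀ x y : ℕ, ee (1 * ⟨x, y⟩) (-(p : GaussianInt)) = ZMod.stdAddChar (-(y : ZMod p)) := by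
    intro x y
    have h6 := stdChar_int (p := p) (-(y : ℤ))
    push_cast at h6
    rw [h6, one_mul, ee_im, inert_norm]
    congr 1
    have : (p : ℂ) ≠ 0 := by exact_mod_cast hpp.ne_zero
    simp
    field_simp
  simp only [hval, e1] at t0 t1
  set A : ℂ := ∑ x : ZMod p, (quadraticChar (ZMod p) (x ^ 2 + 1) : ℂ) with hA
  have hin : ∀ y : ZMod p, ∑ x ∈ Finset.range p, ((quadraticChar (ZMod p)
      ((x : ZMod p) ^ 2 + y ^ 2) : ℤ) : ℂ) = if y = 0 then (p : ℂ) - 1 else A := by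
    intro y
    rw [sum_zmod_range p (fun x : ZMod p => ((quadraticChar (ZMod p) (x ^ 2 + y ^ 2) : ℤ) : ℂ))]
    split_ifs with hy
    · subst hy
      have : ∀ x : ZMod p, ((quadraticChar (ZMod p) (x ^ 2 + 0 ^ 2) : ℤ) : ℂ) = 1 - if x = 0 then 1 else 0 := by
        intro x
        split_ifs with hx
        · subst hx; simp
        · have : x ^ 2 + 0 ^ 2 = x ^ 2 := by ring
          rw [this, map_pow, quadraticChar_sq_one hx]; simp
      rw [Finset.sum_congr rfl fun x _ => this x, Finset.sum_sub_distrib]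
      simp [ZMod.card]
    · rw [hA, ← Equiv.sum_comp (Equiv.mulLeft₀ y hy)]
      refine Finset.sum_congr rfl fun x _ => ?_
      change ((quadraticChar (ZMod p) ((y * x) ^ 2 + y ^ 2) : ℤ) : ℂ) = _
      rw [show (y * x) ^ 2 + y ^ 2 = y ^ 2 * (x ^ 2 + 1) by ring, map_mul, map_pow,
        quadraticChar_sq_one hy, one_mul]
  have hdelta : ∀ (F : ZMod p → ℂ), ∑ y : ZMod p, (if y = 0 then (p : ℂ) - 1 else A) * F y =
      ((p : ℂ) - 1 - A) * F 0 + A * ∑ y : ZMod p, F y := by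
    intro F
    have : ∀ y : ZMod p, (if y = 0 then (p : ℂ) - 1 else A) * F y =
      (if y = 0 then ((p : ℂ) - 1 - A) * F 0 else 0) + A * F y := by
      intro y; split_ifs with h
      · subst h; ring
      · ring
    rw [Finset.sum_congr rfl fun y _ => this y, Finset.sum_add_distrib, ← Finset.mul_sum]
    simp
  have t0' : ∑ y : ZMod p, (if y = 0 then (p : ℂ) - 1 else A) * 1 = 0 := by
    rw [← t0, ← sum_zmod_range p]
    refine Finset.sum_congr rfl fun y _ => ?_
    rw [hin y, mul_one]
  have t1' : g 1 (-(p : GaussianInt)) =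
      ∑ y : ZMod p, (if y = 0 then (p : ℂ) - 1 else A) * ZMod.stdAddChar (-y) := by
    rw [t1, ← sum_zmod_range p]
    refine Finset.sum_congr rfl fun y _ => ?_
    rw [← hin y, Finset.sum_mul]
  rw [hdelta] at t0'
  rw [hdelta (fun y => ZMod.stdAddChar (-y))] at t1'
  have h0 : ∑ y : ZMod p, (ZMod.stdAddChar (-y) : ℂ) = 0 := by
    rw [← sum_stdChar (p := p)]
    exact Equiv.sum_comp (Equiv.neg (ZMod p)) (fun y => (ZMod.stdAddChar y : ℂ))
  rw [h0] at t1'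
  simp only [neg_zero, AddChar.map_zero_eq_one, mul_one, mul_zero, add_zero] at t1'
  simp only [Finset.sum_const, Finset.card_univ, ZMod.card, nsmul_eq_mul, mul_one] at t0'
  have hp1 : (p : ℂ) - 1 ≠ 0 := by
    have := hpp.one_lt
    rw [sub_ne_zero]; exact_mod_cast this.ne'
  have hA1 : A = -1 := by
    have : ((p : ℂ) - 1) * (A + 1) = 0 := by linear_combination t0'
    rcases mul_eq_zero.1 this with h | h
    · exact absurd h hp1
    · linear_combination h
  rw [t1', hA1]; ring

lemma gs_prime_one (hχ : IsQuadSym χ) (hg : IsGaussSum χ g) {ϖ : GaussianInt} (hp : Prime ϖ)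
    (hpr : IsPrimary ϖ) : g 1 ϖ = (χ ig ϖ : ℂ) * (Real.sqrt (Nm ϖ) : ℂ) := by
  rcases primary_prime_cases hp hpr with ⟨p, hpp, h1, hN⟩ | ⟨p, hpp, h3, rfl⟩
  · exact gs_split hχ hg hp hpr hpp h1 hN
  · have : χ ig (-(p : GaussianInt)) = 1 := by
      rw [chi_inert hχ hpp h3 hp hpr, norm_def']; simp [ig]
    have h2 : Nm (-(p : GaussianInt)) = (p : ℝ) ^ 2 := by unfold Nm; rw [inert_norm]; simp
    rw [gs_inert hχ hg hpp h3 hp hpr, this, h2, Real.sqrt_sq (by positivity)]; simp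

lemma sum_chi_prime (hχ : IsQuadSym χ) {ϖ : GaussianInt} (hp : Prime ϖ)
    (hpr : IsPrimary ϖ) {S : Finset GaussianInt} (hS : IsRes ϖ S) : ∑ x ∈ S, (χ x ϖ : ℂ) = 0 := by
  rcases primary_prime_cases hp hpr with ⟨p, hpp, h1, hN⟩ | ⟨p, hpp, h3, rfl⟩
  · have hf := Fact.mk hpp
    rw [hS.sum_eq (isRes_split hpp hN) (fun x => (χ x ϖ : ℂ)) (fun x y h => by
      rw [chi_periodic hχ hpr x y h]), Finset.sum_image (by
      intro x hx y hy hxy; simpa using congrArg Zsqrtd.re hxy)]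
    have hp2 : ringChar (ZMod p) ≠ 2 := by
      rw [ZMod.ringChar_zmod_n]; rintro rfl; omega
    have := quadraticChar_sum_zero hp2
    have h2 : ∑ a : ZMod p, (quadraticChar (ZMod p) a : ℂ) = 0 := by exact_mod_cast this
    rw [← h2, ← sum_zmod_range p]
    refine Finset.sum_congr rfl fun x _ => ?_
    have h5 := chi_split_int hχ hp hpr hpp hN x
    rw [Int.cast_natCast] at h5
    rw [h5, jac_quad]; simp
  · exact inert_sum hχ hpp h3 hp hpr hS

lemma gs_prime (hχ : IsQuadSym χ) (hg : IsGaussSum χ g) {ϖ : GaussianInt} (hp : Prime ϖ)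
    (hpr : IsPrimary ϖ) (q : GaussianInt) :
    g q ϖ = (χ (ig * q) ϖ : ℂ) * (Real.sqrt (Nm ϖ) : ℂ) := by
  by_cases h : ϖ ∣ q
  · rw [hχ.zero_of_dvd _ _ hp (h.mul_left _)]
    obtain ⟨S, hS⟩ := exists_isRes hpr.ne_zero
    rw [gs_eq hg _ hpr.ne_zero hS, Int.cast_zero, zero_mul, ← sum_chi_prime hχ hp hpr hS]
    refine Finset.sum_congr rfl fun x _ => ?_
    obtain ⟨k, rfl⟩ := h
    rw [mul_assoc, ee_mul_self _ hpr.ne_zero, mul_one]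
  · have hc : IsCoprime q ϖ := ((hp.irreducible.coprime_iff_not_dvd).2 h).symm
    have := gs_unit_mul hχ hg 1 q hpr hc
    rw [one_mul] at this
    rw [this, gs_prime_one hχ hg hp hpr, chi_mul hχ _ _ hpr]; push_cast; ring
end GS

/-- `u` tends to `a` rapidly at infinity -/
def Rapid (u : ℝ → ℂ) (a : ℂ) : Prop := ∀ r : ℝ, (fun x => u x - a) =O[atTop] (fun x : ℝ => x ^ r)

lemma Rapid.mul {u v : ℝ → ℂ} {a b : ℂ} (hu : Rapid u a) (hv : Rapid v b) :
    Rapid (fun x => u x * v x) (a * b) := by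
  intro r
  have h1 : v =O[atTop] (fun _ : ℝ => (1 : ℝ)) := by
    have h2 := (hv 0).add (Asymptotics.isBigO_const_const b (one_ne_zero (α := ℝ)) atTop |>.congr_right
      (fun x => (Real.rpow_zero x).symm))
    refine (h2.congr_left (fun x => ?_)).congr_right (fun x => Real.rpow_zero x)
    ring
  have h3 := (((hu r).mul h1).congr_right (fun x => mul_one _)).add ((hv r).const_mul_left a)
  refine h3.congr_left (fun x => ?_)
  ring

lemma rapid_of_exp {u : ℝ → ℝ} {a : ℝ} (h : ∃ p : ℝ, 0 < p ∧
    (fun x => u x - a) =O[atTop] (fun x => rexp (-p * x))) : Rapid (fun x => (u x : ℂ)) a := by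
  intro r
  obtain ⟨p, hp, h1⟩ := h
  have h2 := h1.trans (isLittleO_exp_neg_mul_rpow_atTop hp r).isBigO
  refine Asymptotics.IsBigO.trans ?_ h2
  refine Asymptotics.IsBigO.of_bound 1 (Eventually.of_forall fun x => ?_)
  rw [← Complex.ofReal_sub, Complex.norm_real, one_mul]

/-- even kernel product at a complex number -/
def eK (z : ℂ) (x : ℝ) : ℂ :=
  (HurwitzZeta.evenKernel (z.re : UnitAddCircle) x : ℂ) * (HurwitzZeta.evenKernel (z.im : UnitAddCircle) x : ℂ)

/-- cosine kernel product at a complex number -/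
def cK (z : ℂ) (x : ℝ) : ℂ :=
  (HurwitzZeta.cosKernel (z.re : UnitAddCircle) x : ℂ) * (HurwitzZeta.cosKernel (z.im : UnitAddCircle) x : ℂ)

lemma eK_feq (z : ℂ) {x : ℝ} (hx : 0 < x) : eK z (1 / x) = x * cK z x := by
  unfold eK cK
  rw [HurwitzZeta.evenKernel_functional_equation, HurwitzZeta.evenKernel_functional_equation,
    one_div_one_div]
  have h1 : (1 / (1 / x) ^ (1 / 2 : ℝ)) * (1 / (1 / x) ^ (1 / 2 : ℝ)) = x := by
    rw [← Real.sqrt_eq_rpow, div_mul_div_comm, Real.mul_self_sqrt (by positivity)]; field_simp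
  have h2 : ((1 / (1 / x) ^ (1 / 2 : ℝ) : ℝ) : ℂ) * ((1 / (1 / x) ^ (1 / 2 : ℝ) : ℝ) : ℂ) = x := by
    exact_mod_cast congrArg (fun t : ℝ => (t : ℂ)) h1
  rw [Complex.ofReal_mul, Complex.ofReal_mul]
  linear_combination (HurwitzZeta.cosKernel (z.re : UnitAddCircle) x : ℂ) *
    (HurwitzZeta.cosKernel (z.im : UnitAddCircle) x : ℂ) * h2

lemma eK_rapid (z : ℂ) : Rapid (eK z) ((if (z.re : UnitAddCircle) = 0 then 1 else 0) *
    (if (z.im : UnitAddCircle) = 0 then 1 else 0)) := by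
  have h1 := rapid_of_exp (HurwitzZeta.isBigO_atTop_evenKernel_sub (z.re : UnitAddCircle))
  have h2 := rapid_of_exp (HurwitzZeta.isBigO_atTop_evenKernel_sub (z.im : UnitAddCircle))
  have := h1.mul h2
  refine Eq.mp (congrArg (Rapid (eK z)) ?_) this
  congr 1 <;> split_ifs <;> simp

lemma cK_rapid (z : ℂ) : Rapid (cK z) 1 := by
  have h1 := rapid_of_exp (HurwitzZeta.isBigO_atTop_cosKernel_sub (z.re : UnitAddCircle))
  have h2 := rapid_of_exp (HurwitzZeta.isBigO_atTop_cosKernel_sub (z.im : UnitAddCircle))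
  have := h1.mul h2
  rw [Complex.ofReal_one, mul_one] at this
  exact this

lemma eK_cont (z : ℂ) : ContinuousOn (eK z) (Set.Ioi 0) :=
  (continuous_ofReal.comp_continuousOn (HurwitzZeta.continuousOn_evenKernel _)).mul
    (continuous_ofReal.comp_continuousOn (HurwitzZeta.continuousOn_evenKernel _))

lemma cK_cont (z : ℂ) : ContinuousOn (cK z) (Set.Ioi 0) :=
  (continuous_ofReal.comp_continuousOn (HurwitzZeta.continuousOn_cosKernel _)).mul
    (continuous_ofReal.comp_continuousOn (HurwitzZeta.continuousOn_cosKernel _))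

lemma Rapid.const_mul {u : ℝ → ℂ} {a : ℂ} (hu : Rapid u a) (c : ℂ) :
    Rapid (fun x => c * u x) (c * a) := by
  intro r
  refine ((hu r).const_mul_left c).congr_left (fun x => ?_)
  ring

lemma Rapid.sum {ι : Type*} {s : Finset ι} {u : ι → ℝ → ℂ} {a : ι → ℂ} (h : ∀ i ∈ s, Rapid (u i) (a i)) :
    Rapid (fun x => ∑ i ∈ s, u i x) (∑ i ∈ s, a i) := by
  intro r
  refine (Asymptotics.IsBigO.sum (fun i hi => h i hi r)).congr_left (fun x => ?_)
  rw [Finset.sum_apply, Finset.sum_sub_distrib]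

/-- the point `r/c` -/
def qt (r c : GaussianInt) : ℂ := GaussianInt.toComplex r / GaussianInt.toComplex c

lemma dvd_of_qt {r c : GaussianInt} (hc : c ≠ 0) (h1 : ((qt r c).re : UnitAddCircle) = 0)
    (h2 : ((qt r c).im : UnitAddCircle) = 0) : c ∣ r := by
  rw [AddCircle.coe_eq_zero_iff] at h1 h2
  obtain ⟨a, ha⟩ := h1
  obtain ⟨b, hb⟩ := h2
  simp only [zsmul_one] at ha hb
  refine ⟨⟨a, b⟩, ?_⟩
  apply GaussianInt.toComplex_injective
  rw [map_mul]
  have : GaussianInt.toComplex ⟨a, b⟩ = qt r c := by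
    apply Complex.ext <;> simp [GaussianInt.toComplex_def, ha, hb]
  rw [this, qt]
  have := toComplex_ne_zero hc
  field_simp

section pair
variable (c : GaussianInt) (hc : c ≠ 0) (F : GaussianInt → ℂ) (h0 : ∀ x, c ∣ x → F x = 0)
  (S : Finset GaussianInt)

/-- theta pair for a periodic function -/
def thPair : WeakFEPair ℂ where
  f x := ∑ r ∈ S, F r * eK (qt r c) x
  g x := ∑ r ∈ S, F r * cK (qt r c) x
  k := 1
  ε := 1
  f₀ := 0
  g₀ := ∑ r ∈ S, F r
  hf_int := (continuousOn_finsetSum _ fun r _ => continuousOn_const.mul (eK_cont _)).locallyIntegrableOn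
    measurableSet_Ioi
  hg_int := (continuousOn_finsetSum _ fun r _ => continuousOn_const.mul (cK_cont _)).locallyIntegrableOn
    measurableSet_Ioi
  hk := one_pos
  hε := one_ne_zero
  h_feq := by
    intro x hx
    rw [Set.mem_Ioi] at hx
    simp only [eK_feq _ hx]
    rw [Real.rpow_one, one_mul, smul_eq_mul, Finset.mul_sum]
    exact Finset.sum_congr rfl fun r _ => by ring
  hf_top := by
    have h : Rapid (fun x => ∑ r ∈ S, F r * eK (qt r c) x) (∑ r ∈ S, 0) := by
      refine Rapid.sum fun r _ => ?_
      have := (eK_rapid (qt r c)).const_mul (F r)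
      convert this using 1
      by_cases h : c ∣ r
      · rw [h0 r h, zero_mul]
      · by_cases h1 : ((qt r c).re : UnitAddCircle) = 0
        · have h2 : ¬ ((qt r c).im : UnitAddCircle) = 0 := fun h2 => h (dvd_of_qt hc h1 h2)
          simp [h2]
        · simp [h1]
    rw [Finset.sum_const_zero] at h
    exact h
  hg_top := by
    have h : Rapid (fun x => ∑ r ∈ S, F r * cK (qt r c) x) (∑ r ∈ S, F r * 1) :=
      Rapid.sum fun r _ => (cK_rapid (qt r c)).const_mul (F r)
    simp only [mul_one] at h
    exact h
end pair

/-- finite Fourier transform -/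
def fhat (F : GaussianInt → ℂ) (S : Finset GaussianInt) (c k : GaussianInt) : ℂ :=
  ∑ r ∈ S, F r * ee (k * r) c

/-- `ℤ × ℤ ≃ ℤ[i]` -/
def giEquiv : ℤ × ℤ ≃ GaussianInt where
  toFun p := ⟨p.1, p.2⟩
  invFun z := (z.re, z.im)
  left_inv _ := rfl
  right_inv _ := rfl

/-- swapped -/
def giEquiv' : ℤ × ℤ ≃ GaussianInt where
  toFun p := ⟨p.2, p.1⟩
  invFun z := (z.im, z.re)
  left_inv _ := rfl
  right_inv _ := rfl

lemma Nm_eq (n : GaussianInt) : Nm n = (n.re : ℝ) ^ 2 + (n.im : ℝ) ^ 2 := by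
  unfold Nm; rw [norm_def']; push_cast; rfl

lemma hasSum_eK (z : ℂ) {x : ℝ} (hx : 0 < x) :
    HasSum (fun k : GaussianInt => ((rexp (-π * ‖GaussianInt.toComplex k + z‖ ^ 2 * x) : ℝ) : ℂ)) (eK z x) := by
  have h1 := HurwitzZeta.hasSum_int_evenKernel z.re hx
  have h2 := HurwitzZeta.hasSum_int_evenKernel z.im hx
  have h3 := h1.mul h2 (h1.summable.mul_of_nonneg h2.summable (fun _ => (Real.exp_pos _).le) (fun _ => (Real.exp_pos _).le))
  rw [← giEquiv.hasSum_iff]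
  unfold eK
  rw [← Complex.ofReal_mul]
  refine (Complex.hasSum_ofReal.2 h3).congr_fun ?_
  rintro ⟨a, b⟩
  simp only [Function.comp, giEquiv, Equiv.coe_fn_mk]
  rw [← Real.exp_add]
  congr 2
  rw [← Complex.normSq_eq_norm_sq, Complex.normSq_apply]
  simp [GaussianInt.toComplex_def]
  ring

lemma cK_term (z : ℂ) (x : ℝ) (a b : ℤ) :
    eT (GaussianInt.toComplex ⟨b, a⟩ * z) * ((rexp (-π * Nm ⟨b, a⟩ * x) : ℝ) : ℂ) =
      cexp (2 * π * I * z.re * a) * rexp (-π * a ^ 2 * x) *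
        (cexp (2 * π * I * z.im * b) * rexp (-π * b ^ 2 * x)) := by
  have e1 : eT (GaussianInt.toComplex ⟨b, a⟩ * z) =
      cexp (2 * π * I * z.re * a) * cexp (2 * π * I * z.im * b) := by
    rw [eT_eq, ← Complex.exp_add]
    congr 1
    simp only [GaussianInt.toComplex_def, Complex.mul_im, Complex.add_re, Complex.add_im,
        Complex.intCast_re, Complex.intCast_im, Complex.mul_re, Complex.I_re, Complex.I_im]
    push_cast
    ring
  have e2 : rexp (-π * Nm ⟨b, a⟩ * x) = rexp (-π * a ^ 2 * x) * rexp (-π * b ^ 2 * x) := by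
    rw [← Real.exp_add, Nm_eq]
    congr 1
    ring
  rw [e1, e2, Complex.ofReal_mul]
  ring

lemma hasSum_prod_abs {f g : ℤ → ℂ} {a b : ℂ} (hf : HasSum f a) (hg : HasSum g b) :
    HasSum (fun p : ℤ × ℤ => f p.1 * g p.2) (a * b) := by
  have h1 : Summable (fun n => ‖f n‖) := hf.summable.norm
  have h2 : Summable (fun n => ‖g n‖) := hg.summable.norm
  exact HasSum.mul hf hg (summable_mul_of_summable_norm h1 h2)

lemma hasSum_cK (z : ℂ) {x : ℝ} (hx : 0 < x) :
    HasSum (fun k : GaussianInt => eT (GaussianInt.toComplex k * z) * ((rexp (-π * Nm k * x) : ℝ) : ℂ))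
      (cK z x) := by
  have h1 := HurwitzZeta.hasSum_int_cosKernel z.re hx
  have h2 := HurwitzZeta.hasSum_int_cosKernel z.im hx
  have h3 := hasSum_prod_abs h1 h2
  rw [← giEquiv'.hasSum_iff]
  have key : ((fun k : GaussianInt => eT (GaussianInt.toComplex k * z) *
      ((rexp (-π * Nm k * x) : ℝ) : ℂ)) ∘ giEquiv') = fun p : ℤ × ℤ => 
      cexp (2 * π * I * z.re * p.1) * rexp (-π * p.1 ^ 2 * x) *
        (cexp (2 * π * I * z.im * p.2) * rexp (-π * p.2 ^ 2 * x)) := 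
    funext fun p => cK_term z x p.1 p.2
  rw [key]
  exact h3

lemma norm_Gamma_le_re {s : ℂ} (hs : 0 < s.re) : ‖Complex.Gamma s‖ ≤ Real.Gamma s.re := by
  rw [Complex.Gamma_eq_integral hs, Real.Gamma_eq_integral hs, Complex.GammaIntegral]
  refine (MeasureTheory.norm_integral_le_integral_norm _).trans (le_of_eq ?_)
  refine MeasureTheory.setIntegral_congr_fun measurableSet_Ioi fun x hx => ?_
  have hx' : 0 < x := hx
  simp only [norm_mul]
  rw [Complex.norm_cpow_eq_rpow_re_of_pos hx', Complex.norm_real, Real.norm_eq_abs, abs_of_pos (Real.exp_pos _)]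
  simp

lemma norm_sin_le_exp (z : ℂ) : ‖Complex.sin z‖ ≤ rexp |z.im| := by
  rw [Complex.sin]
  have h1 : ‖cexp (-z * I)‖ ≤ rexp |z.im| := by
    rw [Complex.norm_exp]; apply Real.exp_le_exp.2; simp [le_abs_self]
  have h2 : ‖cexp (z * I)‖ ≤ rexp |z.im| := by
    rw [Complex.norm_exp]; apply Real.exp_le_exp.2; simp [neg_le_abs]
  have h3 := norm_sub_le (cexp (-z * I)) (cexp (z * I))
  rw [norm_div, norm_mul, Complex.norm_I, Complex.norm_ofNat]
  linarith

/-- a priori bound for the reciprocal Gamma function -/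
lemma rGamma_apriori : ∃ A : ℝ, 0 ≤ A ∧ ∀ s : ℂ, s.re ∈ Set.Icc (-1/2 : ℝ) (3/2) →
    ‖(Complex.Gamma s)⁻¹‖ ≤ A * rexp (π * |s.im|) := by
  have hK : IsCompact (Set.Icc (-1/2 : ℝ) (3/2) ×ℂ Set.Icc (-1 : ℝ) 1) :=
    isCompact_Icc.reProdIm isCompact_Icc
  obtain ⟨A1, hA1⟩ := hK.exists_bound_of_continuousOn
    (Complex.differentiable_one_div_Gamma.continuous.continuousOn)
  have hK2 : IsCompact (Set.Icc (1/2 : ℝ) (5/2)) := isCompact_Icc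
  have hc : ContinuousOn Real.Gamma (Set.Icc (1/2 : ℝ) (5/2)) := fun x hx =>
    (Real.differentiableAt_Gamma fun m => by
      have := hx.1; have : (0:ℝ) ≤ m := Nat.cast_nonneg m; linarith [hx.1]).continuousAt.continuousWithinAt
  obtain ⟨A2, hA2⟩ := hK2.exists_bound_of_continuousOn hc
  refine ⟨max A1 (max A2 0), le_max_of_le_right (le_max_right _ _), fun s hs => ?_⟩
  have hA0 : 0 ≤ max A1 (max A2 0) := le_max_of_le_right (le_max_right _ _)
  by_cases h1 : |s.im| ≤ 1
  · have := hA1 s (by rw [Complex.mem_reProdIm]; exact ⟨hs, abs_le.1 h1⟩)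
    refine this.trans ((le_max_left A1 (max A2 0)).trans ?_)
    exact le_mul_of_one_le_right hA0 (Real.one_le_exp (by positivity))
  · push Not at h1
    have hne : s.im ≠ 0 := by intro h; rw [h, abs_zero] at h1; linarith
    have hsin : Complex.sin (π * s) ≠ 0 := by
      intro h
      rw [Complex.sin_eq_zero_iff] at h
      obtain ⟨k, hk⟩ := h
      have := congrArg Complex.im hk
      simp at this
      exact hne this
    have hG := Complex.Gamma_mul_Gamma_one_sub s
    have h2 : (Complex.Gamma s)⁻¹ = Complex.Gamma (1 - s) * Complex.sin (π * s) / π := by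
      have hpi : (π : ℂ) ≠ 0 := by exact_mod_cast pi_ne_zero
      have hGs : Complex.Gamma s ≠ 0 := by
        intro h; rw [h, zero_mul] at hG
        exact div_ne_zero hpi hsin hG.symm
      refine inv_eq_of_mul_eq_one_left ?_
      rw [show Complex.Gamma (1 - s) * Complex.sin (π * s) / π * Complex.Gamma s =
        (Complex.Gamma s * Complex.Gamma (1 - s)) * Complex.sin (π * s) / π by ring, hG]
      field_simp
    have hne1 : 1 - s ≠ 0 := by
      intro h; have := congrArg Complex.im h; simp at this; exact hne this
    have h3 := Complex.Gamma_add_one (1 - s) hne1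
    have h4 : ‖Complex.Gamma (1 - s + 1)‖ ≤ A2 := by
      have hre : (1 - s + 1).re = 2 - s.re := by simp; ring
      refine (norm_Gamma_le_re (by rw [hre]; linarith [hs.2])).trans ?_
      refine (le_abs_self _).trans ?_
      rw [hre]
      exact hA2 _ ⟨by linarith [hs.2], by linarith [hs.1]⟩
    have h5 : 1 ≤ ‖1 - s‖ := by
      refine h1.le.trans ?_
      have := Complex.abs_im_le_norm (1 - s)
      simpa using this
    have h6 : ‖Complex.Gamma (1 - s)‖ ≤ A2 := by
      rw [h3, norm_mul] at h4
      exact (le_mul_of_one_le_left (norm_nonneg _) h5).trans h4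
    rw [h2, norm_div, norm_mul, Complex.norm_real, Real.norm_eq_abs, abs_of_pos pi_pos]
    have h7 := norm_sin_le_exp (π * s)
    have h8 : ((π : ℂ) * s).im = π * s.im := by simp
    rw [h8, abs_mul, abs_of_pos pi_pos] at h7
    have h9 : ‖Complex.Gamma (1 - s)‖ * ‖Complex.sin (π * s)‖ ≤ max A1 (max A2 0) * rexp (π * |s.im|) :=
      mul_le_mul (h6.trans (le_max_of_le_right (le_max_left _ _))) h7 (norm_nonneg _) hA0
    refine (div_le_self (by positivity) ?_).trans h9
    linarith [pi_gt_three]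

lemma norm_gauss_factor (z : ℂ) (t0 : ℝ) :
    ‖cexp ((z - I * t0) ^ 2)‖ = rexp (z.re ^ 2 - (z.im - t0) ^ 2) := by
  rw [Complex.norm_exp]; congr 1
  simp [pow_two]

/-- three lines theorem with polynomial growth in the vertical direction -/
lemma three_lines_poly {f : ℂ → ℂ} {a b A B M0 M1 k0 k1 : ℝ} (hab : a < b) (ha : -2 ≤ a) (hb : b ≤ 2)
    (hd : ∀ z : ℂ, z.re ∈ Set.Icc a b → DifferentiableAt ℂ f z)
    (hk0 : 0 ≤ k0) (hk0' : k0 ≤ 2) (hk1 : 0 ≤ k1) (hk1' : k1 ≤ 2) (hM0 : 0 ≤ M0) (hM1 : 0 ≤ M1)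
    (hA : 0 ≤ A) (hB : 0 ≤ B)
    (hap : ∀ z : ℂ, z.re ∈ Set.Icc a b → ‖f z‖ ≤ A * rexp (B * |z.im|))
    (h0 : ∀ z : ℂ, z.re = a → ‖f z‖ ≤ M0 * (1 + |z.im|) ^ k0)
    (h1 : ∀ z : ℂ, z.re = b → ‖f z‖ ≤ M1 * (1 + |z.im|) ^ k1) {z : ℂ} (hz : z.re ∈ Set.Icc a b) :
    ‖f z‖ ≤ (2 * rexp 4 * M0 * (1 + |z.im|) ^ k0) ^ (1 - (z.re - a) / (b - a)) *
      (2 * rexp 4 * M1 * (1 + |z.im|) ^ k1) ^ ((z.re - a) / (b - a)) := by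
  set t0 := z.im with ht0
  have hsq : ∀ x ∈ Set.Icc a b, x ^ 2 ≤ 4 := fun x hx => by nlinarith [hx.1, hx.2]
  have hu : ∀ u : ℝ, ∀ k : ℝ, 0 ≤ k → k ≤ 2 → (1 + |u|) ^ k ≤ 2 * rexp (u ^ 2) := by
    intro u k hk hk'
    have hh : (1:ℝ) ≤ 1 + |u| := by linarith [abs_nonneg u]
    calc (1 + |u|) ^ k ≤ (1 + |u|) ^ (2:ℝ) := Real.rpow_le_rpow_of_exponent_le hh hk'
      _ = (1 + |u|) ^ 2 := by norm_num
      _ ≤ 2 * (u ^ 2 + 1) := by nlinarith [sq_abs u, sq_nonneg (1 - |u|)]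
      _ ≤ 2 * rexp (u ^ 2) := by gcongr; exact Real.add_one_le_exp _
  have hsub : ∀ t : ℝ, 1 + |t| ≤ (1 + |t0|) * (1 + |t - t0|) := by
    intro t
    have h := abs_add_le t0 (t - t0)
    rw [add_sub_cancel] at h
    nlinarith [mul_nonneg (abs_nonneg t0) (abs_nonneg (t - t0))]
  have hline : ∀ (c M k : ℝ), c ∈ Set.Icc a b → 0 ≤ k → k ≤ 2 → 0 ≤ M →
      (∀ z : ℂ, z.re = c → ‖f z‖ ≤ M * (1 + |z.im|) ^ k) →
      ∀ z : ℂ, z.re = c → ‖f z * cexp ((z - I * t0) ^ 2)‖ ≤ 2 * rexp 4 * M * (1 + |t0|) ^ k := by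
    intro c M k hc hk hk' hM h y hy
    rw [norm_mul, norm_gauss_factor, hy]
    have e1 : (1 + |y.im|) ^ k ≤ (1 + |t0|) ^ k * (2 * rexp ((y.im - t0) ^ 2)) := by
      refine (Real.rpow_le_rpow (by positivity) (hsub y.im) hk).trans ?_
      rw [Real.mul_rpow (by positivity) (by positivity)]
      gcongr
      exact hu _ _ hk hk'
    calc ‖f y‖ * rexp (c ^ 2 - (y.im - t0) ^ 2)
        ≤ (M * ((1 + |t0|) ^ k * (2 * rexp ((y.im - t0) ^ 2)))) * rexp (4 - (y.im - t0) ^ 2) := by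
          gcongr
          · exact (h y hy).trans (by gcongr)
          · exact hsq c hc
      _ = 2 * M * (1 + |t0|) ^ k * (rexp ((y.im - t0) ^ 2) * rexp (4 - (y.im - t0) ^ 2)) := by ring
      _ = 2 * rexp 4 * M * (1 + |t0|) ^ k := by
          rw [← Real.exp_add]; rw [show (y.im - t0) ^ 2 + (4 - (y.im - t0) ^ 2) = 4 by ring]; ring
  have key := Complex.HadamardThreeLines.norm_le_interp_of_mem_verticalClosedStrip'
    (f := fun z => f z * cexp ((z - I * t0) ^ 2)) (z := z) (l := a) (u := b) hab hz ?_ ?_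
    (hline a M0 k0 ⟨le_rfl, hab.le⟩ hk0 hk0' hM0 h0) (hline b M1 k1 ⟨hab.le, le_rfl⟩ hk1 hk1' hM1 h1)
  · refine le_trans ?_ key
    rw [norm_mul, norm_gauss_factor, ← ht0, sub_self]
    refine le_mul_of_one_le_right (norm_nonneg _) (Real.one_le_exp ?_)
    nlinarith [sq_nonneg z.re]
  · apply DifferentiableOn.diffContOnCl
    intro y hy
    have hy' : y.re ∈ Set.Icc a b := by
      have : closure (Complex.HadamardThreeLines.verticalStrip a b) ⊆ re ⁻¹' Set.Icc a b := by
        apply closure_minimal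
        · intro x hx; exact Set.Ioo_subset_Icc_self hx
        · exact isClosed_Icc.preimage Complex.continuous_re
      exact this hy
    exact ((hd y hy').mul (by fun_prop)).differentiableWithinAt
  · refine ⟨A * rexp (B * |t0| + B ^ 2 + 4), ?_⟩
    rintro _ ⟨y, hy, rfl⟩
    have hy' : y.re ∈ Set.Icc a b := hy
    simp only [Function.comp, norm_mul, norm_gauss_factor]
    calc ‖f y‖ * rexp (y.re ^ 2 - (y.im - t0) ^ 2)
        ≤ (A * rexp (B * |y.im|)) * rexp (4 - (y.im - t0) ^ 2) := by
          gcongr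
          · exact hap y hy'
          · exact hsq _ hy'
      _ = A * rexp (B * |y.im| + (4 - (y.im - t0) ^ 2)) := by rw [mul_assoc, ← Real.exp_add]
      _ ≤ _ := by
          refine mul_le_mul_of_nonneg_left (Real.exp_le_exp.2 ?_) hA
          have h := abs_add_le t0 (y.im - t0)
          rw [add_sub_cancel] at h
          nlinarith [sq_abs (y.im - t0), sq_nonneg (B - |y.im - t0|), mul_le_mul_of_nonneg_left h hB, sq_nonneg (y.im - t0)]

/-- Gamma quotient bound -/
lemma gamma_quot : ∃ K : ℝ, 0 ≤ K ∧ ∀ s : ℂ, s.re ∈ Set.Icc (-1/2 : ℝ) 0 →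
    ‖Complex.Gamma (1 - s) * (Complex.Gamma s)⁻¹‖ ≤ K * (1 + |s.im|) ^ (1 - 2 * s.re) := by
  obtain ⟨A1, hA1, hA⟩ := rGamma_apriori
  have hK2 : IsCompact (Set.Icc (1/2 : ℝ) (5/2)) := isCompact_Icc
  have hc : ContinuousOn Real.Gamma (Set.Icc (1/2 : ℝ) (5/2)) := fun x hx =>
    (Real.differentiableAt_Gamma fun m => by
      have := hx.1; have : (0:ℝ) ≤ m := Nat.cast_nonneg m; linarith [hx.1]).continuousAt.continuousWithinAt
  obtain ⟨A2, hA2⟩ := hK2.exists_bound_of_continuousOn hc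
  have hG2 : ∀ z : ℂ, z.re ∈ Set.Icc (-1/2 : ℝ) 0 → ‖Complex.Gamma (1 - z)‖ ≤ A2 := by
    intro z hz
    have hre : (1 - z).re = 1 - z.re := by simp
    refine (norm_Gamma_le_re (by rw [hre]; linarith [hz.2])).trans ?_
    refine (le_abs_self _).trans ?_
    rw [hre]
    exact hA2 _ ⟨by linarith [hz.2], by linarith [hz.1]⟩
  have hA20 : 0 ≤ A2 := (norm_nonneg _).trans (hG2 0 (by norm_num))
  have hconj : ∀ x y : ℂ, y = (starRingEnd ℂ) x → ‖Complex.Gamma y‖ = ‖Complex.Gamma x‖ := by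
    intro x y h; rw [h, Complex.Gamma_conj, RCLike.norm_conj]
  refine ⟨(2 * rexp 4 * 1) + 1, by positivity, fun s hs => ?_⟩
  have := three_lines_poly (f := fun s => Complex.Gamma (1 - s) * (Complex.Gamma s)⁻¹) (a := -1/2) (b := 0)
    (A := A2 * A1) (B := π) (M0 := 1) (M1 := 1) (k0 := 2) (k1 := 1) (by norm_num) (by norm_num)
    (by norm_num) ?_ (by norm_num) (by norm_num) (by norm_num) (by norm_num) (by norm_num) (by norm_num)
    (by positivity) pi_pos.le ?_ ?_ ?_ hs
  · refine this.trans ?_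
    have e : (s.re - -1/2) / (0 - -1/2) = 1 + 2 * s.re := by ring
    rw [e]
    have hp : 0 < 1 + |s.im| := by positivity
    rw [Real.mul_rpow (by positivity) (by positivity), Real.mul_rpow (x := 2 * rexp 4 * 1) (y := (1 + |s.im|) ^ (1:ℝ)) (by positivity) (by positivity),
      ← Real.rpow_mul hp.le, ← Real.rpow_mul hp.le]
    rw [show ∀ x y z w : ℝ, x * y * (z * w) = (x * z) * (y * w) by intros; ring, ← Real.rpow_add (by positivity),
      ← Real.rpow_add hp]
    rw [show 1 - (1 + 2 * s.re) + (1 + 2 * s.re) = 1 by ring, Real.rpow_one]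
    rw [show 2 * (1 - (1 + 2 * s.re)) + 1 * (1 + 2 * s.re) = 1 - 2 * s.re by ring]
    gcongr
    linarith
  · intro z hz
    refine DifferentiableAt.mul ?_ (Complex.differentiable_one_div_Gamma z)
    refine DifferentiableAt.comp z (Complex.differentiableAt_Gamma _ fun m h => ?_) (by fun_prop)
    have := congrArg Complex.re h
    simp at this
    have h2 : (0:ℝ) ≤ m := Nat.cast_nonneg m
    linarith [hz.2]
  · intro z hz
    rw [norm_mul, mul_assoc]
    exact mul_le_mul (hG2 z hz) (hA z ⟨hz.1, by linarith [hz.2]⟩) (norm_nonneg _) hA20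
  · intro z hz
    have hz1 : z ≠ 0 := by intro h; rw [h] at hz; norm_num at hz
    have hz2 : z + 1 ≠ 0 := by
      intro h; have := congrArg Complex.re h; simp [hz] at this; norm_num at this
    have e1 := Complex.Gamma_add_one z hz1
    have e2 := Complex.Gamma_add_one (z + 1) hz2
    rw [e1] at e2
    have e3 : ‖Complex.Gamma (1 - z)‖ = ‖Complex.Gamma (z + 1 + 1)‖ := by
      apply hconj
      apply Complex.ext <;> simp [hz]
      norm_num
    have hG : Complex.Gamma z ≠ 0 := by
      apply Complex.Gamma_ne_zero
      intro m h
      have := congrArg Complex.re h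
      simp [hz] at this
      have h3 : (m : ℝ) * 2 = 1 := by linarith
      have h4 : m * 2 = 1 := by exact_mod_cast h3
      omega
    rw [norm_mul, e3, e2, norm_mul, norm_mul, norm_inv]
    rw [show ‖z + 1‖ * (‖z‖ * ‖Complex.Gamma z‖) * ‖Complex.Gamma z‖⁻¹ = ‖z + 1‖ * ‖z‖ by
      field_simp [norm_ne_zero_iff.2 hG]]
    have h5 : ‖z‖ ≤ 1 + |z.im| := by
      refine (Complex.norm_le_abs_re_add_abs_im z).trans ?_
      rw [hz]; norm_num [abs_of_neg]
    have h6 : ‖z + 1‖ ≤ 1 + |z.im| := by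
      refine (Complex.norm_le_abs_re_add_abs_im _).trans ?_
      simp [hz]; norm_num [abs_of_pos]
    calc ‖z + 1‖ * ‖z‖ ≤ (1 + |z.im|) * (1 + |z.im|) := by gcongr
      _ = 1 * (1 + |z.im|) ^ (2:ℝ) := by rw [Real.rpow_two]; ring
  · intro z hz
    by_cases hz1 : z = 0
    · subst hz1; simp
    have e1 := Complex.Gamma_add_one z hz1
    have e3 : ‖Complex.Gamma (1 - z)‖ = ‖Complex.Gamma (z + 1)‖ := by
      apply hconj
      apply Complex.ext <;> simp [hz]
    have hG : Complex.Gamma z ≠ 0 := by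
      apply Complex.Gamma_ne_zero
      intro m h
      have h2 := congrArg Complex.im h
      simp at h2
      exact hz1 (Complex.ext hz h2)
    rw [norm_mul, e3, e1, norm_mul, norm_inv, mul_assoc, mul_inv_cancel₀ (norm_ne_zero_iff.2 hG),
      mul_one, Real.rpow_one, one_mul]
    refine (Complex.norm_le_abs_re_add_abs_im z).trans ?_
    rw [hz]; simp

lemma summable_Nm {σ : ℝ} (hσ : 1 < σ) : Summable fun n : GaussianInt => (Nm n) ^ (-σ) := by
  have h := EisensteinSeries.summable_one_div_norm_rpow (k := 2 * σ) (by linarith)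
  have e : Function.Injective (fun n : GaussianInt => (![n.re, n.im] : Fin 2 → ℤ)) := by
    intro a b h
    have h0 := congrFun h 0
    have h1 := congrFun h 1
    simp at h0 h1
    exact Zsqrtd.ext h0 h1
  refine Summable.of_nonneg_of_le (fun n => Real.rpow_nonneg (Nm_nonneg n) _) (fun n => ?_) (h.comp_injective e)
  by_cases hn : n = 0
  · subst hn
    rw [show Nm 0 = 0 by simp [Nm], Real.zero_rpow (by linarith)]
    exact Real.rpow_nonneg (norm_nonneg _) _
  · simp only [Function.comp]
    set v : Fin 2 → ℤ := ![n.re, n.im]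
    have hv : ‖v‖ ^ 2 ≤ Nm n := by
      rw [Nm_eq]
      have h1 : ‖v‖ ≤ Real.sqrt ((n.re : ℝ) ^ 2 + (n.im : ℝ) ^ 2) := by
        rw [pi_norm_le_iff_of_nonneg (Real.sqrt_nonneg _)]
        intro i
        fin_cases i
        · simp only [v, Fin.zero_eta, Matrix.cons_val_zero, Int.norm_eq_abs]
          exact Real.abs_le_sqrt (by nlinarith [sq_nonneg (n.im : ℝ)])
        · simp only [v, Fin.mk_one, Matrix.cons_val_one, Int.norm_eq_abs]
          exact Real.abs_le_sqrt (by change (n.im : ℝ) ^ 2 ≤ _; nlinarith [sq_nonneg (n.re : ℝ)])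
      calc ‖v‖ ^ 2 ≤ (Real.sqrt ((n.re : ℝ) ^ 2 + (n.im : ℝ) ^ 2)) ^ 2 := by gcongr
        _ = _ := Real.sq_sqrt (by positivity)
    have hv0 : 0 < ‖v‖ := by
      rw [norm_pos_iff]
      intro h0
      apply hn
      have h0' := congrFun h0 0
      have h1' := congrFun h0 1
      simp [v] at h0' h1'
      exact Zsqrtd.ext h0' h1'
    rw [show -(2 * σ) = ((2:ℕ):ℝ) * (-σ) by push_cast; ring, Real.rpow_mul hv0.le, Real.rpow_natCast]
    exact Real.rpow_le_rpow_of_nonpos (by positivity) hv (by linarith)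

lemma hasSum_congrC {ι : Type*} {f g : ι → ℂ} {a : ℂ} (h : ∀ i, f i = g i) : HasSum f a ↔ HasSum g a := by
  rw [funext h]

instance instCountableGI : Countable GaussianInt := giEquiv.symm.injective.countable

/-- the lattice sum `∑ N(n)^{-σ}` -/
def Zsum (σ : ℝ) : ℝ := ∑' n : GaussianInt, (Nm n) ^ (-σ)

lemma Zsum_nonneg (σ : ℝ) : 0 ≤ Zsum σ := tsum_nonneg fun n => Real.rpow_nonneg (Nm_nonneg n) _

lemma Lam0_bdd (P : WeakFEPair ℂ) (a b : ℝ) : ∃ A : ℝ, 0 ≤ A ∧ ∀ s : ℂ, s.re ∈ Set.Icc a b →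
    ‖P.Λ₀ s‖ ≤ A := by
  have hm := fun s : ℂ => (P.isStrongFEPair_toStrongFEPair.hasMellin s).1
  have ha := (hm (a : ℂ)).norm
  have hb := (hm (b : ℂ)).norm
  refine ⟨∫ t in Set.Ioi (0:ℝ), (‖(t : ℂ) ^ ((a : ℂ) - 1) • P.toStrongFEPair.f t‖ +
    ‖(t : ℂ) ^ ((b : ℂ) - 1) • P.toStrongFEPair.f t‖), MeasureTheory.integral_nonneg fun t => by positivity, ?_⟩
  intro s hs
  refine (MeasureTheory.norm_integral_le_integral_norm _).trans ?_
  refine MeasureTheory.setIntegral_mono_on (hm s).norm (ha.add hb) measurableSet_Ioi ?_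
  intro t ht
  have ht' : 0 < t := ht
  change ‖(t : ℂ) ^ (s - 1) • P.toStrongFEPair.f t‖ ≤ _
  rw [norm_smul, norm_smul, norm_smul, ← add_mul]
  refine mul_le_mul_of_nonneg_right ?_ (norm_nonneg _)
  simp only [Complex.norm_cpow_eq_rpow_re_of_pos ht']
  simp only [Complex.sub_re, Complex.ofReal_re, Complex.one_re]
  by_cases h1 : 1 ≤ t
  · have := Real.rpow_le_rpow_of_exponent_le h1 (show s.re - 1 ≤ b - 1 by linarith [hs.2])
    have h2 := Real.rpow_nonneg ht'.le (a - 1)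
    linarith
  · push Not at h1
    have := Real.rpow_le_rpow_of_exponent_ge ht' h1.le (show a - 1 ≤ s.re - 1 by linarith [hs.1])
    have h2 := Real.rpow_nonneg ht'.le (b - 1)
    linarith

section pair
variable (c : GaussianInt) (hc : c ≠ 0) (F : GaussianInt → ℂ) (h0 : ∀ x, c ∣ x → F x = 0)
  (S : Finset GaussianInt)

lemma theta_f_hasSum (hS : IsRes c S) (hper : ∀ a b, c ∣ a - b → F a = F b) {x : ℝ} (hx : 0 < x) :
    HasSum (fun n : GaussianInt => F n * ((rexp (-π * (Nm n / Nm c) * x) : ℝ) : ℂ))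
      ((thPair c hc F h0 S).f x) := by
  change HasSum _ (∑ r ∈ S, F r * eK (qt r c) x)
  have hr : ∀ r ∈ S, HasSum (fun n : GaussianInt => if c ∣ n - r then
      F n * ((rexp (-π * (Nm n / Nm c) * x) : ℝ) : ℂ) else 0) (F r * eK (qt r c) x) := by
    intro r _
    have h1 := (hasSum_eK (qt r c) hx).mul_left (F r)
    have hinj : Function.Injective (fun k : GaussianInt => r + c * k) := by
      intro a b h
      exact mul_left_cancel₀ hc (add_left_cancel h)
    rw [← hinj.hasSum_iff]
    · refine (hasSum_congrC fun k => ?_).mpr h1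
      have hd : c ∣ r + c * k - r := ⟨k, by ring⟩
      simp only [Function.comp]
      rw [if_pos hd, hper _ _ hd]
      congr 5
      rw [Nm_eq_norm_sq, Nm_eq_norm_sq, ← div_pow, ← norm_div, qt]
      congr 2
      have := toComplex_ne_zero hc
      rw [map_add, map_mul]
      field_simp
      ring
    · intro n hn
      rw [if_neg]
      rintro ⟨k, hk⟩
      exact hn ⟨k, by simp only; rw [← hk]; ring⟩
  have h2 := hasSum_sum hr
  refine (hasSum_congrC fun n => ?_).mpr h2
  obtain ⟨r, ⟨hr1, hr2⟩, hu⟩ := hS n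
  rw [Finset.sum_eq_single_of_mem r hr1, if_pos hr2]
  intro b hb hbr
  rw [if_neg]
  intro h
  exact hbr (hu b ⟨hb, h⟩)

lemma theta_g_hasSum {x : ℝ} (hx : 0 < x) :
    HasSum (fun n : GaussianInt => fhat F S c n * ((rexp (-π * Nm n * x) : ℝ) : ℂ))
      ((thPair c hc F h0 S).g x) := by
  change HasSum _ (∑ r ∈ S, F r * cK (qt r c) x)
  have h2 := hasSum_sum (fun r (_ : r ∈ S) => (hasSum_cK (qt r c) hx).mul_left (F r))
  refine (hasSum_congrC fun n => ?_).mpr h2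
  rw [fhat, Finset.sum_mul]
  refine Finset.sum_congr rfl fun r _ => ?_
  rw [ee, qt, map_mul, mul_div_assoc]
  ring

lemma Lam_hasSum (hS : IsRes c S) (hper : ∀ a b, c ∣ a - b → F a = F b) (hF : ∀ n, ‖F n‖ ≤ 1)
    {s : ℂ} (hs : 1 < s.re) :
    HasSum (fun n : GaussianInt => (π : ℂ) ^ (-s) * Complex.Gamma s * F n / ((Nm n / Nm c : ℝ) : ℂ) ^ s)
      ((thPair c hc F h0 S).Λ s) := by
  have h1 := ((thPair c hc F h0 S).hasMellin (s := s) hs).2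
  rw [← h1]
  have hc0 := Nm_pos hc
  refine hasSum_mellin_pi_mul₀ (fun n => div_nonneg (Nm_nonneg n) (Nm_nonneg c)) (by linarith) ?_ ?_
  · intro t ht
    have h2 := theta_f_hasSum c hc F h0 S hS hper ht
    have h3 : (thPair c hc F h0 S).f t - (thPair c hc F h0 S).f₀ = (thPair c hc F h0 S).f t := sub_zero _
    rw [h3]
    refine (hasSum_congrC fun n => ?_).mpr h2
    by_cases hn : n = 0
    · subst hn
      rw [h0 0 (dvd_zero _)]; simp
    · rw [if_neg (div_pos (Nm_pos hn) hc0).ne']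
  · have h2 := (summable_Nm hs).mul_left (Nm c ^ s.re)
    refine Summable.of_nonneg_of_le (fun n => by have := Nm_nonneg n; positivity) (fun n => ?_) h2
    rw [Real.div_rpow (Nm_nonneg n) hc0.le, Real.rpow_neg (Nm_nonneg n)]
    have h3 : ‖F n‖ / (Nm n ^ s.re / Nm c ^ s.re) = ‖F n‖ * (Nm c ^ s.re * (Nm n ^ s.re)⁻¹) := by
      rw [div_div_eq_mul_div]; ring
    rw [h3]
    have := Nm_nonneg n
    exact mul_le_of_le_one_left (by positivity) (hF n)

lemma Lam_dual_bound {B : ℝ} (hB : ∀ k, ‖fhat F S c k‖ ≤ B) {s : ℂ} (hs : 1 < s.re) :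
    ‖(thPair c hc F h0 S).symm.Λ s‖ ≤ ‖Complex.Gamma s‖ * (B * Zsum s.re) := by
  have hB0 : 0 ≤ B := (norm_nonneg _).trans (hB 0)
  have h1 := ((thPair c hc F h0 S).symm.hasMellin (s := s) hs).2
  have hsum : Summable fun n : GaussianInt => ‖fhat F S c n‖ / Nm n ^ s.re := by
    refine Summable.of_nonneg_of_le (fun n => by have := Nm_nonneg n; positivity) (fun n => ?_)
      ((summable_Nm hs).mul_left B)
    rw [Real.rpow_neg (Nm_nonneg n), div_eq_mul_inv]
    have := Nm_nonneg n
    gcongr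
    exact hB n
  have h2 : HasSum (fun n : GaussianInt => (π : ℂ) ^ (-s) * Complex.Gamma s * fhat F S c n / ((Nm n : ℝ) : ℂ) ^ s)
      ((thPair c hc F h0 S).symm.Λ s) := by
    rw [← h1]
    refine hasSum_mellin_pi_mul₀ (fun n => Nm_nonneg n) (by linarith) ?_ hsum
    intro t ht
    have h2 := theta_g_hasSum c hc F h0 S (x := t) ht
    have h3 := h2.sub (hasSum_ite_eq (0 : GaussianInt) (∑ r ∈ S, F r))
    refine (hasSum_congrC fun n => ?_).mpr h3
    by_cases hn : n = 0
    · subst hn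
      rw [show Nm 0 = 0 by simp [Nm], if_pos rfl, if_pos rfl, fhat]
      simp [ee_zero]
    · rw [if_neg (Nm_pos hn).ne', if_neg hn, sub_zero]
  rw [← h2.tsum_eq]
  have h4 : ∀ n, ‖(π : ℂ) ^ (-s) * Complex.Gamma s * fhat F S c n / ((Nm n : ℝ) : ℂ) ^ s‖ ≤
      ‖Complex.Gamma s‖ * (B * Nm n ^ (-s.re)) := by
    intro n
    have hN := Nm_nonneg n
    have hp : ‖(π : ℂ) ^ (-s)‖ ≤ 1 := by
      rw [Complex.norm_cpow_eq_rpow_re_of_pos pi_pos]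
      refine Real.rpow_le_one_of_one_le_of_nonpos (by linarith [pi_gt_three]) ?_
      simp; linarith
    rw [norm_div, norm_mul, norm_mul]
    rw [Complex.norm_cpow_eq_rpow_re_of_nonneg hN (by linarith), Real.rpow_neg hN, div_eq_mul_inv, mul_assoc]
    refine mul_le_mul (mul_le_of_le_one_left (norm_nonneg _) hp) ?_ (by positivity) (norm_nonneg _)
    gcongr
    exact hB n
  have h5 : Summable fun n => ‖Complex.Gamma s‖ * (B * Nm n ^ (-s.re)) :=
    ((summable_Nm hs).mul_left B).mul_left _
  refine (tsum_of_norm_bounded h5.hasSum h4).trans ?_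
  rw [tsum_mul_left, tsum_mul_left, Zsum]

/-- the `L`-function attached to the periodic function `F` -/
def Lf (s : ℂ) : ℂ :=
  (π : ℂ) ^ s * (Nm c : ℂ) ^ (-s) * (thPair c hc F h0 S).Λ s * (Complex.Gamma s)⁻¹

lemma Lf_hasSum (hS : IsRes c S) (hper : ∀ a b, c ∣ a - b → F a = F b) (hF : ∀ n, ‖F n‖ ≤ 1)
    {s : ℂ} (hs : 1 < s.re) :
    HasSum (fun n : GaussianInt => F n / (Nm n : ℂ) ^ s) (Lf c hc F h0 S s) := by
  have h1 := ((Lam_hasSum c hc F h0 S hS hper hF hs).mul_left ((π : ℂ) ^ s * (Nm c : ℂ) ^ (-s))).mul_right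
    (Complex.Gamma s)⁻¹
  have hc0 := Nm_pos hc
  refine (hasSum_congrC fun n => ?_).mpr h1
  have hG : Complex.Gamma s ≠ 0 := Complex.Gamma_ne_zero_of_re_pos (by linarith)
  have hpi : (π : ℂ) ^ s ≠ 0 := by simp [Complex.cpow_eq_zero_iff, pi_ne_zero]
  have hNc : (Nm c : ℂ) ^ s ≠ 0 := by simp [Complex.cpow_eq_zero_iff, hc0.ne']
  by_cases hn : n = 0
  · subst hn; rw [h0 0 (dvd_zero _)]; simp
  have hNn : (Nm n : ℂ) ^ s ≠ 0 := by simp [Complex.cpow_eq_zero_iff, (Nm_pos hn).ne']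
  have e : ((Nm n / Nm c : ℝ) : ℂ) ^ s = (Nm n : ℂ) ^ s / (Nm c : ℂ) ^ s := by
    rw [div_eq_mul_inv, Complex.ofReal_mul, Complex.mul_cpow_ofReal_nonneg (Nm_nonneg n) (by positivity),
      Complex.ofReal_inv, Complex.inv_cpow, div_eq_mul_inv]
    rw [Complex.arg_ofReal_of_nonneg hc0.le]; exact pi_pos.ne
  rw [e, Complex.cpow_neg, Complex.cpow_neg]
  generalize (Nm n : ℂ) ^ s = u at *
  generalize (Nm c : ℂ) ^ s = v at *
  generalize (π : ℂ) ^ s = w at *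
  generalize Complex.Gamma s = G at *
  field_simp

lemma Lf_right_bound (hS : IsRes c S) (hper : ∀ a b, c ∣ a - b → F a = F b) (hF : ∀ n, ‖F n‖ ≤ 1)
    {s : ℂ} (hs : 1 < s.re) : ‖Lf c hc F h0 S s‖ ≤ Zsum s.re := by
  rw [← (Lf_hasSum c hc F h0 S hS hper hF hs).tsum_eq, Zsum]
  refine tsum_of_norm_bounded (summable_Nm hs).hasSum fun n => ?_
  have hN := Nm_nonneg n
  rw [norm_div, Complex.norm_cpow_eq_rpow_re_of_nonneg hN (by linarith), Real.rpow_neg hN, div_eq_mul_inv]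
  exact mul_le_of_le_one_left (by positivity) (hF n)

lemma Lf_left_bound {B K : ℝ} (hB : ∀ k, ‖fhat F S c k‖ ≤ B)
    (hK : ∀ s : ℂ, s.re ∈ Set.Icc (-1/2 : ℝ) 0 →
      ‖Complex.Gamma (1 - s) * (Complex.Gamma s)⁻¹‖ ≤ K * (1 + |s.im|) ^ (1 - 2 * s.re))
    {s : ℂ} (hs : s.re < 0) (hs' : -1/2 ≤ s.re) :
    ‖Lf c hc F h0 S s‖ ≤ Nm c ^ (-s.re) * (B * Zsum (1 - s.re)) * (K * (1 + |s.im|) ^ (1 - 2 * s.re)) := by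
  have hB0 : 0 ≤ B := (norm_nonneg _).trans (hB 0)
  have hc0 := Nm_pos hc
  have hfe := (thPair c hc F h0 S).functional_equation (1 - s)
  have e1 : ((thPair c hc F h0 S).k : ℂ) - (1 - s) = s := by
    change ((1 : ℝ) : ℂ) - (1 - s) = s
    push_cast; ring
  have e2 : (thPair c hc F h0 S).ε = 1 := rfl
  rw [e1, e2, one_smul] at hfe
  have h1 := Lam_dual_bound c hc F h0 S hB (s := 1 - s) (by simp; linarith)
  have e3 : (1 - s).re = 1 - s.re := by simp
  rw [← hfe, e3] at h1
  rw [Lf, norm_mul, norm_mul, norm_mul]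
  have hp : ‖(π : ℂ) ^ s‖ ≤ 1 := by
    rw [Complex.norm_cpow_eq_rpow_re_of_pos pi_pos]
    exact Real.rpow_le_one_of_one_le_of_nonpos (by linarith [pi_gt_three]) hs.le
  have hn : ‖(Nm c : ℂ) ^ (-s)‖ = Nm c ^ (-s.re) := by
    rw [Complex.norm_cpow_eq_rpow_re_of_pos hc0]; simp
  have hk := hK s ⟨hs', hs.le⟩
  rw [norm_mul] at hk
  have hZ := Zsum_nonneg (1 - s.re)
  calc ‖(π : ℂ) ^ s‖ * ‖(Nm c : ℂ) ^ (-s)‖ * ‖(thPair c hc F h0 S).Λ s‖ * ‖(Complex.Gamma s)⁻¹‖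
      ≤ 1 * Nm c ^ (-s.re) * (‖Complex.Gamma (1 - s)‖ * (B * Zsum (1 - s.re))) * ‖(Complex.Gamma s)⁻¹‖ := by
        rw [hn]; gcongr
    _ = Nm c ^ (-s.re) * (B * Zsum (1 - s.re)) * (‖Complex.Gamma (1 - s)‖ * ‖(Complex.Gamma s)⁻¹‖) := by ring
    _ ≤ _ := by gcongr

/-- entire version: `μ(s) L(s)` -/
lemma Lf_eq (s : ℂ) (hs : s ≠ 1) : Lf c hc F h0 S s = (π : ℂ) ^ s * (Nm c : ℂ) ^ (-s) *
    ((thPair c hc F h0 S).Λ₀ s + (∑ r ∈ S, F r) / (s - 1)) * (Complex.Gamma s)⁻¹ := by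
  rw [Lf, WeakFEPair.Λ]
  have e1 : (thPair c hc F h0 S).f₀ = 0 := rfl
  have e2 : (thPair c hc F h0 S).ε = 1 := rfl
  have e3 : ((thPair c hc F h0 S).k : ℂ) = 1 := by change ((1:ℝ):ℂ) = 1; simp
  have e4 : (thPair c hc F h0 S).g₀ = ∑ r ∈ S, F r := rfl
  rw [e1, e2, e3, e4, smul_zero, sub_zero, smul_eq_mul]
  congr 2
  have h1 : s - 1 ≠ 0 := sub_ne_zero.2 hs
  have h2 : 1 - s ≠ 0 := sub_ne_zero.2 hs.symm
  field_simp
  ring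

lemma Lf_eq0 (hg : ∑ r ∈ S, F r = 0) (s : ℂ) : Lf c hc F h0 S s = (π : ℂ) ^ s * (Nm c : ℂ) ^ (-s) *
    (thPair c hc F h0 S).Λ₀ s * (Complex.Gamma s)⁻¹ := by
  rw [Lf, WeakFEPair.Λ]
  have e1 : (thPair c hc F h0 S).f₀ = 0 := rfl
  have e4 : (thPair c hc F h0 S).g₀ = 0 := hg
  rw [e1, e4, smul_zero, sub_zero, smul_zero, sub_zero]

end pair

lemma convex_core {f : ℂ → ℂ} {δ N M A B : ℝ} (hδ : 0 < δ) (hδ' : δ ≤ 1/2) (hN : 0 < N) (hM : 0 ≤ M)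
    (hA : 0 ≤ A) (hB : 0 ≤ B)
    (hd : ∀ z : ℂ, z.re ∈ Set.Icc (-δ) (1 + δ) → DifferentiableAt ℂ f z)
    (hap : ∀ z : ℂ, z.re ∈ Set.Icc (-δ) (1 + δ) → ‖f z‖ ≤ A * rexp (B * |z.im|))
    (h0 : ∀ z : ℂ, z.re = -δ → ‖f z‖ ≤ (M * N ^ (1/2 + δ)) * (1 + |z.im|) ^ (1 + 2 * δ))
    (h1 : ∀ z : ℂ, z.re = 1 + δ → ‖f z‖ ≤ M) {z : ℂ} (hz : z.re ∈ Set.Icc (-δ) (1 + δ)) :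
    ‖f z‖ ≤ 2 * rexp 4 * M * (N * (1 + |z.im|) ^ 2) ^ ((1 + δ - z.re) / 2) := by
  have key := three_lines_poly (f := f) (a := -δ) (b := 1 + δ) (A := A) (B := B) (M0 := M * N ^ (1/2 + δ))
    (M1 := M) (k0 := 1 + 2 * δ) (k1 := 0) (by linarith) (by linarith) (by linarith) hd (by linarith)
    (by linarith) le_rfl (by norm_num) (by positivity) hM hA hB hap h0
    (fun z hz => by rw [Real.rpow_zero, mul_one]; exact h1 z hz) hz
  refine key.trans (le_of_eq ?_)
  have hp : 0 < 1 + |z.im| := by positivity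
  set x := (z.re - -δ) / (1 + δ - -δ) with hx
  have e1 : 1 - x = (1 + δ - z.re) / (1 + 2 * δ) := by
    have : (1 + δ - -δ) ≠ 0 := by linarith
    have : (1 + 2 * δ) ≠ 0 := by linarith
    rw [hx]; field_simp; ring
  have e2 : 2 * rexp 4 * (M * N ^ (1/2 + δ)) * (1 + |z.im|) ^ (1 + 2 * δ) =
      (2 * rexp 4 * M) * (N * (1 + |z.im|) ^ 2) ^ (1/2 + δ) := by
    rw [Real.mul_rpow hN.le (by positivity), ← Real.rpow_natCast (1 + |z.im|) 2, ← Real.rpow_mul hp.le]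
    rw [show ((2:ℕ):ℝ) * (1/2 + δ) = 1 + 2 * δ by push_cast; ring]
    ring
  rw [e2, Real.rpow_zero, mul_one, Real.mul_rpow (by positivity) (by positivity), ← Real.rpow_mul (by positivity)]
  rw [show (1/2 + δ) * (1 - x) = (1 + δ - z.re) / 2 by
    rw [e1]; have : (1 + 2 * δ) ≠ 0 := by linarith
    field_simp]
  have hx0 : 0 ≤ x := div_nonneg (by linarith [hz.1]) (by linarith)
  have hx1 : 0 ≤ 1 - x := by rw [e1]; exact div_nonneg (by linarith [hz.2]) (by linarith)
  rw [mul_right_comm, ← Real.rpow_add_of_nonneg (by positivity) hx1 hx0]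
  rw [show 1 - x + x = 1 by ring, Real.rpow_one]

lemma apriori_mul (c : GaussianInt) (hc : c ≠ 0) (E : ℂ → ℂ) {A δ : ℝ} (hδ : 0 < δ) (hδ' : δ ≤ 1/2)
    (hA : 0 ≤ A) (hE : ∀ z : ℂ, z.re ∈ Set.Icc (-δ) (1 + δ) → ‖E z‖ ≤ A) :
    ∃ A' : ℝ, 0 ≤ A' ∧ ∀ z : ℂ, z.re ∈ Set.Icc (-δ) (1 + δ) →
      ‖(π : ℂ) ^ z * (Nm c : ℂ) ^ (-z) * E z * (Complex.Gamma z)⁻¹‖ ≤ A' * rexp (π * |z.im|) := by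
  obtain ⟨A1, hA1, hR⟩ := rGamma_apriori
  have hN := Nm_pos hc
  have hN1 := one_le_Nm hc
  refine ⟨π ^ (2:ℝ) * Nm c ^ (1:ℝ) * A * A1, by positivity, fun z hz => ?_⟩
  rw [norm_mul, norm_mul, norm_mul, Complex.norm_cpow_eq_rpow_re_of_pos pi_pos,
    Complex.norm_cpow_eq_rpow_re_of_pos hN, mul_assoc _ A1]
  have h1 : π ^ z.re ≤ π ^ (2:ℝ) := Real.rpow_le_rpow_of_exponent_le (by linarith [pi_gt_three]) (by linarith [hz.2])
  have h2 : Nm c ^ (-z).re ≤ Nm c ^ (1:ℝ) := Real.rpow_le_rpow_of_exponent_le hN1 (by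
    rw [Complex.neg_re]; linarith [hz.1])
  have h3 := hR z ⟨by linarith [hz.1], by linarith [hz.2]⟩
  have h4 := hE z hz
  gcongr

lemma Lf_convex0 {δ : ℝ} (hδ : 0 < δ) (hδ' : δ ≤ 1/2) : ∃ K : ℝ, 0 < K ∧
    ∀ (c : GaussianInt) (hc : c ≠ 0) (F : GaussianInt → ℂ) (h0 : ∀ x, c ∣ x → F x = 0)
      (S : Finset GaussianInt) (N : ℝ), 0 < N → Nm c = 64 * N → IsRes c S →
      (∀ a b, c ∣ a - b → F a = F b) → (∀ n, ‖F n‖ ≤ 1) → (∀ k, ‖fhat F S c k‖ ≤ 64 * Real.sqrt N) →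
      (∀ z : ℂ, z.re = -δ → ‖Lf c hc F h0 S z‖ ≤ (K * N ^ (1/2 + δ)) * (1 + |z.im|) ^ (1 + 2 * δ)) ∧
      (∀ z : ℂ, z.re = 1 + δ → ‖Lf c hc F h0 S z‖ ≤ K) := by
  obtain ⟨Kg, hKg, hG⟩ := gamma_quot
  have hZ := Zsum_nonneg (1 + δ)
  refine ⟨64 ^ δ * 64 * Zsum (1 + δ) * Kg + Zsum (1 + δ) + 1, by positivity, ?_⟩
  intro c hc F h0 S N hN hcN hS hper hF hfh
  constructor
  · intro z hz
    have := Lf_left_bound c hc F h0 S hfh hG (s := z) (by linarith) (by linarith)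
    refine this.trans ?_
    rw [hz, hcN, show 1 - 2 * -δ = 1 + 2 * δ by ring, show 1 - -δ = 1 + δ by ring, neg_neg]
    rw [← mul_assoc]
    gcongr ?_ * _
    rw [Real.mul_rpow (by norm_num) hN.le, Real.sqrt_eq_rpow, Real.rpow_add hN]
    have h1 : 0 ≤ N ^ (1/2 : ℝ) * N ^ δ := by positivity
    nlinarith [mul_nonneg h1 hZ]
  · intro z hz
    have := Lf_right_bound c hc F h0 S hS hper hF (s := z) (by linarith)
    rw [hz] at this
    have h2 : 0 ≤ 64 ^ δ * 64 * Zsum (1 + δ) * Kg := by positivity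
    linarith

lemma cpow_diff {a : ℝ} (ha : 0 < a) : Differentiable ℂ fun z : ℂ => (a : ℂ) ^ z := fun z =>
  (differentiableAt_id).const_cpow (Or.inl (by exact_mod_cast ha.ne'))

lemma Lf_diff0 (c : GaussianInt) (hc : c ≠ 0) (F : GaussianInt → ℂ) (h0 : ∀ x, c ∣ x → F x = 0)
    (S : Finset GaussianInt) (hg : ∑ r ∈ S, F r = 0) : Differentiable ℂ (Lf c hc F h0 S) := by
  rw [show Lf c hc F h0 S = _ from funext (Lf_eq0 c hc F h0 S hg)]
  have h1 := cpow_diff pi_pos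
  have h2 : Differentiable ℂ fun z : ℂ => (Nm c : ℂ) ^ (-z) := (cpow_diff (Nm_pos hc)).comp differentiable_neg
  exact ((h1.mul h2).mul (thPair c hc F h0 S).differentiable_Λ₀).mul Complex.differentiable_one_div_Gamma

lemma Lf_bound0 {δ : ℝ} (hδ : 0 < δ) (hδ' : δ ≤ 1/2) : ∃ K : ℝ, 0 < K ∧
    ∀ (c : GaussianInt) (hc : c ≠ 0) (F : GaussianInt → ℂ) (h0 : ∀ x, c ∣ x → F x = 0)
      (S : Finset GaussianInt) (N : ℝ), 0 < N → Nm c = 64 * N → IsRes c S →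
      (∀ a b, c ∣ a - b → F a = F b) → (∀ n, ‖F n‖ ≤ 1) → (∀ k, ‖fhat F S c k‖ ≤ 64 * Real.sqrt N) →
      ∑ r ∈ S, F r = 0 → ∀ z : ℂ, z.re ∈ Set.Icc (-δ) (1 + δ) →
      ‖Lf c hc F h0 S z‖ ≤ K * (N * (1 + |z.im|) ^ 2) ^ ((1 + δ - z.re) / 2) := by
  obtain ⟨K, hK, h⟩ := Lf_convex0 hδ hδ'
  refine ⟨2 * rexp 4 * K, by positivity, ?_⟩
  intro c hc F h0 S N hN hcN hS hper hF hfh hg z hz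
  obtain ⟨hl, hr⟩ := h c hc F h0 S N hN hcN hS hper hF hfh
  obtain ⟨A, hA, hAb⟩ := Lam0_bdd (thPair c hc F h0 S) (-δ) (1 + δ)
  obtain ⟨A', hA', hAb'⟩ := apriori_mul c hc _ hδ hδ' hA hAb
  refine convex_core hδ hδ' hN hK.le hA' pi_pos.le (fun z _ => Lf_diff0 c hc F h0 S hg z) ?_ hl hr hz
  intro y hy
  rw [Lf_eq0 c hc F h0 S hg]
  exact hAb' y hy

lemma Lf_diff1 (c : GaussianInt) (hc : c ≠ 0) (F : GaussianInt → ℂ) (h0 : ∀ x, c ∣ x → F x = 0)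
    (S : Finset GaussianInt) {s : ℂ} (hs : s ≠ 1) : DifferentiableAt ℂ (Lf c hc F h0 S) s := by
  have h1 := cpow_diff pi_pos s
  have h2 : Differentiable ℂ fun z : ℂ => (Nm c : ℂ) ^ (-z) := (cpow_diff (Nm_pos hc)).comp differentiable_neg
  refine ((h1.mul (h2 s)).mul ?_).mul (Complex.differentiable_one_div_Gamma s)
  refine (thPair c hc F h0 S).differentiableAt_Λ (Or.inr rfl) (Or.inl ?_)
  change s ≠ ((1:ℝ):ℂ)
  simpa using hs

lemma Lf_residue (c : GaussianInt) (hc : c ≠ 0) (F : GaussianInt → ℂ) (h0 : ∀ x, c ∣ x → F x = 0)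
    (S : Finset GaussianInt) :
    Tendsto (fun s => (s - 1) * Lf c hc F h0 S s) (𝓝[≠] 1) (𝓝 (π * (Nm c : ℂ)⁻¹ * ∑ r ∈ S, F r)) := by
  have h := (thPair c hc F h0 S).Λ_residue_k
  have e1 : (((thPair c hc F h0 S).k : ℝ) : ℂ) = 1 := by change ((1:ℝ):ℂ) = 1; simp
  have e2 : (thPair c hc F h0 S).ε • (thPair c hc F h0 S).g₀ = ∑ r ∈ S, F r := one_smul _ _
  rw [e1, e2] at h
  have h1 := cpow_diff pi_pos
  have h2 : Differentiable ℂ fun z : ℂ => (Nm c : ℂ) ^ (-z) := (cpow_diff (Nm_pos hc)).comp differentiable_neg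
  have h3 := (((h1.mul h2).mul Complex.differentiable_one_div_Gamma).continuous.tendsto 1).mono_left
    (nhdsWithin_le_nhds (s := {1}ᶜ))
  have h4 := h3.mul h
  refine (h4.congr fun s => ?_).trans (le_of_eq ?_)
  · simp only [Lf, smul_eq_mul, Pi.mul_apply]; ring
  · simp [Complex.cpow_neg_one]

lemma Lf_bound1 {δ : ℝ} (hδ : 0 < δ) (hδ' : δ ≤ 1/2)
    (c : GaussianInt) (hc : c ≠ 0) (F : GaussianInt → ℂ) (h0 : ∀ x, c ∣ x → F x = 0)
      (S : Finset GaussianInt) (N : ℝ) (hN : 0 < N) (hcN : Nm c = 64 * N) (hS : IsRes c S)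
      (hper : ∀ a b, c ∣ a - b → F a = F b) (hF : ∀ n, ‖F n‖ ≤ 1)
      (hfh : ∀ k, ‖fhat F S c k‖ ≤ 64 * Real.sqrt N) : ∃ K : ℝ, 0 < K ∧
      ∀ z : ℂ, z.re ∈ Set.Icc (-δ) (1 + δ) → z ≠ 1 →
      ‖Lf c hc F h0 S z‖ ≤ (1 + 3 / ‖z - 1‖) * (K * (N * (1 + |z.im|) ^ 2) ^ ((1 + δ - z.re) / 2)) := by
  obtain ⟨K, hK, h⟩ := Lf_convex0 hδ hδ'
  refine ⟨2 * rexp 4 * K, by positivity, ?_⟩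
  obtain ⟨hl, hr⟩ := h c hc F h0 S N hN hcN hS hper hF hfh
  obtain ⟨A, hA, hAb⟩ := Lam0_bdd (thPair c hc F h0 S) (-δ) (1 + δ)
  set g0 := ∑ r ∈ S, F r with hg0
  have hne2 : ∀ z : ℂ, z.re ∈ Set.Icc (-δ) (1 + δ) → z + 2 ≠ 0 := by
    intro z hz h
    have := congrArg Complex.re h
    simp at this; linarith [hz.1]
  have hge : ∀ z : ℂ, z.re ∈ Set.Icc (-δ) (1 + δ) → 1 ≤ ‖z + 2‖ := by
    intro z hz
    refine le_trans ?_ (Complex.re_le_norm _)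
    simp; linarith [hz.1]
  have hle : ∀ z : ℂ, z.re ∈ Set.Icc (-δ) (1 + δ) → ‖(z - 1) / (z + 2)‖ ≤ 1 := by
    intro z hz
    rw [norm_div, div_le_one (by linarith [hge z hz])]
    rw [← sq_le_sq₀ (norm_nonneg _) (norm_nonneg _), ← Complex.normSq_eq_norm_sq, ← Complex.normSq_eq_norm_sq,
      Complex.normSq_apply, Complex.normSq_apply]
    simp; nlinarith [hz.1]
  obtain ⟨A', hA', hAb'⟩ := apriori_mul c hc (fun z => (z - 1) / (z + 2) * (thPair c hc F h0 S).Λ₀ z + g0 / (z + 2))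
    hδ hδ' (A := A + ‖g0‖) (by positivity) (by
      intro z hz
      refine (norm_add_le _ _).trans (add_le_add ?_ ?_)
      · rw [norm_mul]
        exact (mul_le_of_le_one_left (norm_nonneg _) (hle z hz)).trans (hAb z hz)
      · rw [norm_div]; exact div_le_self (norm_nonneg _) (hge z hz))
  have heq : ∀ z : ℂ, z.re ∈ Set.Icc (-δ) (1 + δ) → z ≠ 1 →
      (π : ℂ) ^ z * (Nm c : ℂ) ^ (-z) * ((z - 1) / (z + 2) * (thPair c hc F h0 S).Λ₀ z + g0 / (z + 2)) * (Complex.Gamma z)⁻¹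
      = (z - 1) / (z + 2) * Lf c hc F h0 S z := by
    intro z hz h1
    rw [Lf_eq c hc F h0 S z h1]
    have := hne2 z hz
    have h2 : z - 1 ≠ 0 := sub_ne_zero.2 h1
    rw [← hg0]
    generalize (π : ℂ) ^ z = a1
    generalize (Nm c : ℂ) ^ (-z) = a2
    field_simp
  have hne1 : ∀ z : ℂ, z.re ≠ 1 → z ≠ 1 := fun z hz h => hz (by rw [h]; simp)
  intro z hz hz1
  have key := convex_core (f := fun z => (π : ℂ) ^ z * (Nm c : ℂ) ^ (-z) *
    ((z - 1) / (z + 2) * (thPair c hc F h0 S).Λ₀ z + g0 / (z + 2)) * (Complex.Gamma z)⁻¹)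
    hδ hδ' hN hK.le hA' pi_pos.le ?_ hAb' ?_ ?_ hz
  · simp only [heq z hz hz1] at key
    rw [norm_mul] at key
    have h2 : 0 < ‖z - 1‖ := norm_pos_iff.2 (sub_ne_zero.2 hz1)
    have h3 : 0 < ‖z + 2‖ := by linarith [hge z hz]
    have h4 : ‖(z + 2) / (z - 1)‖ ≤ 1 + 3 / ‖z - 1‖ := by
      rw [show (z + 2) / (z - 1) = 1 + 3 / (z - 1) by
        have := sub_ne_zero.2 hz1
        field_simp; ring]
      refine (norm_add_le _ _).trans ?_
      rw [norm_one, norm_div]; simp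
    calc ‖Lf c hc F h0 S z‖ = ‖(z + 2) / (z - 1)‖ * (‖(z - 1) / (z + 2)‖ * ‖Lf c hc F h0 S z‖) := by
          rw [norm_div, norm_div]; field_simp
      _ ≤ _ := by gcongr
  · intro y hy
    have h1 := cpow_diff pi_pos y
    have h2 : Differentiable ℂ fun z : ℂ => (Nm c : ℂ) ^ (-z) := (cpow_diff (Nm_pos hc)).comp differentiable_neg
    have h3 := (thPair c hc F h0 S).differentiable_Λ₀ y
    have ha : DifferentiableAt ℂ (fun z : ℂ => (z - 1) / (z + 2)) y :=
      DifferentiableAt.div (by fun_prop) (by fun_prop) (hne2 y hy)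
    have hb : DifferentiableAt ℂ (fun z : ℂ => g0 / (z + 2)) y :=
      DifferentiableAt.div (by fun_prop) (by fun_prop) (hne2 y hy)
    generalize (thPair c hc F h0 S).Λ₀ = L0 at h3 ⊢
    exact ((h1.mul (h2 y)).mul ((ha.mul h3).add hb)).mul (Complex.differentiable_one_div_Gamma y)
  · intro y hy
    have hy' : y.re ∈ Set.Icc (-δ) (1 + δ) := by rw [hy]; constructor <;> linarith
    simp only [heq y hy' (hne1 y (by rw [hy]; linarith))]
    rw [norm_mul]
    exact (mul_le_of_le_one_left (norm_nonneg _) (hle y hy')).trans (hl y hy)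
  · intro y hy
    have hy' : y.re ∈ Set.Icc (-δ) (1 + δ) := by rw [hy]; constructor <;> linarith
    simp only [heq y hy' (hne1 y (by rw [hy]; linarith))]
    rw [norm_mul]
    exact (mul_le_of_le_one_left (norm_nonneg _) (hle y hy')).trans (hr y hy)

section chars
variable {χ : GaussianInt → GaussianInt → ℤ} {g : GaussianInt → GaussianInt → ℂ}

lemma gs_sqfree (hχ : IsQuadSym χ) (hg : IsGaussSum χ g) (m : GaussianInt) (hm : IsPrimary m) :
    Squarefree m → ∀ k, ‖g k m‖ ≤ Real.sqrt (Nm m) ∧ (m ≠ 1 → g 0 m = 0) := by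
  refine primary_induction (P := fun m => Squarefree m → ∀ k, ‖g k m‖ ≤ Real.sqrt (Nm m) ∧
    (m ≠ 1 → g 0 m = 0)) ?_ ?_ m hm
  · intro _ k
    simp [gs_one hχ hg, Nm_one]
  · intro ϖ m hp hpr hm ih hsq k
    have hcop : IsCoprime ϖ m := by
      rw [hp.irreducible.coprime_iff_not_dvd]
      rintro ⟨t, ht⟩
      exact hp.not_isUnit (hsq ϖ ⟨t, by rw [ht]; ring⟩)
    have hsm : Squarefree m := hsq.of_mul_right
    have e1 : ∀ k, ‖g k ϖ‖ ≤ Real.sqrt (Nm ϖ) := by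
      intro k
      rw [gs_prime hχ hg hp hpr, norm_mul, Complex.norm_real, Real.norm_of_nonneg (Real.sqrt_nonneg _)]
      exact mul_le_of_le_one_left (Real.sqrt_nonneg _) (abs_chi_le hχ hpr _)
    refine ⟨?_, fun _ => ?_⟩
    · rw [gs_mul hχ hg k hpr hm hcop, norm_mul, Nm_mul, Real.sqrt_mul (Nm_nonneg _)]
      exact mul_le_mul (e1 k) (ih hsm k).1 (norm_nonneg _) (Real.sqrt_nonneg _)
    · rw [gs_mul hχ hg 0 hpr hm hcop, gs_prime hχ hg hp hpr, mul_zero, hχ.zero_of_dvd _ _ hp (dvd_zero _)]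
      simp

/-- character of conductor dividing `8` -/
def psi (χ : GaussianInt → GaussianInt → ℤ) (u n : GaussianInt) : ℂ :=
  if IsPrimary n then (χ u n : ℂ) else 0

lemma chi_pow_num (hχ : IsQuadSym χ) (a : GaussianInt) {n : GaussianInt} (hn : IsPrimary n) (k : ℕ) :
    χ (a ^ k) n = χ a n ^ k := by
  induction k with
  | zero => simp [chi_one_num hχ hn]
  | succ k ih => rw [pow_succ, pow_succ, chi_mul hχ _ _ hn, ih]

lemma psi_eq (hχ : IsQuadSym χ) (α β : ℕ) (n : GaussianInt) : psi χ (ig ^ α * ωg ^ β) n =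
    if n.im % 2 = 0 ∧ (n.re + n.im) % 4 = 1 then
      (((if n.im % 4 = 0 then 1 else -1) ^ α * (if (n.re + n.im) % 8 = 1 then 1 else -1) ^ β : ℤ) : ℂ)
    else 0 := by
  unfold psi
  by_cases h : IsPrimary n
  · rw [if_pos h, if_pos ((isPrimary_iff n).mp h), chi_mul hχ _ _ h, chi_pow_num hχ _ h, chi_pow_num hχ _ h,
      chi_ig hχ h, chi_omega hχ h]
  · rw [if_neg h, if_neg (fun h' => h ((isPrimary_iff n).mpr h'))]

lemma psi_per (hχ : IsQuadSym χ) (α β : ℕ) (a b : GaussianInt) (h : (8 : GaussianInt) ∣ a - b) :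
    psi χ (ig ^ α * ωg ^ β) a = psi χ (ig ^ α * ωg ^ β) b := by
  have h' := (natCast_dvd_iff 8 (a - b)).mp (by simpa using h)
  simp only [Zsqrtd.re_sub, Zsqrtd.im_sub] at h'
  obtain ⟨h1, h2⟩ := h'
  push_cast at h1 h2
  rw [psi_eq hχ, psi_eq hχ]
  have e1 : a.im % 2 = b.im % 2 := by omega
  have e2 : a.im % 4 = b.im % 4 := by omega
  have e3 : (a.re + a.im) % 4 = (b.re + b.im) % 4 := by omega
  have e4 : (a.re + a.im) % 8 = (b.re + b.im) % 8 := by omega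
  rw [e1, e2, e3, e4]

lemma psi_norm (hχ : IsQuadSym χ) (u n : GaussianInt) : ‖psi χ u n‖ ≤ 1 := by
  unfold psi
  split_ifs with h
  · exact abs_chi_le hχ h _
  · simp

/-- the Dirichlet coefficients -/
def FF (χ : GaussianInt → GaussianInt → ℤ) (u q n : GaussianInt) : ℂ := psi χ u n * (χ n q : ℂ)

lemma FF_eq (hχ : IsQuadSym χ) (u : GaussianInt) {q : GaussianInt} (hq : IsPrimary q) {n : GaussianInt}
    (hn : IsPrimary n) : FF χ u q n = (χ (u * q) n : ℂ) := by
  rw [FF, psi, if_pos hn, chi_mul hχ _ _ hn, recip hχ hq hn]; push_cast; ring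

lemma FF_eq0 (u q : GaussianInt) {n : GaussianInt}
    (hn : ¬ IsPrimary n) : FF χ u q n = 0 := by
  rw [FF, psi, if_neg hn, zero_mul]

lemma FF_h0 (u q : GaussianInt) : ∀ x, 8 * q ∣ x → FF χ u q x = 0 := by
  intro x hx
  apply FF_eq0
  intro h
  apply h.not_omega_dvd
  refine dvd_trans (dvd_trans ⟨4 * (1 - ig), ?_⟩ (dvd_mul_right 8 q)) hx
  decide

lemma FF_per (hχ : IsQuadSym χ) (α β : ℕ) {q : GaussianInt} (hq : IsPrimary q) :
    ∀ a b, 8 * q ∣ a - b → FF χ (ig ^ α * ωg ^ β) q a = FF χ (ig ^ α * ωg ^ β) q b := by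
  intro a b h
  rw [FF, FF, psi_per hχ α β a b ((dvd_mul_right _ _).trans h),
    chi_periodic hχ hq a b ((dvd_mul_left _ _).trans h)]

lemma FF_norm (hχ : IsQuadSym χ) (u : GaussianInt) {q : GaussianInt} (hq : IsPrimary q) (n : GaussianInt) :
    ‖FF χ u q n‖ ≤ 1 := by
  rw [FF, norm_mul]
  exact mul_le_one₀ (psi_norm hχ _ _) (norm_nonneg _) (abs_chi_le hχ hq _)

lemma eight_ne : (8 : GaussianInt) ≠ 0 := by decide

lemma cop_eight {q : GaussianInt} (hq : IsPrimary q) : IsCoprime (8 : GaussianInt) q := by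
  have : IsCoprime ωg q := (prime_omega.irreducible.coprime_iff_not_dvd).mpr hq.not_omega_dvd
  have h8 : (8 : GaussianInt) = ωg ^ 6 * ig := by decide
  rw [h8]
  exact (isCoprime_mul_unit_right_left isUnit_ig _ _).mpr this.pow_left

lemma FF_fhat (hχ : IsQuadSym χ) (hg : IsGaussSum χ g) (α β : ℕ) {q : GaussianInt} (hq : IsPrimary q)
    {S T : Finset GaussianInt} (hS : IsRes (8 * q) S) (hT : IsRes 8 T) (k : GaussianInt) :
    fhat (FF χ (ig ^ α * ωg ^ β) q) S (8 * q) k =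
      (∑ x ∈ T, psi χ (ig ^ α * ωg ^ β) (q * x) * ee (k * x) 8) * ((χ 8 q : ℂ) * g k q) := by
  obtain ⟨R, hR⟩ := exists_isRes hq.ne_zero
  have hne : 8 * q ≠ 0 := mul_ne_zero eight_ne hq.ne_zero
  rw [fhat, IsRes.sum_crt (cop_eight hq) hT hR hS, gs_eq hg k hq.ne_zero hR, Finset.mul_sum, Finset.sum_mul_sum]
  · refine Finset.sum_congr rfl fun x _ => Finset.sum_congr rfl fun y _ => ?_
    rw [ee_crt k x y eight_ne hq.ne_zero, FF, psi_per hχ α β (q * x + 8 * y) (q * x) (by simp),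
      chi_periodic hχ hq (q * x + 8 * y) (8 * y) (by simp), chi_mul hχ _ _ hq]
    push_cast; ring
  · intro x y h
    rw [FF_per hχ α β hq x y h, ee_periodic hne (a := k * x) (b := k * y)]
    rw [← mul_sub]; exact h.mul_left k

lemma Nm_eight : Nm 8 = 64 := by
  have : Zsqrtd.norm (8 : GaussianInt) = 64 := by decide
  simp [Nm, this]

lemma FF_fhat_bound (hχ : IsQuadSym χ) (hg : IsGaussSum χ g) (α β : ℕ) {q : GaussianInt} (hq : IsPrimary q)
    (hsq : Squarefree q) {S : Finset GaussianInt} (hS : IsRes (8 * q) S) (k : GaussianInt) :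
    ‖fhat (FF χ (ig ^ α * ωg ^ β) q) S (8 * q) k‖ ≤ 64 * Real.sqrt (Nm q) := by
  obtain ⟨T, hT⟩ := exists_isRes eight_ne
  rw [FF_fhat hχ hg α β hq hS hT, norm_mul, norm_mul]
  refine mul_le_mul ?_ ?_ (by positivity) (by norm_num)
  · refine (norm_sum_le _ _).trans ?_
    refine (Finset.sum_le_sum (g := fun _ => (1:ℝ)) fun x _ => ?_).trans ?_
    · rw [norm_mul, norm_ee, mul_one]; exact psi_norm hχ _ _
    · simp [hT.card_eq_Nm eight_ne, Nm_eight]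
  · exact (mul_le_of_le_one_left (norm_nonneg _) (abs_chi_le hχ hq _)).trans
      (gs_sqfree hχ hg q hq hsq k).1

lemma FF_sum_eq (q u : GaussianInt) (S : Finset GaussianInt) (c : GaussianInt) :
    ∑ r ∈ S, FF χ u q r = fhat (FF χ u q) S c 0 := by
  simp [fhat, ee_zero]

lemma FF_sum_zero (hχ : IsQuadSym χ) (hg : IsGaussSum χ g) (α β : ℕ) (hα : α < 2) (hβ : β < 2)
    {q : GaussianInt} (hq : IsPrimary q)
    (hsq : Squarefree q) {S : Finset GaussianInt} (hS : IsRes (8 * q) S) (hne : ¬ (α = 0 ∧ β = 0 ∧ q = 1)) :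
    ∑ r ∈ S, FF χ (ig ^ α * ωg ^ β) q r = 0 := by
  by_cases hq1 : q = 1
  · subst hq1
    have key : ∀ a : GaussianInt, IsPrimary a → psi χ (ig ^ α * ωg ^ β) a = -1 →
        ∑ r ∈ S, FF χ (ig ^ α * ωg ^ β) 1 r = 0 := by
      intro a ha h1
      have hc : IsCoprime a (8 * 1) := by rw [mul_one]; exact (cop_eight ha).symm
      have h := hS.sum_mul _ (FF_per hχ α β hq) hc
      have h2 : ∀ r, FF χ (ig ^ α * ωg ^ β) 1 (a * r) = - FF χ (ig ^ α * ωg ^ β) 1 r := by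
        intro r
        by_cases hr : IsPrimary r
        · rw [FF_eq hχ _ hq (ha.mul hr), FF_eq hχ _ hq hr, chi_mul_den hχ _ ha hr]
          rw [psi, if_pos ha] at h1
          rw [mul_one]; push_cast; rw [h1]; ring
        · rw [FF_eq0 _ _ hr, FF_eq0, neg_zero]
          intro h; exact hr (ha.of_mul h)
      simp only [h2, Finset.sum_neg_distrib] at h
      exact self_eq_neg.mp h.symm
    have h32 : IsPrimary ⟨3, 2⟩ := by rw [isPrimary_iff]; decide
    have h50 : IsPrimary ⟨5, 0⟩ := by rw [isPrimary_iff]; decide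
    interval_cases α <;> interval_cases β
    · simp at hne
    · exact key _ h32 (by rw [psi_eq hχ]; norm_num)
    · exact key _ h32 (by rw [psi_eq hχ]; norm_num)
    · exact key _ h50 (by rw [psi_eq hχ]; norm_num)
  · obtain ⟨T, hT⟩ := exists_isRes eight_ne
    rw [FF_sum_eq _ _ _ (8 * q), FF_fhat hχ hg α β hq hS hT, (gs_sqfree hχ hg q hq hsq 0).2 hq1]
    simp

lemma FF_sum_ne (hχ : IsQuadSym χ) {S : Finset GaussianInt} (hS : IsRes (8 * 1) S) :
    ∑ r ∈ S, FF χ 1 1 r ≠ 0 := by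
  have h1 : ∀ r, FF χ 1 1 r = if IsPrimary r then 1 else 0 := by
    intro r
    split_ifs with h
    · rw [FF_eq hχ _ isPrimary_one h, mul_one, chi_one_num hχ h]; simp
    · exact FF_eq0 _ _ h
  simp only [h1, Finset.sum_boole]
  rw [Nat.cast_ne_zero, ← Nat.pos_iff_ne_zero, Finset.card_pos]
  obtain ⟨x, ⟨hx, hx'⟩, -⟩ := hS 1
  refine ⟨x, Finset.mem_filter.mpr ⟨hx, ?_⟩⟩
  unfold IsPrimary
  have h8 : ωg ^ 3 ∣ 8 * 1 := ⟨ωg ^ 3 * ig, by decide⟩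
  rw [← neg_sub, dvd_neg]
  exact h8.trans hx'

end chars

section decomp

lemma Nm_pow' (n : GaussianInt) (k : ℕ) : Nm (n ^ k) = Nm n ^ k := by
  induction k with
  | zero => simp [Nm_one]
  | succ k ih => rw [pow_succ, pow_succ, Nm_mul, ih]

lemma primary_decomp (m : GaussianInt) (hm : IsPrimary m) :
    ∃ q t, IsPrimary q ∧ IsPrimary t ∧ Squarefree q ∧ m = q * t ^ 2 := by
  refine primary_induction (P := fun m => ∃ q t, IsPrimary q ∧ IsPrimary t ∧ Squarefree q ∧
    m = q * t ^ 2) ?_ ?_ m hm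
  · exact ⟨1, 1, isPrimary_one, isPrimary_one, squarefree_one, by simp⟩
  · rintro ϖ m hp hpr hm ⟨q, t, hq, ht, hs, rfl⟩
    by_cases h : ϖ ∣ q
    · obtain ⟨r, rfl⟩ := h
      exact ⟨r, ϖ * t, hpr.of_mul hq, hpr.mul ht, hs.of_mul_right, by ring⟩
    · refine ⟨ϖ * q, t, hpr.mul hq, ht, ?_, by ring⟩
      rw [squarefree_mul_iff]
      exact ⟨(hp.irreducible.coprime_iff_not_dvd.mpr h).isRelPrime, hp.irreducible.squarefree, hs⟩

lemma sq_decomp (Q : GaussianInt) : ∃ (α β : ℕ) (q t : GaussianInt), α < 2 ∧ β < 2 ∧ IsPrimary q ∧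
    Squarefree q ∧ (Q ≠ 0 → Q = (ig ^ α * ωg ^ β * q) * t ^ 2 ∧
      ((∃ r, Q = r ^ 2) ↔ (α = 0 ∧ β = 0 ∧ q = 1))) := by
  by_cases hQ : Q = 0
  · exact ⟨0, 0, 1, 1, by norm_num, by norm_num, isPrimary_one, squarefree_one, fun h => absurd hQ h⟩
  by_cases hsq : ∃ r, Q = r ^ 2
  · obtain ⟨r, hr⟩ := hsq
    exact ⟨0, 0, 1, r, by norm_num, by norm_num, isPrimary_one, squarefree_one,
      fun _ => ⟨by simp [hr], fun _ => ⟨rfl, rfl, rfl⟩, fun _ => ⟨r, hr⟩⟩⟩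
  · obtain ⟨k, n, hn, hkn⟩ := WfDvdMonoid.max_power_factor hQ prime_omega.irreducible
    obtain ⟨u, hu, hun⟩ := exists_primary_unit hn
    obtain ⟨q, t, hq, ht, hs, hqt⟩ := primary_decomp _ hun
    obtain ⟨v, hv⟩ := hu.exists_left_inv
    have hvu : IsUnit v := .of_mul_eq_one _ hv
    have h1 : Q = v * ωg ^ k * q * t ^ 2 := by
      rw [hkn]; linear_combination (v * ωg ^ k) * hqt + (-ωg ^ k * n) * hv
    obtain ⟨α, ρ, hα, hvα⟩ : ∃ (α : ℕ) (ρ : GaussianInt), α < 2 ∧ v = ig ^ α * ρ ^ 2 := by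
      rcases isUnit_cases hvu with h | h | h | h
      · exact ⟨0, 1, by norm_num, by rw [h]; decide⟩
      · exact ⟨0, ig, by norm_num, by rw [h]; decide⟩
      · exact ⟨1, 1, by norm_num, by rw [h]; decide⟩
      · exact ⟨1, ig, by norm_num, by rw [h]; decide⟩
    have h2 : Q = (ig ^ α * ωg ^ (k % 2) * q) * (ρ * ωg ^ (k / 2) * t) ^ 2 := by
      rw [h1, hvα]
      have : ωg ^ k = ωg ^ (k % 2) * (ωg ^ (k / 2)) ^ 2 := by
        rw [← pow_mul, ← pow_add]; congr 1; omega
      rw [this]; ring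
    refine ⟨α, k % 2, q, _, hα, Nat.mod_lt _ (by norm_num), hq, hs, fun _ => ⟨h2, ?_⟩⟩
    refine ⟨fun h => absurd h hsq, ?_⟩
    rintro ⟨r1, r2, r3⟩
    rw [r1, r2, r3] at h2
    exact absurd ⟨_, by simpa using h2⟩ hsq

end decomp

section LL
variable {χ : GaussianInt → GaussianInt → ℤ} {g : GaussianInt → GaussianInt → ℂ}

lemma eq_ne {q : GaussianInt} (hq : IsPrimary q) : 8 * q ≠ 0 := mul_ne_zero eight_ne hq.ne_zero

/-- the L-function -/
def LL (χ : GaussianInt → GaussianInt → ℤ) (α β : ℕ) (q : GaussianInt) (hq : IsPrimary q) (s : ℂ) : ℂ :=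
  Lf (8 * q) (eq_ne hq) (FF χ (ig ^ α * ωg ^ β) q) (FF_h0 _ _) (Classical.choose (exists_isRes (eq_ne hq))) s

lemma Zsum_anti {a b : ℝ} (ha : 1 < a) (hab : a ≤ b) : Zsum b ≤ Zsum a := by
  refine Summable.tsum_le_tsum (fun n => ?_) (summable_Nm (ha.trans_le hab)) (summable_Nm ha)
  by_cases h : n = 0
  · have : Nm n = 0 := by rw [h]; simp [Nm]
    rw [this, Real.zero_rpow (by linarith), Real.zero_rpow (by linarith)]
  · exact Real.rpow_le_rpow_of_exponent_le (one_le_Nm h) (by linarith)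

lemma L_pack (hχ : IsQuadSym χ) (hg : IsGaussSum χ g) : ∃ (Q1 : GaussianInt → GaussianInt)
    (L : GaussianInt → ℂ → ℂ),
    (∀ Q, Q ≠ 0 → (∃ t, Q = Q1 Q * t ^ 2) ∧
      (∀ s : ℂ, 1 < s.re → HasSum (fun n : GaussianInt => (if IsPrimary n then (χ (Q1 Q) n : ℂ) else 0)
        / (Nm n : ℂ) ^ s) (L Q s)) ∧
      (∀ s, s ≠ 1 → DifferentiableAt ℂ (L Q) s) ∧
      (¬ (∃ r, Q = r ^ 2) → Differentiable ℂ (L Q)) ∧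
      ((∃ r, Q = r ^ 2) → ∃ c : ℂ, c ≠ 0 ∧ Tendsto (fun s => (s - 1) * L Q s) (𝓝[≠] 1) (𝓝 c))) ∧
    ∀ δ : ℝ, 0 < δ → δ ≤ 1/2 → ∃ K : ℝ, 0 < K ∧ ∀ Q, Q ≠ 0 → ∀ z : ℂ, -δ ≤ z.re →
      ((∃ r, Q = r ^ 2) → z ≠ 1) →
      ‖L Q z‖ ≤ (if ∃ r, Q = r ^ 2 then 1 + 3 / ‖z - 1‖ else 1) *
        (K * (Nm Q * (1 + |z.im|) ^ 2) ^ (max ((1 + δ - z.re) / 2) 0)) := by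
  choose α β q t hα hβ hq hsq hQ using sq_decomp
  have hres : ∀ Q, IsRes (8 * q Q) (Classical.choose (exists_isRes (eq_ne (hq Q)))) :=
    fun Q => Classical.choose_spec (exists_isRes (eq_ne (hq Q)))
  refine ⟨fun Q => ig ^ α Q * ωg ^ β Q * q Q, fun Q => LL χ (α Q) (β Q) (q Q) (hq Q), ?_, ?_⟩
  · intro Q hQ0
    obtain ⟨h1, h2⟩ := hQ Q hQ0
    refine ⟨⟨_, h1⟩, ?_, ?_, ?_, ?_⟩
    · intro s hs
      refine (hasSum_congrC fun n => ?_).mpr (Lf_hasSum _ (eq_ne (hq Q)) _ (FF_h0 _ _) _ (hres Q)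
        (FF_per hχ _ _ (hq Q)) (FF_norm hχ _ (hq Q)) hs)
      split_ifs with h
      · rw [FF_eq hχ _ (hq Q) h]
      · rw [FF_eq0 _ _ h]
    · intro s hs
      exact Lf_diff1 _ _ _ _ _ hs
    · intro hn
      exact Lf_diff0 _ _ _ _ _ (FF_sum_zero hχ hg _ _ (hα Q) (hβ Q) (hq Q) (hsq Q) (hres Q)
        (fun h => hn (h2.mpr h)))
    · intro hr
      obtain ⟨e1, e2, e3⟩ := h2.mp hr
      refine ⟨_, ?_, Lf_residue _ _ _ _ _⟩
      refine mul_ne_zero (mul_ne_zero (by simp [Real.pi_ne_zero]) (inv_ne_zero ?_)) ?_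
      · exact_mod_cast (Nm_pos (eq_ne (hq Q))).ne'
      · have hr' := hres Q
        revert hr'
        generalize Classical.choose (exists_isRes (eq_ne (hq Q))) = S'
        intro hr'
        rw [e3] at hr'
        have := FF_sum_ne hχ hr'
        rw [e1, e2, e3]; simpa using this
  · intro δ hδ hδ'
    obtain ⟨K0, hK0, hb0⟩ := Lf_bound0 hδ hδ'
    have hp1 := isPrimary_one
    obtain ⟨K1, hK1, hb1⟩ := Lf_bound1 hδ hδ' (8 * 1) (eq_ne hp1) (FF χ (ig ^ 0 * ωg ^ 0) 1) (FF_h0 _ _)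
      (Classical.choose (exists_isRes (eq_ne hp1))) 1 one_pos (by rw [mul_one, Nm_eight]; norm_num)
      (Classical.choose_spec (exists_isRes (eq_ne hp1))) (FF_per hχ _ _ hp1) (FF_norm hχ _ hp1)
      (fun k => by
        have := FF_fhat_bound hχ hg 0 0 hp1 squarefree_one
          (Classical.choose_spec (exists_isRes (eq_ne hp1))) k
        rwa [Nm_one] at this)
    refine ⟨K0 + K1 + Zsum (1 + δ), by have := Zsum_nonneg (1 + δ); positivity, ?_⟩
    intro Q hQ0 z hz hz1
    obtain ⟨h1, h2⟩ := hQ Q hQ0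
    have hZ := Zsum_nonneg (1 + δ)
    have hN1 : 1 ≤ Nm Q := one_le_Nm hQ0
    have hI1 : 1 ≤ (1 + |z.im|) ^ 2 := one_le_pow₀ (by linarith [abs_nonneg z.im])
    have hX1 : 1 ≤ Nm Q * (1 + |z.im|) ^ 2 := by nlinarith
    have hite : (1:ℝ) ≤ (if ∃ r, Q = r ^ 2 then 1 + 3 / ‖z - 1‖ else 1) := by
      split_ifs
      · have : 0 ≤ 3 / ‖z - 1‖ := by positivity
        linarith
      · exact le_rfl
    by_cases hre : z.re ≤ 1 + δ
    · have hmax : max ((1 + δ - z.re) / 2) 0 = (1 + δ - z.re) / 2 := max_eq_left (by linarith)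
      rw [hmax]
      have hqQ : Nm (q Q) ≤ Nm Q := by
        apply Nm_le_of_dvd _ hQ0
        exact ⟨ig ^ α Q * ωg ^ β Q * (t Q) ^ 2, by rw [mul_comm (q Q)]; exact h1.trans (by ring)⟩
      have hqpos := Nm_pos (hq Q).ne_zero
      by_cases hr : ∃ r, Q = r ^ 2
      · rw [if_pos hr]
        obtain ⟨e1, e2, e3⟩ := h2.mp hr
        have heq : LL χ (α Q) (β Q) (q Q) (hq Q) z = LL χ 0 0 1 hp1 z := by
          have : ∀ (a b : ℕ) (x : GaussianInt) (hx : IsPrimary x), a = 0 → b = 0 → x = 1 →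
            LL χ a b x hx z = LL χ 0 0 1 hp1 z := by
            rintro a b x hx rfl rfl rfl; rfl
          exact this _ _ _ _ e1 e2 e3
        simp only [heq]
        refine (hb1 z ⟨hz, hre⟩ (hz1 hr)).trans ?_
        refine mul_le_mul_of_nonneg_left ?_ (by positivity)
        refine mul_le_mul (by linarith) (Real.rpow_le_rpow (by positivity) ?_ (by linarith)) (by positivity)
          (by positivity)
        exact mul_le_mul_of_nonneg_right hN1 (by positivity)
      · rw [if_neg hr, one_mul]
        refine (hb0 (8 * q Q) (eq_ne (hq Q)) _ (FF_h0 _ _) _ (Nm (q Q)) hqpos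
          (by rw [Nm_mul, Nm_eight]) (hres Q)
          (FF_per hχ _ _ (hq Q)) (FF_norm hχ _ (hq Q)) (fun k => FF_fhat_bound hχ hg _ _ (hq Q) (hsq Q) (hres Q) k)
          (FF_sum_zero hχ hg _ _ (hα Q) (hβ Q) (hq Q) (hsq Q) (hres Q)
            (fun h => hr (h2.mpr h))) z ⟨hz, hre⟩).trans ?_
        refine mul_le_mul (by linarith) (Real.rpow_le_rpow (by positivity) ?_ (by linarith)) (by positivity)
          (by positivity)
        exact mul_le_mul_of_nonneg_right hqQ (by positivity)
    · push Not at hre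
      rw [max_eq_right (by linarith), Real.rpow_zero, mul_one]
      refine (Lf_right_bound _ (eq_ne (hq Q)) _ (FF_h0 _ _) _ (hres Q)
        (FF_per hχ _ _ (hq Q)) (FF_norm hχ _ (hq Q)) (by linarith)).trans ?_
      refine (Zsum_anti (by linarith) hre.le).trans ?_
      nlinarith

end LL

section peel

/-- primary elements not divisible by any element of `S` -/
def MS (S : Finset GaussianInt) : Set GaussianInt := {m | IsPrimary m ∧ ∀ ϖ ∈ S, ¬ ϖ ∣ m}

/-- primary primes -/
def PP (ϖ : GaussianInt) : Prop := Prime ϖ ∧ IsPrimary ϖ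

lemma PP.eq_of_dvd {p q : GaussianInt} (hp : PP p) (hq : PP q) (h : p ∣ q) : p = q :=
  IsPrimary.eq_of_associated hp.2 hq.2 ((hp.1.dvd_prime_iff_associated hq.1).mp h)

lemma PP.coprime {p m : GaussianInt} (hp : PP p) (h : ¬ p ∣ m) : IsCoprime p m :=
  hp.1.irreducible.coprime_iff_not_dvd.mpr h

lemma MS_one {S : Finset GaussianInt} (hS : ∀ p ∈ S, PP p) : (1 : GaussianInt) ∈ MS S :=
  ⟨isPrimary_one, fun p hp h => (hS p hp).1.not_isUnit (isUnit_of_dvd_one h)⟩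

lemma peel_mem {S : Finset GaussianInt} (hS : ∀ p ∈ S, PP p) {ϖ : GaussianInt} (hϖ : PP ϖ) (hn : ϖ ∉ S)
    (k : ℕ) {m : GaussianInt} (hm : m ∈ MS (insert ϖ S)) : ϖ ^ k * m ∈ MS S := by
  refine ⟨(hϖ.2.pow k).mul hm.1, fun p hp h => ?_⟩
  rcases (hS p hp).1.dvd_or_dvd h with h | h
  · have := (hS p hp).eq_of_dvd hϖ ((hS p hp).1.dvd_of_dvd_pow h)
    exact hn (this ▸ hp)
  · exact hm.2 p (Finset.mem_insert_of_mem hp) h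

lemma peel_bij {S : Finset GaussianInt} (hS : ∀ p ∈ S, PP p) {ϖ : GaussianInt} (hϖ : PP ϖ) (hn : ϖ ∉ S) :
    Function.Bijective (fun x : ℕ × MS (insert ϖ S) =>
      (⟨ϖ ^ x.1 * x.2.1, peel_mem hS hϖ hn x.1 x.2.2⟩ : MS S)) := by
  constructor
  · rintro ⟨k, m, hm⟩ ⟨l, n, hn'⟩ h
    have h' : ϖ ^ k * m = ϖ ^ l * n := congrArg Subtype.val h
    have hm' := hm.2 ϖ (Finset.mem_insert_self _ _)
    have hn'' := hn'.2 ϖ (Finset.mem_insert_self _ _)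
    have key : ∀ (k l : ℕ) (m n : GaussianInt), ¬ ϖ ∣ n → ϖ ^ k * m = ϖ ^ l * n → k ≤ l := by
      intro k l m n hn h
      by_contra hlt
      push Not at hlt
      obtain ⟨d, rfl⟩ := Nat.exists_eq_add_of_lt hlt
      apply hn
      have h0 : ϖ ^ l ≠ 0 := pow_ne_zero _ hϖ.1.ne_zero
      refine ⟨ϖ ^ d * m, mul_left_cancel₀ h0 ?_⟩
      rw [← h]; ring
    have hkl : k = l := le_antisymm (key _ _ _ _ hn'' h') (key _ _ _ _ hm' h'.symm)
    subst hkl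
    have := mul_left_cancel₀ (pow_ne_zero _ hϖ.1.ne_zero) h'
    subst this; rfl
  · rintro ⟨m, hm⟩
    obtain ⟨k, n, hn, hkn⟩ := WfDvdMonoid.max_power_factor hm.1.ne_zero hϖ.1.irreducible
    have hnp : IsPrimary n := (hϖ.2.pow k).of_mul (by rw [← hkn]; exact hm.1)
    refine ⟨⟨k, n, hnp, fun p hp => ?_⟩, Subtype.ext hkn.symm⟩
    rcases Finset.mem_insert.mp hp with rfl | hp
    · exact hn
    · intro h; exact hm.2 p hp (hkn ▸ h.mul_left _)

lemma MS_summable {f : GaussianInt → ℂ} (hf : Summable fun m : MS ∅ => ‖f m‖) (S : Finset GaussianInt) :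
    Summable fun m : MS S => ‖f m‖ := by
  have hsub : ∀ m : MS S, m.1 ∈ MS ∅ := fun m => ⟨m.2.1, by simp⟩
  exact hf.comp_injective (i := fun m : MS S => (⟨m.1, hsub m⟩ : MS ∅)) (by
    rintro ⟨a, _⟩ ⟨b, _⟩ h
    simpa using h)

lemma peel {f : GaussianInt → ℂ} (hf : Summable fun m : MS ∅ => ‖f m‖)
    (hmul : ∀ m n, IsPrimary m → IsPrimary n → IsCoprime m n → f (m * n) = f m * f n)
    {S : Finset GaussianInt} (hS : ∀ p ∈ S, PP p) {ϖ : GaussianInt} (hϖ : PP ϖ) (hn : ϖ ∉ S) :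
    ∑' m : MS S, f m = (∑' k : ℕ, f (ϖ ^ k)) * ∑' m : MS (insert ϖ S), f m := by
  have h1 : Summable fun k : ℕ => ‖f (ϖ ^ k)‖ := by
    refine hf.comp_injective (i := fun k : ℕ => (⟨ϖ ^ k, hϖ.2.pow k, by simp⟩ : MS ∅)) ?_
    intro k l h
    have h' : ϖ ^ k = ϖ ^ l := congrArg Subtype.val h
    exact (pow_inj_of_not_isUnit hϖ.1.not_isUnit hϖ.1.ne_zero).mp h'
  rw [tsum_mul_tsum_of_summable_norm h1 (MS_summable hf _)]
  rw [← (Equiv.ofBijective _ (peel_bij hS hϖ hn)).tsum_eq]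
  refine tsum_congr fun x => ?_
  refine hmul _ _ (hϖ.2.pow _) x.2.2.1 ?_
  exact (hϖ.coprime (x.2.2.2 ϖ (Finset.mem_insert_self _ _))).pow_left

lemma peel_prod {f : GaussianInt → ℂ} (hf : Summable fun m : MS ∅ => ‖f m‖)
    (hmul : ∀ m n, IsPrimary m → IsPrimary n → IsCoprime m n → f (m * n) = f m * f n)
    (S : Finset GaussianInt) : (∀ p ∈ S, PP p) →
    ∑' m : MS ∅, f m = (∏ ϖ ∈ S, ∑' k : ℕ, f (ϖ ^ k)) * ∑' m : MS S, f m := by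
  induction S using Finset.induction_on with
  | empty => simp
  | insert ϖ S hn ih =>
    intro h
    have hS : ∀ p ∈ S, PP p := fun p hp => h p (Finset.mem_insert_of_mem hp)
    rw [ih hS, peel hf hmul hS (h ϖ (Finset.mem_insert_self _ _)) hn, Finset.prod_insert hn]
    ring

/-- the square decomposition -/
lemma sq_unique {a b t u : GaussianInt} (ha : IsPrimary a) (hb : IsPrimary b) (ht : IsPrimary t)
    (hu : IsPrimary u) (hsa : Squarefree a) (hsb : Squarefree b) (h : a * t ^ 2 = b * u ^ 2) :
    a = b ∧ t = u := by
  revert a b u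
  refine primary_induction (P := fun t => ∀ {a b u : GaussianInt}, IsPrimary a → IsPrimary b → IsPrimary u →
    Squarefree a → Squarefree b → a * t ^ 2 = b * u ^ 2 → a = b ∧ t = u) ?_ ?_ t ht
  · intro a b u ha hb hu hsa hsb h
    have hu1 : u = 1 := by
      refine hu.eq_one_of_isUnit (hsa u ⟨b, ?_⟩)
      linear_combination h
    subst hu1
    exact ⟨by simpa using h, rfl⟩
  · intro ϖ t hp hpr ht ih a b u ha hb hu hsa hsb h
    have hdu : ϖ ∣ u := by
      by_contra hnu
      have h1 : IsCoprime (ϖ * ϖ) (u ^ 2) := by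
        have : IsCoprime ϖ u := hp.irreducible.coprime_iff_not_dvd.mpr hnu
        rw [← sq]; exact this.pow
      have h2 : ϖ * ϖ ∣ b * u ^ 2 := ⟨a * t ^ 2, by rw [← h]; ring⟩
      exact hp.not_isUnit (hsb ϖ (h1.dvd_of_dvd_mul_right h2))
    obtain ⟨u', rfl⟩ := hdu
    have h0 : ϖ ^ 2 ≠ 0 := pow_ne_zero _ hp.ne_zero
    have := ih ha hb (hpr.of_mul hu) hsa hsb (mul_left_cancel₀ h0 (by linear_combination h))
    exact ⟨this.1, by rw [this.2]⟩

lemma sq_split {h : GaussianInt → ℂ} (hf : Summable fun m : MS ∅ => ‖h m‖)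
    (hf2 : Summable fun m : MS ∅ => ‖h (m.1 ^ 2)‖)
    (hmul : ∀ m n, IsPrimary m → IsPrimary n → h (m * n) = h m * h n)
    {S : Finset GaussianInt} (hS : ∀ p ∈ S, PP p) :
    ∑' m : MS S, h m = (∑' m : MS S, if Squarefree m.1 then h m else 0) * ∑' m : MS S, h (m.1 ^ 2) := by
  have h1 : Summable fun m : MS S => ‖(if Squarefree m.1 then h m else 0 : ℂ)‖ := by
    refine (MS_summable hf S).of_nonneg_of_le (fun _ => norm_nonneg _) fun m => ?_
    split_ifs <;> simp
  have h2 : Summable fun m : MS S => ‖h (m.1 ^ 2)‖ := MS_summable (f := fun m => h (m ^ 2)) hf2 S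
  rw [tsum_mul_tsum_of_summable_norm h1 h2]
  let φ : MS S × MS S → MS S := fun x => ⟨x.1.1 * x.2.1 ^ 2, x.1.2.1.mul (x.2.2.1.pow 2), fun p hp hd => by
    rcases (hS p hp).1.dvd_or_dvd hd with hd | hd
    · exact x.1.2.2 p hp hd
    · exact x.2.2.2 p hp ((hS p hp).1.dvd_of_dvd_pow hd)⟩
  have hinj : Set.InjOn φ {x | Squarefree x.1.1} := by
    rintro ⟨⟨a, ha⟩, ⟨t, ht⟩⟩ hsa ⟨⟨b, hb⟩, ⟨u, hu⟩⟩ hsb he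
    have he' : a * t ^ 2 = b * u ^ 2 := congrArg Subtype.val he
    have := sq_unique ha.1 hb.1 ht.1 hu.1 hsa hsb he'
    simp [this.1, this.2]
  have hsurj : ∀ m : MS S, ∃ x, Squarefree x.1.1 ∧ φ x = m := by
    rintro ⟨m, hm⟩
    obtain ⟨q, t, hq, ht, hsq, rfl⟩ := primary_decomp m hm.1
    refine ⟨⟨⟨q, hq, fun p hp hd => hm.2 p hp (hd.mul_right _)⟩,
      ⟨t, ht, fun p hp hd => hm.2 p hp ((hd.trans (dvd_pow_self t (by norm_num))).mul_left _)⟩⟩, hsq, rfl⟩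
  let e : {x : MS S × MS S // Squarefree x.1.1} ≃ MS S := Equiv.ofBijective (fun x => φ x.1)
    ⟨fun x y hxy => Subtype.ext (hinj x.2 y.2 hxy), fun m => by
      obtain ⟨x, hx, hx'⟩ := hsurj m; exact ⟨⟨x, hx⟩, hx'⟩⟩
  rw [← e.tsum_eq]
  have hsupp : Function.support (fun z : MS S × MS S => (if Squarefree z.1.1 then h z.1 else 0) * h (z.2.1 ^ 2)) ⊆
      {x : MS S × MS S | Squarefree x.1.1} := by
    intro x hx
    by_contra hc
    simp only [Set.mem_ofPred_eq] at hc
    simp [hc] at hx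
  rw [← tsum_subtype_eq_of_support_subset hsupp]
  refine tsum_congr fun x => ?_
  have hx : Squarefree x.1.1.1 := x.2
  simp only [if_pos hx]
  exact hmul _ _ x.1.1.2.1 (x.1.2.2.1.pow 2)

end peel

section zeta

/-- `N(m)^{-s}` -/
def nz (s : ℂ) (m : GaussianInt) : ℂ := (Nm m : ℂ) ^ (-s)

lemma nz_eq (s : ℂ) (m : GaussianInt) (x : ℂ) : x / (Nm m : ℂ) ^ s = x * nz s m := by
  rw [nz, Complex.cpow_neg, div_eq_mul_inv]

lemma nz_mul (s : ℂ) (m n : GaussianInt) : nz s (m * n) = nz s m * nz s n := by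
  rw [nz, Nm_mul]; push_cast; exact Complex.mul_cpow_ofReal_nonneg (Nm_nonneg _) (Nm_nonneg _) _

lemma nz_one (s : ℂ) : nz s 1 = 1 := by simp [nz, Nm_one]

lemma nz_pow (s : ℂ) (m : GaussianInt) (k : ℕ) : nz s (m ^ k) = nz s m ^ k := by
  induction k with
  | zero => simp [nz_one]
  | succ k ih => rw [pow_succ, pow_succ, nz_mul, ih]

lemma nz_norm (s : ℂ) {m : GaussianInt} (hm : m ≠ 0) : ‖nz s m‖ = Nm m ^ (-s.re) := by
  rw [nz, Complex.norm_cpow_eq_rpow_re_of_pos (Nm_pos hm)]; simp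

lemma nz_add (s t : ℂ) {m : GaussianInt} (hm : m ≠ 0) : nz (s + t) m = nz s m * nz t m := by
  have : (Nm m : ℂ) ≠ 0 := by exact_mod_cast (Nm_pos hm).ne'
  rw [nz, neg_add, Complex.cpow_add _ _ this]; rfl

lemma nz_diff {m : GaussianInt} (hm : m ≠ 0) : Differentiable ℂ fun s => nz s m :=
  (cpow_diff (Nm_pos hm)).comp differentiable_neg

lemma MS_nz_summable {s : ℂ} (hs : 1 < s.re) : Summable fun m : MS ∅ => ‖nz s m‖ := by
  have h := (summable_Nm hs).subtype (MS ∅)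
  refine h.congr fun m => ?_
  rw [nz_norm s m.2.1.ne_zero]; rfl

lemma MS_bdd_summable {s : ℂ} {f : GaussianInt → ℂ} (hf : ∀ m, IsPrimary m → ‖f m‖ ≤ ‖nz s m‖)
    (hs : 1 < s.re) : Summable fun m : MS ∅ => ‖f m‖ :=
  (MS_nz_summable hs).of_nonneg_of_le (fun _ => norm_nonneg _) fun m => hf m m.2.1

lemma PP.nz_lt {p : GaussianInt} (hp : PP p) {s : ℂ} (hs : 0 < s.re) : ‖nz s p‖ < 1 := by
  rw [nz_norm s hp.1.ne_zero]
  refine Real.rpow_lt_one_of_one_lt_of_neg ?_ (by linarith)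
  have := IsPrimary.five_le_Nm hp.2 (fun h => hp.1.not_isUnit (h ▸ isUnit_one))
  linarith

/-- odd zeta function -/
def ZZ (s : ℂ) : ℂ := ∑' m : MS ∅, nz s m

lemma geom_peel {f : GaussianInt → ℂ} (hf : Summable fun m : MS ∅ => ‖f m‖) (h1 : f 1 = 1)
    (hmul : ∀ m n, IsPrimary m → IsPrimary n → f (m * n) = f m * f n)
    (S : Finset GaussianInt) (hS : ∀ p ∈ S, PP p) (hlt : ∀ p ∈ S, ‖f p‖ < 1) :
    (∏ p ∈ S, (1 - f p)) * ∑' m : MS ∅, f m = ∑' m : MS S, f m := by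
  have hpow : ∀ p ∈ S, ∀ k : ℕ, f (p ^ k) = f p ^ k := by
    intro p hp k
    induction k with
    | zero => simp [h1]
    | succ k ih => rw [pow_succ, pow_succ, hmul _ _ ((hS p hp).2.pow k) (hS p hp).2, ih]
  rw [peel_prod hf (fun m n hm hn _ => hmul m n hm hn) S hS, ← mul_assoc, ← Finset.prod_mul_distrib]
  rw [Finset.prod_eq_one, one_mul]
  intro p hp
  rw [tsum_congr (hpow p hp), tsum_geometric_of_norm_lt_one (hlt p hp)]
  refine mul_inv_cancel₀ ?_
  intro h0
  have : f p = 1 := by linear_combination -h0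
  have h2 := hlt p hp
  rw [this] at h2; simp at h2

lemma nz_real (σ : ℝ) (m : GaussianInt) : nz σ m = ((Nm m ^ (-σ) : ℝ) : ℂ) := by
  rw [nz, Complex.ofReal_cpow (Nm_nonneg m)]; simp

lemma ZZ_real (σ : ℝ) : ZZ σ = ((∑' m : MS ∅, Nm m.1 ^ (-σ) : ℝ) : ℂ) := by
  rw [ZZ, Complex.ofReal_tsum]
  exact tsum_congr fun m => nz_real σ m

lemma ZZ_norm_le {s : ℂ} (hs : 1 < s.re) : ∑' m : MS ∅, Nm m.1 ^ (-s.re) ≤ Zsum s.re := by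
  rw [Zsum]
  exact Summable.tsum_subtype_le (fun n => Nm n ^ (-s.re)) (MS ∅) (fun n => Real.rpow_nonneg (Nm_nonneg n) _) (summable_Nm hs)

lemma ZZ_tail {s : ℂ} (hs : 1 < s.re) {ε : ℝ} (hε : 0 < ε) :
    ∃ S : Finset GaussianInt, (∀ p ∈ S, PP p) ∧ ‖(∑' m : MS S, nz s m) - 1‖ < ε := by
  have hsum : Summable fun n : GaussianInt => nz s n := by
    refine Summable.of_norm ((summable_Nm hs).congr fun n => ?_)
    by_cases h : n = 0
    · rw [h]
      have h0 : Nm 0 = 0 := by simp [Nm]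
      have : (-s) ≠ 0 := by intro h; rw [neg_eq_zero.mp h] at hs; simp at hs; linarith
      rw [nz, h0, Real.zero_rpow (by linarith)]; simp [Complex.zero_cpow this]
    · rw [nz_norm s h]
  obtain ⟨F, hF⟩ := hsum.tsum_vanishing (Metric.ball_mem_nhds (0:ℂ) hε)
  have hex : ∀ m : GaussianInt, ∃ p, IsPrimary m → m ≠ 1 → PP p ∧ p ∣ m := by
    intro m
    by_cases h : IsPrimary m ∧ m ≠ 1
    · obtain ⟨p, hp⟩ := exists_primary_prime_dvd h.1 h.2
      exact ⟨p, fun _ _ => ⟨⟨hp.1, hp.2.1⟩, hp.2.2⟩⟩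
    · exact ⟨1, fun h1 h2 => absurd ⟨h1, h2⟩ h⟩
  choose P hP using hex
  let S := (F.filter (fun m => IsPrimary m ∧ m ≠ 1)).image P
  have hS : ∀ p ∈ S, PP p := by
    intro p hp
    obtain ⟨m, hm, rfl⟩ := Finset.mem_image.mp hp
    exact (hP m (Finset.mem_filter.mp hm).2.1 (Finset.mem_filter.mp hm).2.2).1
  refine ⟨S, hS, ?_⟩
  have hdis : Disjoint (MS S \ {1}) (F : Set GaussianInt) := by
    rw [Set.disjoint_left]
    rintro m ⟨hm, hm1⟩ hmF
    have := hP m hm.1 hm1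
    exact hm.2 (P m) (Finset.mem_image.mpr ⟨m, Finset.mem_filter.mpr ⟨hmF, hm.1, hm1⟩, rfl⟩) this.2
  have h := hF _ hdis
  rw [mem_ball_zero_iff] at h
  have h3 : (∑' m : MS S, nz s m) = 1 + ∑' m : (MS S \ {1} : Set GaussianInt), nz s m := by
    rw [_root_.tsum_subtype, _root_.tsum_subtype, (hsum.indicator (MS S)).tsum_eq_add_tsum_ite 1,
      Set.indicator_of_mem (MS_one hS), nz_one]
    congr 1
    refine tsum_congr fun m => ?_
    by_cases hm : m = 1
    · simp [hm]
    · simp [hm, Set.indicator_apply]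
  rw [h3]; simpa using h

lemma ZZ_lower {s : ℂ} (hs : 1 < s.re) : 1 ≤ ‖ZZ s‖ * Zsum s.re := by
  refine le_of_forall_pos_lt_add fun ε hε => ?_
  obtain ⟨S, hS, hSε⟩ := ZZ_tail hs hε
  have hlt : ∀ p ∈ S, ‖nz s p‖ < 1 := fun p hp => (hS p hp).nz_lt (by linarith)
  have h1 := geom_peel (MS_nz_summable hs) (nz_one s) (fun m n _ _ => nz_mul s m n) S hS hlt
  have hs' : 1 < ((s.re : ℝ) : ℂ).re := by simpa using hs
  have h2 := geom_peel (MS_nz_summable hs') (nz_one _) (fun m n _ _ => nz_mul _ m n) S hS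
    (fun p hp => (hS p hp).nz_lt (by linarith))
  change _ * ZZ s = _ at h1
  change _ * ZZ _ = _ at h2
  have h4 : ∑' m : MS S, nz (s.re : ℂ) m = ((∑' m : MS S, Nm m.1 ^ (-s.re) : ℝ) : ℂ) := by
    rw [Complex.ofReal_tsum]
    exact tsum_congr fun m => nz_real _ m
  have h5 : 1 ≤ ∑' m : MS S, Nm m.1 ^ (-s.re) := by
    have := ((summable_Nm hs).subtype (MS S)).le_tsum (⟨1, MS_one hS⟩ : MS S)
      (fun m _ => Real.rpow_nonneg (Nm_nonneg m.1) _)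
    refine le_trans (le_of_eq ?_) this
    simp [Nm_one]
  rw [h4, ZZ_real] at h2
  have h6 : ∏ p ∈ S, (1 - nz (s.re : ℂ) p) = ((∏ p ∈ S, (1 - Nm p ^ (-s.re)) : ℝ) : ℂ) := by
    push_cast; exact Finset.prod_congr rfl fun p _ => by rw [nz_real]
  rw [h6] at h2
  have h7 : (∏ p ∈ S, (1 - Nm p ^ (-s.re))) * ∑' m : MS ∅, Nm m.1 ^ (-s.re) =
    ∑' m : MS S, Nm m.1 ^ (-s.re) := by exact_mod_cast h2
  have hx : ∀ p ∈ S, 0 < Nm p ^ (-s.re) ∧ Nm p ^ (-s.re) < 1 := fun p hp => by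
    have := hlt p hp
    rw [nz_norm s (hS p hp).1.ne_zero] at this
    exact ⟨Real.rpow_pos_of_pos (Nm_pos (hS p hp).1.ne_zero) _, this⟩
  set A := ∏ p ∈ S, (1 - Nm p ^ (-s.re)) with hA
  have hA0 : 0 < A := Finset.prod_pos fun p hp => by linarith [(hx p hp).2]
  set B := ‖∏ p ∈ S, (1 - nz s p)‖ with hB
  have hAB : A * B ≤ 1 := by
    rw [hA, hB, norm_prod, ← Finset.prod_mul_distrib]
    refine Finset.prod_le_one (fun p hp => mul_nonneg (by linarith [(hx p hp).2]) (norm_nonneg _)) fun p hp => ?_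
    have h8 : ‖1 - nz s p‖ ≤ 1 + Nm p ^ (-s.re) := by
      refine (norm_sub_le _ _).trans ?_
      rw [nz_norm s (hS p hp).1.ne_zero]; simp
    have := hx p hp
    nlinarith
  have hT : B * ‖ZZ s‖ = ‖∑' m : MS S, nz s m‖ := by rw [hB, ← norm_mul, h1]
  have hT1 : 1 - ε < ‖∑' m : MS S, nz s m‖ := by
    have := norm_sub_norm_le (1:ℂ) (1 - ∑' m : MS S, nz s m)
    rw [norm_one, sub_sub_cancel, norm_sub_rev] at this
    linarith
  have hZ := ZZ_norm_le hs
  set Z := ∑' m : MS ∅, Nm m.1 ^ (-s.re)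
  have hZ0 : 0 ≤ Z := tsum_nonneg fun m => Real.rpow_nonneg (Nm_nonneg _) _
  have h9 : 1 ≤ A * Z := by rw [h7]; exact h5
  have h10 : ‖∑' m : MS S, nz s m‖ ≤ ‖ZZ s‖ * Zsum s.re := by
    rw [← hT]
    calc B * ‖ZZ s‖ ≤ (B * ‖ZZ s‖) * (A * Z) := le_mul_of_one_le_right (by positivity) h9
      _ = (A * B) * (‖ZZ s‖ * Z) := by ring
      _ ≤ 1 * (‖ZZ s‖ * Z) := mul_le_mul_of_nonneg_right hAB (by positivity)
      _ ≤ _ := by rw [one_mul]; exact mul_le_mul_of_nonneg_left hZ (norm_nonneg _)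
  linarith

lemma finite_Nm_lt (X : ℝ) : {n : GaussianInt | Nm n < X}.Finite := by
  have h := (summable_Nm (σ := 2) (by norm_num)).tendsto_cofinite_zero
  have hX : (0:ℝ) < (max X 1) ^ (-2 : ℝ) := Real.rpow_pos_of_pos (by positivity) _
  have h2 := h.eventually (gt_mem_nhds hX)
  rw [Filter.eventually_cofinite] at h2
  refine (h2.insert 0).subset fun n hn => ?_
  by_cases h0 : n = 0
  · exact Or.inl h0
  · right
    simp only [Set.mem_ofPred_eq, not_lt] at hn ⊢
    exact Real.rpow_le_rpow_of_nonpos (Nm_pos h0) (hn.le.trans (le_max_left _ _)) (by norm_num)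

lemma prod_PP_dvd {S : Finset GaussianInt} {q : GaussianInt} (h : ∀ p ∈ S, PP p ∧ p ∣ q) : ∏ p ∈ S, p ∣ q := by
  refine Finset.prod_dvd_of_coprime ?_ (fun p hp => (h p hp).2)
  intro p hp r hr hne
  exact (h p hp).1.coprime fun hd => hne ((h p hp).1.eq_of_dvd (h r hr).1 hd)

lemma omega_bound {A η : ℝ} (hA : 1 ≤ A) (hη : 0 < η) : ∃ C : ℝ, 0 < C ∧ ∀ (q : GaussianInt) (S : Finset GaussianInt),
    q ≠ 0 → (∀ p ∈ S, PP p ∧ p ∣ q) → A ^ S.card ≤ C * Nm q ^ η := by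
  let F := (finite_Nm_lt (A ^ (1 / η))).toFinset
  refine ⟨A ^ F.card, by positivity, fun q S hq hS => ?_⟩
  have h1 : ∀ p ∈ S, A ≤ (if p ∈ F then A else 1) * Nm p ^ η := by
    intro p hp
    have hN : 1 ≤ Nm p := one_le_Nm (hS p hp).1.1.ne_zero
    have hN' : 1 ≤ Nm p ^ η := Real.one_le_rpow hN hη.le
    split_ifs with h
    · nlinarith
    · have h' : A ^ (1 / η) ≤ Nm p := by simpa [F] using h
      have := Real.rpow_le_rpow (by positivity) h' hη.le
      rw [← Real.rpow_mul (by linarith), one_div_mul_cancel hη.ne', Real.rpow_one] at this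
      linarith
  have h2 : A ^ S.card ≤ ∏ p ∈ S, ((if p ∈ F then A else 1) * Nm p ^ η) := by
    rw [← Finset.prod_const]
    exact Finset.prod_le_prod (fun _ _ => by linarith) h1
  refine h2.trans ?_
  rw [Finset.prod_mul_distrib]
  refine mul_le_mul ?_ ?_ (Finset.prod_nonneg fun p _ => Real.rpow_nonneg (Nm_nonneg _) _) (by positivity)
  · rw [← Finset.prod_filter, Finset.prod_const]
    refine pow_le_pow_right₀ hA (Finset.card_le_card fun p hp => (Finset.mem_filter.mp hp).2)
  · rw [Real.finsetProd_rpow _ _ (fun p _ => Nm_nonneg p)]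
    refine Real.rpow_le_rpow (Finset.prod_nonneg fun p _ => Nm_nonneg p) ?_ hη.le
    have h3 : ∏ p ∈ S, Nm p = Nm (∏ p ∈ S, p) := by
      induction S using Finset.induction_on with
      | empty => simp [Nm_one]
      | insert a S ha ih =>
        rw [Finset.prod_insert ha, Finset.prod_insert ha, Nm_mul, ih (fun p hp => hS p (Finset.mem_insert_of_mem hp))
          (fun p hp => h1 p (Finset.mem_insert_of_mem hp)) ?_]
        rw [← Finset.prod_const]
        exact Finset.prod_le_prod (fun _ _ => by linarith) (fun p hp => h1 p (Finset.mem_insert_of_mem hp))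
    rw [h3]
    exact Nm_le_of_dvd (prod_PP_dvd hS) hq

lemma finite_PP_dvd {q : GaussianInt} (hq : q ≠ 0) : {p : GaussianInt | PP p ∧ p ∣ q}.Finite := by
  refine (finite_Nm_lt (Nm q + 1)).subset fun p hp => ?_
  have := Nm_le_of_dvd hp.2 hq
  simp only [Set.mem_ofPred_eq]; linarith

end zeta

section coeff
variable {χ : GaussianInt → GaussianInt → ℤ} {g : GaussianInt → GaussianInt → ℂ}

/-- the coefficients of the double Dirichlet series -/
def bb (χ : GaussianInt → GaussianInt → ℤ) (g : GaussianInt → GaussianInt → ℂ) (v q m : GaussianInt) : ℂ :=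
  (χ v m : ℂ) * g q m

lemma bb_mul (hχ : IsQuadSym χ) (hg : IsGaussSum χ g) (v q : GaussianInt) (m n : GaussianInt)
    (hm : IsPrimary m) (hn : IsPrimary n) (hmn : IsCoprime m n) :
    bb χ g v q (m * n) = bb χ g v q m * bb χ g v q n := by
  rw [bb, bb, bb, chi_mul_den hχ v hm hn, gs_mul hχ hg q hm hn hmn]; push_cast; ring

lemma bb_norm (hχ : IsQuadSym χ) (hg : IsGaussSum χ g) (v q : GaussianInt) {m : GaussianInt}
    (hm : IsPrimary m) : ‖bb χ g v q m‖ ≤ Nm m := by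
  rw [bb, norm_mul]
  exact (mul_le_of_le_one_left (norm_nonneg _) (abs_chi_le hχ hm v)).trans (norm_gs_le hχ hg q hm)

lemma bb_one (hχ : IsQuadSym χ) (hg : IsGaussSum χ g) (v q : GaussianInt) : bb χ g v q 1 = 1 := by
  simp [bb, chi_one_den hχ, gs_one hχ hg]

/-- truncation length -/
def KK (q : GaussianInt) : ℕ := (Zsqrtd.norm q).natAbs + 2

lemma PP.five {p : GaussianInt} (hp : PP p) : 5 ≤ Nm p :=
  IsPrimary.five_le_Nm hp.2 (fun h => hp.1.not_isUnit (h ▸ isUnit_one))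

lemma bb_pow_zero (hχ : IsQuadSym χ) (hg : IsGaussSum χ g) (v : GaussianInt) {q : GaussianInt} (hq : q ≠ 0)
    {p : GaussianInt} (hp : PP p) {k : ℕ} (hk : KK q ≤ k) : bb χ g v q (p ^ k) = 0 := by
  rw [bb, mul_eq_zero]; right
  by_contra h
  unfold KK at hk
  obtain ⟨j, rfl⟩ : ∃ j, k = j + 1 := ⟨k - 1, by omega⟩
  have h1 := Nm_le_of_dvd (gs_pow_dvd hχ hg q hp.2 j h) hq
  rw [Nm_pow'] at h1
  have h2 : (5:ℝ) ^ j ≤ Nm p ^ j := pow_le_pow_left₀ (by norm_num) hp.five j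
  have h3 : (j : ℝ) < 5 ^ j := by exact_mod_cast Nat.lt_pow_self (by norm_num)
  have h4 : Nm q ≤ ((Zsqrtd.norm q).natAbs : ℝ) := by
    rw [Nm, Nat.cast_natAbs]; exact_mod_cast le_abs_self _
  have h5 : (((Zsqrtd.norm q).natAbs : ℕ) : ℝ) ≤ j := by exact_mod_cast (by omega)
  linarith

lemma gs_zero_of_sq (hχ : IsQuadSym χ) (hg : IsGaussSum χ g) (q : GaussianInt) {p m : GaussianInt} (hp : PP p)
    (hpq : ¬ p ∣ q) (hm : IsPrimary m) (h : p ^ 2 ∣ m) : g q m = 0 := by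
  obtain ⟨k, n, hn, hkn⟩ := WfDvdMonoid.max_power_factor hm.ne_zero hp.1.irreducible
  have hnp : IsPrimary n := (hp.2.pow k).of_mul (by rw [← hkn]; exact hm)
  have hc : IsCoprime p n := hp.coprime hn
  rw [hkn] at h ⊢
  rw [gs_mul hχ hg q (hp.2.pow k) hnp hc.pow_left]
  have hk : 2 ≤ k := by
    have h1 : p ^ 2 ∣ p ^ k := (hc.pow_left).dvd_of_dvd_mul_right h
    exact (pow_dvd_pow_iff hp.1.ne_zero hp.1.not_isUnit).mp h1
  obtain ⟨j, rfl⟩ : ∃ j, k = (j + 1) + 1 := ⟨k - 2, by omega⟩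
  by_contra hne
  exact hpq ((dvd_pow_self p (Nat.succ_ne_zero j)).trans
    (gs_pow_dvd hχ hg q hp.2 (j + 1) (left_ne_zero_of_mul hne)))

lemma chi_Q1 (hχ : IsQuadSym χ) {Q Q1 t n : GaussianInt} (h : Q = Q1 * t ^ 2) (hn : IsPrimary n)
    (hc : IsCoprime Q n) : χ Q n = χ Q1 n := by
  rw [h] at hc
  have : IsCoprime t n := IsCoprime.of_mul_left_left (by rw [← sq]; exact hc.of_mul_left_right)
  rw [h, chi_mul hχ _ _ hn, chi_sq hχ hn this, mul_one]

lemma bb_sqfree (hχ : IsQuadSym χ) (hg : IsGaussSum χ g) (v q : GaussianInt) (hv : IsUnit v)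
    {Q1 t : GaussianInt} (hQ : v * (ig * q) = Q1 * t ^ 2) (m : GaussianInt) (hm : IsPrimary m) :
    (∀ p, PP p → p ∣ m → ¬ p ∣ q) →
    bb χ g v q m = if Squarefree m then (χ Q1 m : ℂ) * (Real.sqrt (Nm m) : ℂ) else 0 := by
  refine primary_induction (P := fun m => (∀ p, PP p → p ∣ m → ¬ p ∣ q) →
    bb χ g v q m = if Squarefree m then (χ Q1 m : ℂ) * (Real.sqrt (Nm m) : ℂ) else 0) ?_ ?_ m hm
  · intro _
    simp [bb_one hχ hg, chi_one_den hχ, Nm_one]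
  · intro ϖ m hp hpr hm ih h
    have hPP : PP ϖ := ⟨hp, hpr⟩
    have hnq := h ϖ hPP (dvd_mul_right _ _)
    by_cases hd : ϖ ∣ m
    · have hs : ¬ Squarefree (ϖ * m) := fun hs => hp.not_isUnit (hs ϖ (mul_dvd_mul_left _ hd))
      rw [if_neg hs, bb, gs_zero_of_sq hχ hg q hPP hnq (hpr.mul hm) (by rw [sq]; exact mul_dvd_mul_left _ hd),
        mul_zero]
    · have hc := hPP.coprime hd
      rw [bb_mul hχ hg v q ϖ m hpr hm hc, ih (fun p hp' hpm => h p hp' (hpm.mul_left _))]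
      have hQc : IsCoprime (v * (ig * q)) ϖ := by
        rw [isCoprime_mul_unit_left_left hv, isCoprime_mul_unit_left_left isUnit_ig]
        exact (hPP.coprime hnq).symm
      have e1 : bb χ g v q ϖ = (χ Q1 ϖ : ℂ) * (Real.sqrt (Nm ϖ) : ℂ) := by
        rw [bb, gs_prime hχ hg hp hpr, ← mul_assoc, ← Int.cast_mul, ← chi_mul hχ _ _ hpr, chi_Q1 hχ hQ hpr hQc]
      have e2 : Squarefree (ϖ * m) ↔ Squarefree m := by
        rw [squarefree_mul_iff]
        exact ⟨fun h => h.2.2, fun h => ⟨hc.isRelPrime, hp.irreducible.squarefree, h⟩⟩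
      rw [e1]
      by_cases hs : Squarefree m
      · rw [if_pos hs, if_pos (e2.mpr hs), chi_mul_den hχ _ hpr hm, Nm_mul, Real.sqrt_mul (Nm_nonneg _)]
        push_cast; ring
      · rw [if_neg hs, if_neg (fun h => hs (e2.mp h)), mul_zero]

/-- local polynomial -/
def Pf (χ : GaussianInt → GaussianInt → ℤ) (g : GaussianInt → GaussianInt → ℂ) (v q p : GaussianInt) (w : ℂ) : ℂ :=
  ∑ k ∈ Finset.range (KK q), bb χ g v q (p ^ k) * nz w (p ^ k)

lemma Pf_eq (hχ : IsQuadSym χ) (hg : IsGaussSum χ g) (v : GaussianInt) {q : GaussianInt} (hq : q ≠ 0)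
    {p : GaussianInt} (hp : PP p) (w : ℂ) : ∑' k : ℕ, bb χ g v q (p ^ k) * nz w (p ^ k) = Pf χ g v q p w := by
  refine tsum_eq_sum fun k hk => ?_
  rw [bb_pow_zero hχ hg v hq hp (by simpa using hk), zero_mul]

lemma Pf_diff {p : GaussianInt} (hp : PP p) (v q : GaussianInt) : Differentiable ℂ (Pf χ g v q p) := by
  unfold Pf
  refine Differentiable.fun_sum fun k _ => ?_
  exact (nz_diff (pow_ne_zero _ hp.1.ne_zero)).const_mul _

lemma Pf_term (hχ : IsQuadSym χ) (hg : IsGaussSum χ g) (v q : GaussianInt)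
    {p : GaussianInt} (hp : PP p) {w : ℂ} {r : ℝ} (hr : 0 ≤ r) (hw : 1 + r ≤ w.re) (k : ℕ) :
    ‖bb χ g v q (p ^ k) * nz w (p ^ k)‖ ≤ ((5:ℝ) ^ (-r)) ^ k := by
  have h0 := (hp.2.pow k).ne_zero
  have hN := Nm_pos h0
  rw [norm_mul, nz_norm w h0]
  refine (mul_le_mul_of_nonneg_right (bb_norm hχ hg v q (hp.2.pow k)) (by positivity)).trans ?_
  have e : Nm (p ^ k) * Nm (p ^ k) ^ (-w.re) = Nm (p ^ k) ^ (1 - w.re) := by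
    rw [sub_eq_add_neg, Real.rpow_add hN, Real.rpow_one]
  rw [e]
  have h1 : 1 ≤ Nm (p ^ k) := one_le_Nm h0
  refine (Real.rpow_le_rpow_of_exponent_le h1 (show 1 - w.re ≤ -r by linarith)).trans ?_
  rw [Nm_pow', ← Real.rpow_natCast, ← Real.rpow_mul (Nm_nonneg _), mul_comm, Real.rpow_mul (Nm_nonneg _),
    Real.rpow_natCast]
  refine pow_le_pow_left₀ (by have := Nm_nonneg p; positivity) ?_ _
  exact Real.rpow_le_rpow_of_nonpos (by norm_num) hp.five (by linarith)

lemma Pf_bound (hχ : IsQuadSym χ) (hg : IsGaussSum χ g) (v q : GaussianInt)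
    {p : GaussianInt} (hp : PP p) {w : ℂ} {r : ℝ} (hr : 0 < r) (hw : 1 + r ≤ w.re) :
    ‖Pf χ g v q p w‖ ≤ (1 - (5:ℝ) ^ (-r))⁻¹ := by
  have hlt : (5:ℝ) ^ (-r) < 1 := Real.rpow_lt_one_of_one_lt_of_neg (by norm_num) (by linarith)
  have h0 : (0:ℝ) ≤ 5 ^ (-r) := by positivity
  rw [← tsum_geometric_of_lt_one h0 hlt]
  refine (norm_sum_le _ _).trans ((Finset.sum_le_sum fun k _ => Pf_term hχ hg v q hp hr.le hw k).trans ?_)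
  exact (summable_geometric_of_lt_one h0 hlt).sum_le_tsum _ (fun _ _ => by positivity)

lemma Pf_ne (hχ : IsQuadSym χ) (hg : IsGaussSum χ g) (v q : GaussianInt)
    {p : GaussianInt} (hp : PP p) : Pf χ g v q p (3/2) ≠ 0 := by
  have hre : 1 + (1/2 : ℝ) ≤ ((3:ℂ)/2).re := by
    rw [show ((3:ℂ)/2) = ((3/2 : ℝ) : ℂ) by push_cast; ring, Complex.ofReal_re]; norm_num
  set x : ℝ := (5:ℝ) ^ (-(1/2) : ℝ) with hx
  have hx0 : 0 < x := by positivity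
  have hx2 : x * x = 1/5 := by
    rw [hx, ← Real.rpow_add (by norm_num)]; norm_num
  have hxl : x < 0.45 := by nlinarith
  intro h
  rw [Pf, KK, Finset.sum_range_succ'] at h
  simp only [pow_zero, bb_one hχ hg, nz_one, mul_one] at h
  have h1 : ‖∑ k ∈ Finset.range ((Zsqrtd.norm q).natAbs + 1), bb χ g v q (p ^ (k+1)) * nz (3/2) (p ^ (k+1))‖ ≤
      x * (1 - x)⁻¹ := by
    refine (norm_sum_le _ _).trans ((Finset.sum_le_sum fun k _ => Pf_term hχ hg v q hp (by norm_num) hre (k+1)).trans ?_)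
    rw [← tsum_geometric_of_lt_one hx0.le (by linarith), ← hx]
    simp only [pow_succ']
    rw [← Finset.mul_sum]
    refine mul_le_mul_of_nonneg_left ?_ hx0.le
    exact (summable_geometric_of_lt_one hx0.le (by linarith)).sum_le_tsum _ (fun _ _ => by positivity)
  rw [eq_neg_of_add_eq_zero_left h, norm_neg, norm_one, ← div_eq_mul_inv, le_div_iff₀ (by linarith)] at h1
  linarith

end coeff

section assemble
variable {χ : GaussianInt → GaussianInt → ℤ} {g : GaussianInt → GaussianInt → ℂ}

/-- primary prime divisors of `q` -/
def Sq (q : GaussianInt) : Finset GaussianInt := if h : q ≠ 0 then (finite_PP_dvd h).toFinset else ∅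

lemma mem_Sq {q : GaussianInt} (hq : q ≠ 0) (p : GaussianInt) : p ∈ Sq q ↔ PP p ∧ p ∣ q := by
  rw [Sq, dif_pos hq]; simp

lemma MS_Sq {q : GaussianInt} (hq : q ≠ 0) {m : GaussianInt} (hm : m ∈ MS (Sq q)) :
    (∀ p, PP p → p ∣ m → ¬ p ∣ q) := fun p hp hpm hpq => hm.2 p ((mem_Sq hq p).mpr ⟨hp, hpq⟩) hpm

lemma primary_coprime {m q : GaussianInt} (hm : IsPrimary m) :
    (∀ p, PP p → p ∣ m → ¬ p ∣ q) → IsCoprime q m := by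
  refine primary_induction (P := fun m => (∀ p, PP p → p ∣ m → ¬ p ∣ q) → IsCoprime q m) ?_ ?_ m hm
  · intro _; exact isCoprime_one_right
  · intro ϖ m hp hpr hm ih h
    refine IsCoprime.mul_right ?_ (ih fun p hp' hd => h p hp' (hd.mul_left _))
    exact (PP.coprime ⟨hp, hpr⟩ (h ϖ ⟨hp, hpr⟩ (dvd_mul_right _ _))).symm

lemma sqrt_nz (w : ℂ) {m : GaussianInt} (hm : m ≠ 0) : (Real.sqrt (Nm m) : ℂ) * nz w m = nz (w - 1/2) m := by
  have h : (Real.sqrt (Nm m) : ℂ) = nz (-(1/2)) m := by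
    rw [nz, Real.sqrt_eq_rpow, Complex.ofReal_cpow (Nm_nonneg m)]; push_cast; simp
  rw [h, ← nz_add _ _ hm]; congr 1; ring

/-- finite product of correction factors -/
def EE (χ : GaussianInt → GaussianInt → ℤ) (g : GaussianInt → GaussianInt → ℂ) (v q R : GaussianInt) (w : ℂ) : ℂ :=
  ∏ p ∈ Sq q, (Pf χ g v q p w * (1 - (χ R p : ℂ) * nz (w - 1/2) p) / (1 - nz (2 * w - 1) p))

lemma one_sub_nz_ne {p : GaussianInt} (hp : PP p) {s : ℂ} (hs : 0 < s.re) : 1 - nz s p ≠ 0 := by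
  intro h
  have h1 := hp.nz_lt hs
  rw [← sub_eq_zero.mp h] at h1; simp at h1

lemma ZZ_ne {s : ℂ} (hs : 1 < s.re) : ZZ s ≠ 0 := by
  intro h
  have := ZZ_lower hs
  rw [h] at this; norm_num at this

lemma D_series (hχ : IsQuadSym χ) (hg : IsGaussSum χ g) {v q : GaussianInt} (hv : IsUnit v) (hq : q ≠ 0)
    {R t : GaussianInt} (hQ : v * (ig * q) = R * t ^ 2) {w : ℂ} (hw : 2 < w.re) :
    ∑' m : MS ∅, bb χ g v q m * nz w m = EE χ g v q R w *
      (∑' m : MS ∅, (χ R m : ℂ) * nz (w - 1/2) m) / ZZ (2 * w - 1) := by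
  have hS : ∀ p ∈ Sq q, PP p := fun p hp => ((mem_Sq hq p).mp hp).1
  have hw1 : 1 < (w - 1).re := by simp; linarith
  have hs1 : 1 < (w - 1/2).re := by
    rw [show ((1:ℂ)/2) = ((1/2 : ℝ) : ℂ) by push_cast; ring, Complex.sub_re, Complex.ofReal_re]; linarith
  have hs2 : 1 < (2 * w - 1).re := by simp; linarith
  -- peel the b-series
  have hbs : Summable fun m : MS ∅ => ‖bb χ g v q m * nz w m‖ := by
    refine MS_bdd_summable (s := w - 1) (f := fun m => bb χ g v q m * nz w m) (fun m hm => ?_) hw1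
    rw [norm_mul, nz_norm _ hm.ne_zero, nz_norm _ hm.ne_zero]
    refine (mul_le_mul_of_nonneg_right (bb_norm hχ hg v q hm) (Real.rpow_nonneg (Nm_nonneg _) _)).trans ?_
    rw [show -(w - 1).re = 1 + -w.re by simp; ring, Real.rpow_add (Nm_pos hm.ne_zero), Real.rpow_one]
  have h1 := peel_prod (f := fun m => bb χ g v q m * nz w m) hbs (fun m n hm hn hmn => by
    rw [bb_mul hχ hg v q m n hm hn hmn, nz_mul]; ring) (Sq q) hS
  rw [h1]
  have h2 : (∏ p ∈ Sq q, ∑' k : ℕ, bb χ g v q (p ^ k) * nz w (p ^ k)) = ∏ p ∈ Sq q, Pf χ g v q p w :=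
    Finset.prod_congr rfl fun p hp => Pf_eq hχ hg v hq (hS p hp) w
  rw [h2]
  -- the character series
  set h : GaussianInt → ℂ := fun m => (χ R m : ℂ) * nz (w - 1/2) m with hh
  have hle : ∀ m, IsPrimary m → ‖h m‖ ≤ ‖nz (w - 1/2) m‖ := fun m hm => by
    rw [hh]; simp only [norm_mul]
    exact mul_le_of_le_one_left (norm_nonneg _) (abs_chi_le hχ hm R)
  have hhs : Summable fun m : MS ∅ => ‖h m‖ := MS_bdd_summable hle hs1
  have hnz2 : ∀ m, m ≠ 0 → nz (w - 1/2) m * nz (w - 1/2) m = nz (2 * w - 1) m := fun m hm => by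
    rw [← nz_add _ _ hm]; congr 1; ring
  have hhs2 : Summable fun m : MS ∅ => ‖h (m.1 ^ 2)‖ := by
    refine MS_bdd_summable (s := 2 * w - 1) (f := fun m => h (m ^ 2)) (fun m hm => ?_) hs2
    refine (hle _ (hm.pow 2)).trans (le_of_eq ?_)
    rw [nz_pow, sq, hnz2 m hm.ne_zero]
  have hmul : ∀ m n, IsPrimary m → IsPrimary n → h (m * n) = h m * h n := fun m n hm hn => by
    simp only [hh]; rw [chi_mul_den hχ R hm hn, nz_mul]; push_cast; ring
  have hlt : ∀ p ∈ Sq q, ‖h p‖ < 1 := fun p hp =>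
    (hle p (hS p hp).2).trans_lt ((hS p hp).nz_lt (by linarith))
  have h3 := geom_peel hhs (by simp [hh, chi_one_den hχ, nz_one]) hmul (Sq q) hS hlt
  have h4 := sq_split hhs hhs2 hmul hS
  have h5 := geom_peel (MS_nz_summable hs2) (nz_one _) (fun m n _ _ => nz_mul _ m n) (Sq q) hS
    (fun p hp => (hS p hp).nz_lt (by linarith))
  change _ * ZZ _ = _ at h5
  have hcop : ∀ m ∈ MS (Sq q), IsCoprime (v * (ig * q)) m := fun m hm => by
    rw [isCoprime_mul_unit_left_left hv, isCoprime_mul_unit_left_left isUnit_ig]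
    exact primary_coprime hm.1 (MS_Sq hq hm)
  have h6 : ∑' m : MS (Sq q), h (m.1 ^ 2) = ∑' m : MS (Sq q), nz (2 * w - 1) m := by
    refine tsum_congr fun m => ?_
    have hc := hcop m.1 m.2
    rw [hQ] at hc
    simp only [hh]
    rw [chi_pow_den hχ R m.2.1, nz_pow, sq (nz _ _), hnz2 _ m.2.1.ne_zero]
    rcases chi_of_coprime hχ m.2.1 hc.of_mul_left_left with h | h <;> simp [h]
  have h7 : ∑' m : MS (Sq q), bb χ g v q m * nz w m = ∑' m : MS (Sq q), if Squarefree m.1 then h m else 0 := by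
    refine tsum_congr fun m => ?_
    rw [bb_sqfree hχ hg v q hv hQ m.1 m.2.1 (MS_Sq hq m.2)]
    split_ifs
    · rw [hh]; simp only; rw [mul_assoc, sqrt_nz w m.2.1.ne_zero]
    · simp
  rw [h7]
  rw [h6, ← h5, ← h3] at h4
  have hZ := ZZ_ne hs2
  have hP : ∏ p ∈ Sq q, (1 - nz (2 * w - 1) p) ≠ 0 :=
    Finset.prod_ne_zero_iff.mpr fun p hp => one_sub_nz_ne (hS p hp) (by linarith)
  have hEE : EE χ g v q R w = (∏ p ∈ Sq q, Pf χ g v q p w) * (∏ p ∈ Sq q, (1 - h p)) /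
      ∏ p ∈ Sq q, (1 - nz (2 * w - 1) p) := by
    rw [EE, Finset.prod_div_distrib, Finset.prod_mul_distrib]
  rw [hEE]
  revert h4
  generalize (∑' m : MS (Sq q), if Squarefree m.1 then h m else 0) = U
  generalize (∑' m : MS ∅, h m) = L
  generalize (∏ p ∈ Sq q, (1 - h p)) = A
  revert hP hZ
  generalize (∏ p ∈ Sq q, (1 - nz (2 * w - 1) p)) = B
  generalize ZZ (2 * w - 1) = Z
  intro hZ hP h4
  rw [eq_div_iff hZ, div_mul_eq_mul_div, eq_div_iff hP]
  linear_combination (- ∏ p ∈ Sq q, Pf χ g v q p w) * h4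

lemma EE_diff {v q R : GaussianInt} (hq : q ≠ 0) {w : ℂ} (hw : 1 < w.re) :
    DifferentiableAt ℂ (EE χ g v q R) w := by
  unfold EE
  refine DifferentiableAt.fun_finsetProd fun p hp => ?_
  have hS := ((mem_Sq hq p).mp hp).1
  have hs2 : 0 < (2 * w - 1).re := by simp; linarith
  refine DifferentiableAt.div (DifferentiableAt.mul (Pf_diff hS v q w) ?_) ?_ (one_sub_nz_ne hS hs2)
  · refine (differentiableAt_const _).sub (DifferentiableAt.const_mul ?_ _)
    exact ((nz_diff hS.1.ne_zero) _).comp w (differentiableAt_id.sub_const _)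
  · refine (differentiableAt_const _).sub ?_
    exact ((nz_diff hS.1.ne_zero) _).comp w (f := fun w => 2 * w - 1) (by fun_prop)

lemma one_sub_lower {p : GaussianInt} (hp : PP p) {s : ℂ} (hs : 1 ≤ s.re) : 1/2 ≤ ‖1 - nz s p‖ := by
  have h1 : ‖nz s p‖ ≤ 1/5 := by
    rw [nz_norm s hp.1.ne_zero]
    refine (Real.rpow_le_rpow_of_exponent_le (by linarith [hp.five]) (show -s.re ≤ -1 by linarith)).trans ?_
    rw [Real.rpow_neg_one, one_div]
    exact inv_anti₀ (by norm_num) hp.five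
  have := norm_sub_norm_le (1:ℂ) (nz s p)
  rw [norm_one] at this; linarith

lemma one_sub_upper (hχ : IsQuadSym χ) (R : GaussianInt) {p : GaussianInt} (hp : PP p) {s : ℂ} (hs : 0 < s.re) :
    ‖1 - (χ R p : ℂ) * nz s p‖ ≤ 2 := by
  refine (norm_sub_le _ _).trans ?_
  rw [norm_one, norm_mul]
  have h1 := hp.nz_lt hs
  have h2 := abs_chi_le hχ hp.2 R
  have := mul_le_one₀ h2 (norm_nonneg _) h1.le
  linarith

lemma half_re (w : ℂ) : (w - 1/2).re = w.re - 1/2 := by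
  rw [show ((1:ℂ)/2) = ((1/2 : ℝ) : ℂ) by push_cast; ring, Complex.sub_re, Complex.ofReal_re]

lemma EE_bound (hχ : IsQuadSym χ) (hg : IsGaussSum χ g) {r η : ℝ} (hr : 0 < r) (hη : 0 < η) : ∃ C : ℝ, 0 < C ∧
    ∀ (v q R : GaussianInt) (w : ℂ), q ≠ 0 → 1 + r < w.re → ‖EE χ g v q R w‖ ≤ C * Nm q ^ η := by
  set B := (1 - (5:ℝ) ^ (-r))⁻¹ with hB
  have hlt : (5:ℝ) ^ (-r) < 1 := Real.rpow_lt_one_of_one_lt_of_neg (by norm_num) (by linarith)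
  have h0 : (0:ℝ) < 5 ^ (-r) := by positivity
  have hB1 : 1 ≤ B := (one_le_inv₀ (by linarith)).mpr (by linarith)
  obtain ⟨C, hC, h⟩ := omega_bound (A := B * 2 * 2) (by linarith) hη
  refine ⟨C, hC, fun v q R w hq hw => ?_⟩
  refine le_trans ?_ (h q (Sq q) hq (fun p hp => (mem_Sq hq p).mp hp))
  rw [EE, norm_prod, ← Finset.prod_const]
  refine Finset.prod_le_prod (fun _ _ => norm_nonneg _) fun p hp => ?_
  have hS := ((mem_Sq hq p).mp hp).1
  rw [norm_div, norm_mul]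
  have hl := one_sub_lower hS (s := 2 * w - 1) (by simp; linarith)
  rw [div_le_iff₀ (by linarith)]
  have h1 := Pf_bound hχ hg v q hS hr hw.le
  have h2 := one_sub_upper hχ R hS (s := w - 1/2) (by rw [half_re]; linarith)
  have h3 := mul_le_mul h1 h2 (norm_nonneg _) (by linarith)
  refine h3.trans ?_
  nlinarith

lemma EE_ne (hχ : IsQuadSym χ) (hg : IsGaussSum χ g) {v q R : GaussianInt} (hq : q ≠ 0) :
    EE χ g v q R (3/2) ≠ 0 := by
  rw [EE, Finset.prod_ne_zero_iff]
  intro p hp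
  have hS := ((mem_Sq hq p).mp hp).1
  refine div_ne_zero (mul_ne_zero (Pf_ne hχ hg v q hS) ?_) (one_sub_nz_ne hS (by norm_num))
  intro h
  have h1 : (χ R p : ℂ) * nz (3/2 - 1/2) p = 1 := (sub_eq_zero.mp h).symm
  have h2 : ‖(χ R p : ℂ) * nz (3/2 - 1/2) p‖ < 1 := by
    rw [norm_mul]
    exact (mul_le_of_le_one_left (norm_nonneg _) (abs_chi_le hχ hS.2 R)).trans_lt (hS.nz_lt (by norm_num))
  rw [h1] at h2; simp at h2

end assemble

section final
variable {χ : GaussianInt → GaussianInt → ℤ} {g : GaussianInt → GaussianInt → ℂ}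

lemma mem_MS_empty (m : GaussianInt) : m ∈ MS ∅ ↔ IsPrimary m := by
  constructor
  · intro h; exact h.1
  · intro h; exact ⟨h, by simp⟩

lemma hasSum_MS {f : GaussianInt → ℂ} {s a : ℂ}
    (h : HasSum (fun n : GaussianInt => (if IsPrimary n then f n else 0) / (Nm n : ℂ) ^ s) a) :
    ∑' m : MS ∅, f m * nz s m = a := by
  rw [← h.tsum_eq, tsum_subtype (MS ∅) (fun m => f m * nz s m)]
  refine tsum_congr fun n => ?_
  rw [nz_eq]
  by_cases hn : IsPrimary n
  · rw [Set.indicator_of_mem ((mem_MS_empty n).mpr hn), if_pos hn]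
  · rw [Set.indicator_of_notMem (fun h => hn ((mem_MS_empty n).mp h)), if_neg hn, zero_mul]

lemma tsum_primary (f : GaussianInt → ℂ) :
    ∑' m : {m : GaussianInt // IsPrimary m}, f m.1 = ∑' m : MS ∅, f m.1 :=
  (Equiv.tsum_eq (Equiv.subtypeEquivRight fun m => (mem_MS_empty m).symm) (fun m : MS ∅ => f m.1))

lemma Nm_unit_mul {v q : GaussianInt} (hv : IsUnit v) : Nm (v * (ig * q)) = Nm q := by
  have h1 : ∀ u : GaussianInt, IsUnit u → Nm u = 1 := by
    intro u hu
    exact le_antisymm (by simpa [Nm_one] using Nm_le_of_dvd hu.dvd (one_ne_zero)) (one_le_Nm hu.ne_zero)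
  rw [Nm_mul, Nm_mul, h1 v hv, h1 ig isUnit_ig]; ring

lemma numeric_bound {A B Z K X N F η δ ε σ T y : ℝ} (hA : 0 < A) (hK : 0 < K) (hF : 1 ≤ F)
    (hδ : 0 < δ) (hδ2 : δ ≤ 1/2) (hδε : δ ≤ ε) (hη : η = ε / 2) (hσ : 1 < σ) (hN : 1 ≤ N)
    (hy : 0 ≤ y) (hyT : y ^ 2 ≤ T ^ 2) (hX : X = (1 + T ^ 2) * N) (hB : 0 ≤ B) (hZ : B ≤ Z) :
    (A * N ^ η) * (F * (K * (N * (1 + y) ^ 2) ^ (max ((1 + δ - (σ - 1/2)) / 2) 0))) * B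
      ≤ (2 * A * F * K * Z) * X ^ (max ((3 / 2 - σ) / 2) 0 + ε) := by
  have hε : 0 < ε := by linarith
  have hT := sq_nonneg T
  have hNX : N ≤ X := by rw [hX]; nlinarith
  have hX1 : 1 ≤ X := hN.trans hNX
  have hX0 : 0 < X := by linarith
  set e := max ((1 + δ - (σ - 1/2)) / 2) 0 with he
  have he0 : 0 ≤ e := le_max_right _ _
  have he1 : e ≤ 1 := max_le (by linarith) (by norm_num)
  have heM : e ≤ max ((3 / 2 - σ) / 2) 0 + ε / 2 := by
    refine max_le ?_ ?_
    · have := le_max_left ((3 / 2 - σ) / 2) 0; linarith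
    · have := le_max_right ((3 / 2 - σ) / 2) 0; linarith
  have h1 : N * (1 + y) ^ 2 ≤ 2 * X := by
    rw [hX]
    have : (1 + y) ^ 2 ≤ 2 * (1 + T ^ 2) := by nlinarith [sq_nonneg (1 - y)]
    nlinarith
  have h2 : (N * (1 + y) ^ 2) ^ e ≤ 2 * X ^ (max ((3 / 2 - σ) / 2) 0 + ε / 2) := by
    calc (N * (1 + y) ^ 2) ^ e ≤ (2 * X) ^ e := Real.rpow_le_rpow (by positivity) h1 he0
      _ = 2 ^ e * X ^ e := Real.mul_rpow (by norm_num) hX0.le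
      _ ≤ 2 ^ (1:ℝ) * X ^ (max ((3 / 2 - σ) / 2) 0 + ε / 2) := by
          gcongr
          norm_num
      _ = _ := by rw [Real.rpow_one]
  have h3 : N ^ η ≤ X ^ (ε / 2) := by
    rw [hη]; exact Real.rpow_le_rpow (by linarith) hNX (by linarith)
  have h4 : X ^ (max ((3 / 2 - σ) / 2) 0 + ε) = X ^ (max ((3 / 2 - σ) / 2) 0 + ε / 2) * X ^ (ε / 2) := by
    rw [← Real.rpow_add hX0]; congr 1; ring
  have hF0 : 0 ≤ F := by linarith
  rw [h4]
  calc (A * N ^ η) * (F * (K * (N * (1 + y) ^ 2) ^ e)) * B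
      ≤ (A * X ^ (ε / 2)) * (F * (K * (2 * X ^ (max ((3 / 2 - σ) / 2) 0 + ε / 2)))) * Z := by
        gcongr
    _ = _ := by ring

lemma D_main (hχ : IsQuadSym χ) (hg : IsGaussSum χ g) {v : GaussianInt} (hv : IsUnit v) :
    ∃ D : GaussianInt → ℂ → ℂ,
      (∀ q : GaussianInt, q ≠ 0 →
        (∀ w : ℂ, 2 < w.re → D q w = ∑' m : {m : GaussianInt // IsPrimary m},
            (χ v m.1 : ℂ) * g q m.1 / (Nm m.1 : ℂ) ^ w) ∧
        DifferentiableOn ℂ (D q) {w : ℂ | 1 < w.re ∧ w ≠ 3 / 2} ∧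
        (¬ (∃ r : GaussianInt, v * (ig * q) = r ^ 2) →
          DifferentiableOn ℂ (D q) {w : ℂ | 1 < w.re}) ∧
        ((∃ r : GaussianInt, v * (ig * q) = r ^ 2) → ∃ c : ℂ, c ≠ 0 ∧
          Tendsto (fun w => (w - 3 / 2) * D q w) (𝓝[≠] ((3 : ℂ) / 2)) (𝓝 c))) ∧
      ∀ ε : ℝ, 0 < ε → ∃ C : ℝ, 0 < C ∧ ∀ (q : GaussianInt) (w : ℂ), q ≠ 0 →
        1 + ε < w.re →
        ((∃ r : GaussianInt, v * (ig * q) = r ^ 2) → ε ≤ ‖w - 3 / 2‖) →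
        ‖D q w‖ ≤ C * ((1 + ‖w‖ ^ 2) * Nm q) ^ (max ((3 / 2 - w.re) / 2) 0 + ε) := by
  obtain ⟨Q1, L, hL, hLb⟩ := L_pack hχ hg
  have hQ0 : ∀ q : GaussianInt, q ≠ 0 → v * (ig * q) ≠ 0 := fun q hq =>
    mul_ne_zero hv.ne_zero (mul_ne_zero isUnit_ig.ne_zero hq)
  have hL1 : ∀ z : ℂ, 1 < z.re → L 1 z = ZZ z := by
    intro z hz
    obtain ⟨⟨t, ht⟩, hs, -⟩ := hL 1 one_ne_zero
    rw [← hasSum_MS (hs z hz), ZZ]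
    refine tsum_congr fun m => ?_
    have hm : IsPrimary m.1 := m.2.1
    rw [← chi_Q1 hχ ht hm isCoprime_one_left, chi_one_num hχ hm]; simp
  have hre : ∀ w : ℂ, 1 < w.re → 1 < (2 * w - 1).re := by
    intro w hw; simp; linarith
  have hL1ne : ∀ w : ℂ, 1 < w.re → L 1 (2 * w - 1) ≠ 0 := fun w hw => by
    rw [hL1 _ (hre w hw)]; exact ZZ_ne (hre w hw)
  have hL1d : ∀ w : ℂ, 1 < w.re → DifferentiableAt ℂ (fun w => L 1 (2 * w - 1)) w := by
    intro w hw
    have h1 : (2 * w - 1) ≠ 1 := by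
      intro h; have := hre w hw; rw [h] at this; simp at this
    exact DifferentiableAt.comp w ((hL 1 one_ne_zero).2.2.1 _ h1) (by fun_prop)
  refine ⟨fun q w => EE χ g v q (Q1 (v * (ig * q))) w * L (v * (ig * q)) (w - 1/2) / L 1 (2 * w - 1), ?_, ?_⟩
  · intro q hq
    obtain ⟨⟨t, ht⟩, hs, hd, hd', hr⟩ := hL _ (hQ0 q hq)
    refine ⟨?_, ?_, ?_, ?_⟩
    · intro w hw
      have e1 := tsum_primary (fun m => (χ v m : ℂ) * g q m / (Nm m : ℂ) ^ w)
      have e2 : ∑' m : MS ∅, (χ v m.1 : ℂ) * g q m.1 / (Nm m.1 : ℂ) ^ w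
          = ∑' m : MS ∅, bb χ g v q m * nz w m := tsum_congr fun m => by rw [nz_eq, bb]
      have e3 := D_series hχ hg hv hq ht hw
      rw [hasSum_MS (hs (w - 1/2) (by rw [half_re]; linarith)), ← hL1 _ (hre w (by linarith))] at e3
      exact (e1.trans (e2.trans e3)).symm
    · intro w hw
      have h1 : w - 1/2 ≠ 1 := by
        intro h; apply hw.2; linear_combination h
      have h2 : DifferentiableAt ℂ (fun w => L (v * (ig * q)) (w - 1/2)) w :=
        DifferentiableAt.comp w (hd _ h1) (by fun_prop)
      exact (((EE_diff hq hw.1).mul h2).div (hL1d w hw.1) (hL1ne w hw.1)).differentiableWithinAt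
    · intro hns w hw
      have h2 : DifferentiableAt ℂ (fun w => L (v * (ig * q)) (w - 1/2)) w :=
        DifferentiableAt.comp w (hd' hns _) (by fun_prop)
      exact (((EE_diff hq hw).mul h2).div (hL1d w hw) (hL1ne w hw)).differentiableWithinAt
    · intro hsq
      obtain ⟨c, hc, ht⟩ := hr hsq
      have h32 : 1 < ((3:ℂ)/2).re := by norm_num
      refine ⟨EE χ g v q (Q1 (v * (ig * q))) (3/2) * c / L 1 (2 * (3/2) - 1),
        div_ne_zero (mul_ne_zero (EE_ne hχ hg hq) hc) (hL1ne _ h32), ?_⟩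
      have hmap : Tendsto (fun w : ℂ => w - 1/2) (𝓝[≠] ((3:ℂ)/2)) (𝓝[≠] 1) := by
        refine tendsto_nhdsWithin_iff.mpr ⟨?_, ?_⟩
        · have : ContinuousAt (fun w : ℂ => w - 1/2) (3/2) := by fun_prop
          have h := this.tendsto
          norm_num at h
          exact Tendsto.mono_left (by norm_num; exact h) nhdsWithin_le_nhds
        · filter_upwards [self_mem_nhdsWithin] with w hw h
          apply hw
          have h' : w - 1/2 = 1 := h
          show w = 3/2
          linear_combination h'
      have k1 := ht.comp hmap
      have k2 : Tendsto (EE χ g v q (Q1 (v * (ig * q)))) (𝓝[≠] ((3:ℂ)/2))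
          (𝓝 (EE χ g v q (Q1 (v * (ig * q))) (3/2))) :=
        (EE_diff hq h32).continuousAt.tendsto.mono_left nhdsWithin_le_nhds
      have k3 : Tendsto (fun w => L 1 (2 * w - 1)) (𝓝[≠] ((3:ℂ)/2)) (𝓝 (L 1 (2 * (3/2) - 1))) :=
        (hL1d _ h32).continuousAt.tendsto.mono_left nhdsWithin_le_nhds
      refine ((k2.mul k1).div k3 (hL1ne _ h32)).congr fun w => ?_
      simp only [Function.comp, Pi.div_apply, Pi.mul_apply]
      ring
  · intro ε hε
    set δ := min ε (1/2) with hδ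
    have hδ0 : 0 < δ := lt_min hε (by norm_num)
    have hδ2 : δ ≤ 1/2 := min_le_right _ _
    have hδε : δ ≤ ε := min_le_left _ _
    obtain ⟨K, hK, hb⟩ := hLb δ hδ0 hδ2
    obtain ⟨A, hA, hE⟩ := EE_bound hχ hg hε (half_pos hε)
    have hZ := Zsum_nonneg (1 + 2 * ε)
    have hF : 1 ≤ 1 + 3 / ε := by have : 0 < 3 / ε := by positivity
                                  linarith
    refine ⟨2 * A * (1 + 3 / ε) * K * (Zsum (1 + 2 * ε) + 1), by positivity, fun q w hq hw hw2 => ?_⟩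
    have hw1 : 1 < w.re := by linarith
    have hB : ‖L 1 (2 * w - 1)‖⁻¹ ≤ Zsum (1 + 2 * ε) + 1 := by
      have h1 := ZZ_lower (hre w hw1)
      rw [← hL1 _ (hre w hw1)] at h1
      have h2 : Zsum (2 * w - 1).re ≤ Zsum (1 + 2 * ε) := Zsum_anti (by linarith) (by simp; linarith)
      have h3 : 0 < ‖L 1 (2 * w - 1)‖ := norm_pos_iff.mpr (hL1ne w hw1)
      rw [inv_le_iff_one_le_mul₀ h3]
      nlinarith
    have hz : ((∃ r, v * (ig * q) = r ^ 2) → w - 1/2 ≠ 1) := by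
      intro h h'
      have := hw2 h
      rw [show w - 3/2 = 0 by linear_combination h', norm_zero] at this
      linarith
    have h1 := hb _ (hQ0 q hq) (w - 1/2) (by rw [half_re]; linarith) hz
    rw [half_re, Nm_unit_mul hv] at h1
    have him : (w - 1/2).im = w.im := by simp
    rw [him] at h1
    have hfac : (if ∃ r, v * (ig * q) = r ^ 2 then 1 + 3 / ‖w - 1/2 - 1‖ else 1) ≤ 1 + 3 / ε := by
      split_ifs with h
      · have := hw2 h
        rw [show w - 1/2 - 1 = w - 3/2 by ring]
        gcongr
      · exact hF
    have hNq := Nm_nonneg q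
    have h2 : ‖L (v * (ig * q)) (w - 1/2)‖ ≤ (1 + 3 / ε) * (K * (Nm q * (1 + |w.im|) ^ 2) ^
        (max ((1 + δ - (w.re - 1/2)) / 2) 0)) := h1.trans (by gcongr)
    have h3 := hE v q (Q1 (v * (ig * q))) w hq hw
    have him2 : |w.im| ^ 2 ≤ ‖w‖ ^ 2 := pow_le_pow_left₀ (abs_nonneg _) (Complex.abs_im_le_norm w) 2
    have h4 := numeric_bound hA hK hF hδ0 hδ2 hδε rfl hw1 (one_le_Nm hq) (abs_nonneg w.im) him2 rfl
      (inv_nonneg.mpr (norm_nonneg (L 1 (2 * w - 1)))) hB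
    refine le_trans ?_ h4
    show ‖_ / _‖ ≤ _
    rw [norm_div, norm_mul, div_eq_mul_inv]
    gcongr

lemma Dsq_main (hχ : IsQuadSym χ) (hg : IsGaussSum χ g) (q : GaussianInt) (hq : q ≠ 0) :
    ∃ D : ℂ → ℂ, Differentiable ℂ D ∧ ∀ w, D w = ∑' m : {m : GaussianInt // IsPrimary m},
            g q (m.1 ^ 2) / (Nm m.1 : ℂ) ^ (2 * w) := by
  have hfin : {m : {m : GaussianInt // IsPrimary m} | m.1 ∣ q}.Finite := by
    refine Set.Finite.subset ((finite_Nm_lt (Nm q + 1)).preimage (f := Subtype.val)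
      Subtype.val_injective.injOn) fun m hm => ?_
    have : Nm m.1 ≤ Nm q := Nm_le_of_dvd hm hq
    show Nm m.1 < Nm q + 1
    linarith
  refine ⟨fun w => ∑ m ∈ hfin.toFinset, g q (m.1 ^ 2) * nz (2 * w) m.1, ?_, fun w => ?_⟩
  · refine Differentiable.fun_sum fun m _ => ?_
    exact ((nz_diff m.2.ne_zero).comp (by fun_prop : Differentiable ℂ fun w : ℂ => 2 * w)).const_mul _
  · symm
    rw [tsum_eq_sum (s := hfin.toFinset)]
    · exact Finset.sum_congr rfl fun m _ => nz_eq _ _ _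
    · intro m hm
      by_contra h
      apply hm
      rw [Set.Finite.mem_toFinset]
      have h0 : g q (m.1 ^ (1 + 1)) ≠ 0 := fun h' => h (by
        have : g q (m.1 ^ 2) = 0 := h'
        rw [this, zero_div])
      simpa using gs_pow_dvd hχ hg q m.2 1 h0

lemma sq_iff_one (q : GaussianInt) : (∃ r : GaussianInt, 1 * (ig * q) = r ^ 2) ↔ ∃ r : GaussianInt, q = ig * r ^ 2 := by
  have h := ig_sq
  constructor
  · rintro ⟨r, hr⟩; exact ⟨ig * r, by linear_combination (-1 : GaussianInt) * ig * hr + (q - ig * r ^ 2) * h⟩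
  · rintro ⟨r, hr⟩; exact ⟨ig * r, by linear_combination ig * hr⟩

lemma sq_iff_ig (q : GaussianInt) : (∃ r : GaussianInt, ig * (ig * q) = r ^ 2) ↔ ∃ r : GaussianInt, q = r ^ 2 := by
  have h := ig_sq
  constructor
  · rintro ⟨r, hr⟩; exact ⟨ig * r, by linear_combination (-1 : GaussianInt) * hr + (q - r ^ 2) * h⟩
  · rintro ⟨r, hr⟩; exact ⟨ig * r, by linear_combination ig ^ 2 * hr⟩

end final

/-- Lemma 4.1 of the paper: meromorphic continuation of
`D(w,q;χ₁) = ∑_{m primary} g(q,m)/N(m)^w`, `D(w,q;χ_i) = ∑_{m primary} (i/m)g(q,m)/N(m)^w`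
and `D₁(w,q) = ∑_{m primary} g(q,m²)/N(m)^{2w}` to `{Re w > 1}`, holomorphic there except
for a simple pole at `w = 3/2` when `q = i·□` (for `χ₁`), resp. `q = □` (for `χ_i`);
together with the bound `|D(w,q;χ)| ≪ ((1+|w|²)N(q))^{max((3/2−Re w)/2, 0)+ε}` away from
the possible pole. -/
theorem D_function_meromorphic_continuation_first_moment
    (χ : GaussianInt → GaussianInt → ℤ) (hχ : IsQuadSym χ)
    (g : GaussianInt → GaussianInt → ℂ) (hg : IsGaussSum χ g) :
    ∃ D1 Di Dsq : GaussianInt → ℂ → ℂ,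
      (∀ q : GaussianInt, q ≠ 0 →
        (∀ w : ℂ, 2 < w.re →
          (D1 q w = ∑' m : {m : GaussianInt // IsPrimary m}, g q m.1 / (Nm m.1 : ℂ) ^ w) ∧
          (Di q w = ∑' m : {m : GaussianInt // IsPrimary m},
            (χ ig m.1 : ℂ) * g q m.1 / (Nm m.1 : ℂ) ^ w) ∧
          (Dsq q w = ∑' m : {m : GaussianInt // IsPrimary m},
            g q (m.1 ^ 2) / (Nm m.1 : ℂ) ^ (2 * w))) ∧
        DifferentiableOn ℂ (D1 q) {w : ℂ | 1 < w.re ∧ w ≠ 3 / 2} ∧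
        DifferentiableOn ℂ (Di q) {w : ℂ | 1 < w.re ∧ w ≠ 3 / 2} ∧
        DifferentiableOn ℂ (Dsq q) {w : ℂ | 1 < w.re} ∧
        (¬ (∃ r : GaussianInt, q = ig * r ^ 2) →
          DifferentiableOn ℂ (D1 q) {w : ℂ | 1 < w.re}) ∧
        (¬ (∃ r : GaussianInt, q = r ^ 2) →
          DifferentiableOn ℂ (Di q) {w : ℂ | 1 < w.re}) ∧
        ((∃ r : GaussianInt, q = ig * r ^ 2) → ∃ c : ℂ, c ≠ 0 ∧
          Tendsto (fun w => (w - 3 / 2) * D1 q w) (𝓝[≠] ((3 : ℂ) / 2)) (𝓝 c)) ∧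
        ((∃ r : GaussianInt, q = r ^ 2) → ∃ c : ℂ, c ≠ 0 ∧
          Tendsto (fun w => (w - 3 / 2) * Di q w) (𝓝[≠] ((3 : ℂ) / 2)) (𝓝 c))) ∧
      ∀ ε : ℝ, 0 < ε → ∃ C : ℝ, 0 < C ∧ ∀ (q : GaussianInt) (w : ℂ), q ≠ 0 →
        1 + ε < w.re →
        ((∃ r : GaussianInt, q = ig * r ^ 2) → ε ≤ ‖w - 3 / 2‖) →
        ((∃ r : GaussianInt, q = r ^ 2) → ε ≤ ‖w - 3 / 2‖) →
        ‖D1 q w‖ ≤ C * ((1 + ‖w‖ ^ 2) * Nm q) ^ (max ((3 / 2 - w.re) / 2) 0 + ε) ∧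
        ‖Di q w‖ ≤ C * ((1 + ‖w‖ ^ 2) * Nm q) ^ (max ((3 / 2 - w.re) / 2) 0 + ε) := by
  obtain ⟨D1, h1, b1⟩ := D_main hχ hg (v := 1) isUnit_one
  obtain ⟨Di, hi, bi⟩ := D_main hχ hg (v := ig) isUnit_ig
  simp only [sq_iff_one] at h1 b1
  simp only [sq_iff_ig] at hi bi
  choose Ds hsd hss using Dsq_main hχ hg
  refine ⟨D1, Di, fun q w => if hq : q ≠ 0 then Ds q hq w else 0, ?_, ?_⟩
  · intro q hq
    obtain ⟨a1, a2, a3, a4⟩ := h1 q hq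
    obtain ⟨c1, c2, c3, c4⟩ := hi q hq
    refine ⟨fun w hw => ⟨?_, c1 w hw, ?_⟩, a2, c2, ?_, a3, c3, a4, c4⟩
    · rw [a1 w hw]
      refine tsum_congr fun m => ?_
      rw [chi_one_num hχ m.2, Int.cast_one, one_mul]
    · simp only [dif_pos hq]
      exact hss q hq w
    · simp only [dif_pos hq]
      exact (hsd q hq).differentiableOn
  · intro ε hε
    obtain ⟨C1, hC1, k1⟩ := b1 ε hε
    obtain ⟨C2, hC2, k2⟩ := bi ε hε
    refine ⟨C1 + C2, by positivity, fun q w hq hw hw1 hw2 => ?_⟩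
    have hX : 0 ≤ ((1 + ‖w‖ ^ 2) * Nm q) ^ (max ((3 / 2 - w.re) / 2) 0 + ε) :=
      Real.rpow_nonneg (mul_nonneg (by positivity) (Nm_nonneg q)) _
    refine ⟨(k1 q w hq hw hw1).trans ?_, (k2 q w hq hw hw2).trans ?_⟩
    · exact mul_le_mul_of_nonneg_right (by linarith) hX
    · exact mul_le_mul_of_nonneg_right (by linarith) hX
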